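/- arXiv:2012.11302 — 4 statements merged into one kernel-verified Lean document; each statement's English description precedes it below -/
import Mathlib

section
/- Let f(t,X) = (X²−7X+15)⁵(X²+15X+180)⁵(X²+4X+400) − t·X⁶(X−4)⁴, and write f(t,X) = f1(X) − t·f2(X) with f1(X) = (X²−7X+15)⁵(X²+15X+180)⁵(X²+4X+400) and f2(X) = X⁶(X−4)⁴. Then the polynomial f1(X)f2(Y) − f2(X)f1(Y) ∈ Q[X,Y] factors over Q(X) into irreducible factors of degrees 1 and 21 in Y; consequently a point stabilizer in the Galois group G = Gal(f/Q(t)) ≤ S22 has orbits of lengths 1 and 21, i.e., G is doubly transitive on the 22 roots. -/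
open Polynomial

/-- `f₁(X) = (X²−7X+15)⁵(X²+15X+180)⁵(X²+4X+400)` over `ℚ`. -/
noncomputable def f1Q : ℚ[X] :=
  (X ^ 2 - 7 * X + 15) ^ 5 * (X ^ 2 + 15 * X + 180) ^ 5 * (X ^ 2 + 4 * X + 400)

/-- `f₂(X) = X⁶(X−4)⁴` over `ℚ`. -/
noncomputable def f2Q : ℚ[X] := X ^ 6 * (X - 4) ^ 4

/-- `f(t,X) = f₁(X) − t·f₂(X)`, viewed as a polynomial in `X` over `ℚ(t)`. -/
noncomputable def fT : (RatFunc ℚ)[X] :=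
  f1Q.map (algebraMap ℚ (RatFunc ℚ)) - C RatFunc.X * f2Q.map (algebraMap ℚ (RatFunc ℚ))

/-- `f₁(X)f₂(Y) − f₂(X)f₁(Y)`, viewed as a polynomial in `Y` over `ℚ(X)`; here the field
`ℚ(X)` is `RatFunc ℚ` and `f₁(X), f₂(X)` are the images of `f₁, f₂` in `RatFunc ℚ`. -/
noncomputable def PXY : (RatFunc ℚ)[X] :=
  C (algebraMap ℚ[X] (RatFunc ℚ) f1Q) * f2Q.map (algebraMap ℚ (RatFunc ℚ))
    - C (algebraMap ℚ[X] (RatFunc ℚ) f2Q) * f1Q.map (algebraMap ℚ (RatFunc ℚ))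


namespace DT

def evalL {R : Type*} [CommRing R] : List ℤ → R → R
  | [], _ => 0
  | a :: l, x => (a : R) + x * evalL l x

def addL : List ℤ → List ℤ → List ℤ
  | [], m => m
  | l, [] => l
  | a :: l, b :: m => (a + b) :: addL l m

def smulL (c : ℤ) : List ℤ → List ℤ
  | [] => []
  | a :: l => (c * a) :: smulL c l

def mulL : List ℤ → List ℤ → List ℤ
  | [], _ => []
  | a :: l, m => addL (smulL a m) (0 :: mulL l m)

def powL (l : List ℤ) : ℕ → List ℤ
  | 0 => [1]
  | n + 1 => mulL l (powL l n)

def redL (p : ℤ) : List ℤ → List ℤ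
  | [] => []
  | a :: l => (a % p) :: redL p l

def zeroL (p : ℤ) : List ℤ → Bool
  | [] => true
  | a :: l => (a % p == 0) && zeroL p l

/-- the last entry -/
def lastL : List ℤ → ℤ
  | [] => 0
  | a :: l => match l with
    | [] => a
    | _ :: _ => lastL l

/-- everything but the last entry -/
def initL : List ℤ → List ℤ
  | [] => []
  | a :: l => match l with
    | [] => []
    | _ :: _ => a :: initL l

/-- evaluate a natural number before passing it on (`forceN n k = k n`) -/
def forceN {β : Type} (n : ℕ) (k : ℕ → β) : β :=
  match n with
  | 0 => k 0
  | m + 1 => k (m + 1)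

/-- evaluate an integer before passing it on -/
def forceZ {β : Type} (a : ℤ) (k : ℤ → β) : β :=
  match a with
  | Int.ofNat n => forceN n fun n => k (Int.ofNat n)
  | Int.negSucc n => forceN n fun n => k (Int.negSucc n)

/-- evaluate a list before passing it on -/
def forceL {β : Type} : List ℤ → (List ℤ → β) → β
  | [], k => k []
  | a :: l, k => forceZ a fun a => forceL l fun l => k (a :: l)

def mulXmod (n : ℕ) (m : List ℤ) (l : List ℤ) : List ℤ :=
  if l.length = n + 1 then addL (0 :: initL l) (smulL (lastL l) m) else 0 :: l

def mulmod (p : ℤ) (n : ℕ) (m : List ℤ) (a : List ℤ) : List ℤ → List ℤ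
  | [] => []
  | b :: l => forceL (mulmod p n m a l) fun acc =>
      redL p (addL (smulL b a) (mulXmod n m acc))

/-- value of a list of binary digits, least significant first -/
def bitsVal : List Bool → ℕ
  | [] => 0
  | b :: l => 2 * bitsVal l + (if b then 1 else 0)

def powmod (p : ℤ) (n : ℕ) (m : List ℤ) (a : List ℤ) : List Bool → List ℤ
  | [] => [1]
  | b :: k => forceL (powmod p n m a k) fun l => forceL (mulmod p n m l l) fun l =>
      if b then mulmod p n m a l else l

def frobIter (p : ℕ) (bs : List Bool) (n : ℕ) (m : List ℤ) : ℕ → List ℤ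
  | 0 => [0, 1]
  | k + 1 => forceL (frobIter p bs n m k) fun l => powmod p n m l bs

lemma forceN_eq {β : Type} (n : ℕ) (k : ℕ → β) : forceN n k = k n := by
  cases n <;> rfl

lemma forceZ_eq {β : Type} (n : ℤ) (k : ℤ → β) : forceZ n k = k n := by
  cases n <;> simp [forceZ, forceN_eq]

lemma forceL_eq {β : Type} (l : List ℤ) (k : List ℤ → β) : forceL l k = k l := by
  induction l generalizing k with
  | nil => rfl
  | cons a l ih => simp only [forceL, forceZ_eq, ih]

section
variable {R : Type*} [CommRing R] (x : R)

lemma evalL_addL (l m : List ℤ) : evalL (addL l m) x = evalL l x + evalL m x := by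
  induction l generalizing m with
  | nil => simp [addL, evalL]
  | cons a l ih =>
    cases m with
    | nil => simp [addL, evalL]
    | cons b m => simp only [addL, evalL, ih]; push_cast; ring

lemma evalL_smulL (c : ℤ) (l : List ℤ) : evalL (smulL c l) x = (c : R) * evalL l x := by
  induction l with
  | nil => simp [smulL, evalL]
  | cons a l ih => simp only [smulL, evalL, ih]; push_cast; ring

lemma evalL_mulL (l m : List ℤ) : evalL (mulL l m) x = evalL l x * evalL m x := by
  induction l with
  | nil => simp [mulL, evalL]
  | cons a l ih => simp only [mulL, evalL, evalL_addL, evalL_smulL, ih]; push_cast; ring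

lemma evalL_powL (l : List ℤ) (n : ℕ) : evalL (powL l n) x = evalL l x ^ n := by
  induction n with
  | zero => simp [powL, evalL]
  | succ n ih => simp only [powL, evalL_mulL, ih]; ring

lemma cast_mod {p : ℤ} (hp : (p : R) = 0) (a : ℤ) : ((a % p : ℤ) : R) = a := by
  have := congrArg (Int.cast : ℤ → R) (Int.emod_add_mul_ediv a p)
  push_cast at this
  rw [hp] at this
  simpa using this

lemma evalL_redL {p : ℤ} (hp : (p : R) = 0) (l : List ℤ) : evalL (redL p l) x = evalL l x := by
  induction l with
  | nil => rfl
  | cons a l ih => simp only [redL, evalL, ih, cast_mod hp]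

lemma evalL_zeroL {p : ℤ} (hp : (p : R) = 0) (l : List ℤ) (h : zeroL p l = true) :
    evalL l x = 0 := by
  induction l with
  | nil => rfl
  | cons a l ih =>
    simp only [zeroL, Bool.and_eq_true, beq_iff_eq] at h
    have := cast_mod hp a
    rw [h.1] at this
    simp only [evalL, ih h.2, ← this]
    simp

lemma evalL_initL (l : List ℤ) (k : ℕ) (hl : l.length = k + 1) :
    evalL l x = evalL (initL l) x + (lastL l : R) * x ^ k := by
  induction l generalizing k with
  | nil => simp at hl
  | cons a l ih =>
    cases l with
    | nil =>
      have : k = 0 := by simpa using hl.symm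
      subst this
      simp [initL, lastL, evalL]
    | cons b l =>
      cases k with
      | zero => simp at hl
      | succ k =>
        have := ih k (by simpa using hl)
        rw [evalL, this]
        simp only [initL, lastL, evalL]
        ring

lemma evalL_mulXmod (n : ℕ) (m l : List ℤ) (hm : x ^ (n + 1) = evalL m x) :
    evalL (mulXmod n m l) x = x * evalL l x := by
  unfold mulXmod
  split_ifs with h
  · rw [evalL_initL x l n h, evalL_addL, evalL_smulL, ← hm]
    simp only [evalL]
    push_cast
    ring
  · simp [evalL]

lemma evalL_mulmod {p : ℤ} (hp : (p : R) = 0) (n : ℕ) (m a l : List ℤ)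
    (hm : x ^ (n + 1) = evalL m x) :
    evalL (mulmod p n m a l) x = evalL a x * evalL l x := by
  induction l with
  | nil => simp [mulmod, evalL]
  | cons b l ih =>
    simp only [mulmod, forceL_eq, evalL_redL x hp, evalL_addL, evalL_smulL, evalL_mulXmod x n m _ hm, ih,
      evalL]
    ring

lemma evalL_powmod {p : ℤ} (hp : (p : R) = 0) (n : ℕ) (m a : List ℤ)
    (hm : x ^ (n + 1) = evalL m x) (k : List Bool) :
    evalL (powmod p n m a k) x = evalL a x ^ (bitsVal k) := by
  induction k with
  | nil => simp [powmod, evalL, bitsVal]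
  | cons b k ih =>
    cases b
    · simp [powmod, forceL_eq, evalL_mulmod x hp n m _ _ hm, ih, bitsVal]; ring
    · simp [powmod, forceL_eq, evalL_mulmod x hp n m _ _ hm, ih, bitsVal]; ring

lemma evalL_frobIter {p : ℕ} (hp : (p : R) = 0) (bs : List Bool) (hbs : bitsVal bs = p)
    (n : ℕ) (m : List ℤ) (hm : x ^ (n + 1) = evalL m x) (k : ℕ) :
    evalL (frobIter p bs n m k) x = x ^ (p ^ k) := by
  induction k with
  | zero => simp [frobIter, evalL]
  | succ k ih =>
    rw [frobIter, forceL_eq, evalL_powmod x (by exact_mod_cast hp) n m _ hm, ih, ← pow_mul,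
      pow_succ, hbs]

end
def m13 : List ℤ := [4, 4, 6, 6, 8, 0, 11, 2, 4, 6, 4, 11, 12, 12, 7, 7, 11, 3, 0, 8, 7]
def m11 : List ℤ := [10, 9, 10, 4, 0, 10, 7, 8, 8, 10, 10, 0, 3, 6, 3, 10, 0, 3, 6, 3]
lemma chk13 : zeroL 13 (addL (frobIter 13 [true,false,true,true] 20 m13 7) [0,-1]) = true := by decide +kernel
lemma chk11 : zeroL 11 (addL (frobIter 11 [true,true,false,true] 19 m11 5) [0,-1]) = true := by decide +kernel


/-- list version of `f₁` -/
def L1 : List ℤ := mulL (mulL (powL [15, -7, 1] 5) (powL [180, 15, 1] 5)) [400, 4, 1]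

/-- list version of `f₂` -/
def L2 : List ℤ := mulL (powL [0, 1] 6) (powL [-4, 1] 4)

/-- `X^k - m` as a list -/
def monL (k : ℕ) (m : List ℤ) : List ℤ := addL (powL [0, 1] k) (smulL (-1) m)

lemma fac13 : zeroL 13 (addL (addL (smulL 6 L2) (smulL (-3) L1))
    (mulL [-1, 1] (smulL 3 (monL 21 m13)))) = true := by decide +kernel

lemma fac11 : zeroL 11 (addL (addL (smulL 3 L2) (smulL (-3) L1))
    (mulL [-3, 1] (smulL 3 (mulL [-5, 1] (monL 20 m11))))) = true := by decide +kernel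

lemma noroot13 : ∀ a : ZMod 13, evalL (monL 21 m13) a ≠ 0 := by decide +kernel
lemma noroot11 : ∀ a : ZMod 11, evalL (monL 20 m11) a ≠ 0 := by decide +kernel

/-! ### The polynomials over a general commutative ring -/

noncomputable def F1 (R : Type*) [CommRing R] : R[X] :=
  (X ^ 2 - 7 * X + 15) ^ 5 * (X ^ 2 + 15 * X + 180) ^ 5 * (X ^ 2 + 4 * X + 400)

noncomputable def F2 (R : Type*) [CommRing R] : R[X] := X ^ 6 * (X - 4) ^ 4

noncomputable def PP (R : Type*) [CommRing R] (x : R) : R[X] :=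
  C ((F1 R).eval x) * F2 R - C ((F2 R).eval x) * F1 R

noncomputable def DD (R : Type*) [CommRing R] (x : R) : R[X] := PP R x /ₘ (X - C x)

section
variable {R S : Type*} [CommRing R] [CommRing S]

lemma F1_map (φ : R →+* S) : (F1 R).map φ = F1 S := by
  simp [F1]

lemma F2_map (φ : R →+* S) : (F2 R).map φ = F2 S := by
  simp [F2]

lemma PP_map (φ : R →+* S) (x : R) : (PP R x).map φ = PP S (φ x) := by
  have h1 : φ ((F1 R).eval x) = (F1 S).eval (φ x) := by
    rw [← F1_map φ, eval_map_apply]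
  have h2 : φ ((F2 R).eval x) = (F2 S).eval (φ x) := by
    rw [← F2_map φ, eval_map_apply]
  simp [PP, F1_map, F2_map, h1, h2]

lemma DD_map (φ : R →+* S) (x : R) : (DD R x).map φ = DD S (φ x) := by
  rw [DD, Polynomial.map_divByMonic _ (monic_X_sub_C x), PP_map]
  simp [DD]

lemma PP_eq (x : R) : PP R x = (X - C x) * DD R x := by
  rw [DD, mul_divByMonic_eq_iff_isRoot.mpr]
  simp [PP, IsRoot, mul_comm]

lemma F1_monic [Nontrivial R] : (F1 R).Monic ∧ (F1 R).natDegree = 22 := by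
  have h : ∀ a b : R, (X ^ 2 + C a * X + C b).Monic ∧ (X ^ 2 + C a * X + C b).natDegree = 2 := by
    intro a b
    constructor
    · monicity!
    · compute_degree!
  have e : F1 R = (X ^ 2 + C (-7) * X + C 15) ^ 5 * (X ^ 2 + C 15 * X + C 180) ^ 5 *
      (X ^ 2 + C 4 * X + C 400) := by
    simp only [F1, map_neg, map_ofNat]
    ring
  rw [e]
  have m1 := (h (-7) 15).1.pow 5
  have m2 := (h 15 180).1.pow 5
  have m3 := (h 4 400).1
  refine ⟨(m1.mul m2).mul m3, ?_⟩
  rw [(m1.mul m2).natDegree_mul m3, m1.natDegree_mul m2, (h (-7) 15).1.natDegree_pow,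
    (h 15 180).1.natDegree_pow, (h _ _).2, (h _ _).2, (h _ _).2]

lemma F2_natDegree : (F2 R).natDegree ≤ 10 := by
  unfold F2
  compute_degree

lemma PP_deg [Nontrivial R] (x : R) (hx : (F2 R).eval x ≠ 0) :
    (PP R x).natDegree = 22 ∧ (PP R x).leadingCoeff = - (F2 R).eval x := by
  have c22 : (PP R x).coeff 22 = - (F2 R).eval x := by
    have h1 : (F1 R).coeff 22 = 1 := by
      have := (F1_monic (R := R)).1
      rwa [Monic, leadingCoeff, F1_monic.2] at this
    have h2 : (F2 R).coeff 22 = 0 := coeff_eq_zero_of_natDegree_lt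
      (lt_of_le_of_lt F2_natDegree (by norm_num))
    simp [PP, h1, h2]
  have hd : (PP R x).natDegree ≤ 22 := by
    refine (natDegree_sub_le _ _).trans (max_le ?_ ?_)
    · exact (natDegree_C_mul_le _ _).trans (F2_natDegree.trans (by norm_num))
    · exact (natDegree_C_mul_le _ _).trans F1_monic.2.le
  have hd' : (PP R x).natDegree = 22 := le_antisymm hd
    (le_natDegree_of_ne_zero (by rw [c22]; exact neg_ne_zero.mpr hx))
  exact ⟨hd', by rw [leadingCoeff, hd', c22]⟩

lemma DD_deg [Nontrivial R] (x : R) (hx : (F2 R).eval x ≠ 0) :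
    (DD R x).natDegree = 21 ∧ (DD R x).leadingCoeff = - (F2 R).eval x := by
  have h := PP_deg x hx
  constructor
  · rw [DD, natDegree_divByMonic _ (monic_X_sub_C x), h.1, natDegree_X_sub_C]
  · rw [← h.2, PP_eq, leadingCoeff_monic_mul (monic_X_sub_C x)]

lemma F1_evalL : F1 R = evalL L1 (X : R[X]) := by
  simp only [L1, evalL_mulL, evalL_powL, F1, evalL]
  push_cast
  ring

lemma F2_evalL : F2 R = evalL L2 (X : R[X]) := by
  simp only [L2, evalL_mulL, evalL_powL, F2, evalL]
  push_cast
  ring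

lemma monL_evalL (x : R) (k : ℕ) (m : List ℤ) : evalL (monL k m) x = x ^ k - evalL m x := by
  simp only [monL, evalL_addL, evalL_powL, evalL_smulL, evalL]
  push_cast
  ring

lemma evalL_map (φ : R →+* S) (l : List ℤ) (x : R) : φ (evalL l x) = evalL l (φ x) := by
  induction l with
  | nil => simp [evalL]
  | cons a l ih => simp [evalL, ih]

end

/-- Degree-preserving transport of divisors (Gauss + reduction). -/
lemma transport {R K F : Type*} [CommRing R] [IsDomain R] [UniqueFactorizationMonoid R]
    [Field K] [Algebra R K] [IsFractionRing R K] [Field F] (φ : R →+* F) (D : R[X])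
    (hD : φ D.leadingCoeff ≠ 0) (g : K[X]) (hg : g ∣ D.map (algebraMap R K)) :
    ∃ g' : F[X], g' ∣ D.map φ ∧ g'.natDegree = g.natDegree := by
  classical
  have := Classical.arbitrary (NormalizedGCDMonoid R)
  have hD0 : D ≠ 0 := by
    rintro rfl
    simp at hD
  have hg0 : g ≠ 0 := by
    rintro rfl
    rw [zero_dvd_iff, Polynomial.map_eq_zero_iff (IsFractionRing.injective R K)] at hg
    exact hD0 hg
  obtain ⟨b, hb, hb'⟩ := IsLocalization.integerNormalization_spec (nonZeroDivisors R) g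
  set N := IsLocalization.integerNormalization (nonZeroDivisors R) g with hN
  have hb0 : algebraMap R K b ≠ 0 := IsFractionRing.to_map_ne_zero_of_mem_nonZeroDivisors hb
  have hbg : N.map (algebraMap R K) = C (algebraMap R K b) * g := by
    rw [hb', Algebra.smul_def, Polynomial.algebraMap_apply]
  have hN0 : N ≠ 0 := by
    intro h
    rw [h, Polynomial.map_zero] at hbg
    exact mul_ne_zero (C_ne_zero.mpr hb0) hg0 hbg.symm
  have hdeg : N.primPart.natDegree = g.natDegree := by
    rw [natDegree_primPart, ← natDegree_map_eq_of_injective (IsFractionRing.injective R K) N, hbg,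
      natDegree_C_mul hb0]
  have hdvdN : N.primPart.map (algebraMap R K) ∣ g := by
    have h1 : N.primPart.map (algebraMap R K) ∣ N.map (algebraMap R K) :=
      Polynomial.map_dvd _ N.primPart_dvd
    rw [hbg] at h1
    exact (IsUnit.dvd_mul_left (isUnit_C.mpr hb0.isUnit)).mp h1
  have hdvd : N.primPart ∣ D :=
    N.isPrimitive_primPart.dvd_of_fraction_map_dvd_fraction_map (hdvdN.trans hg)
  refine ⟨N.primPart.map φ, Polynomial.map_dvd _ hdvd, ?_⟩
  rw [← hdeg]
  apply natDegree_map_of_leadingCoeff_ne_zero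
  intro h
  obtain ⟨e, rfl⟩ := hdvd
  rw [leadingCoeff_mul, map_mul, h, zero_mul] at hD
  exact hD rfl

lemma transport_DD (p : ℕ) [Fact p.Prime] (x : ℤ) (hx : (F2 (ZMod p)).eval (x : ZMod p) ≠ 0)
    (g : (RatFunc ℚ)[X]) (hg : g ∣ DD (RatFunc ℚ) RatFunc.X) :
    ∃ g' : (ZMod p)[X], g' ∣ DD (ZMod p) x ∧ g'.natDegree = g.natDegree := by
  have hxp : Int.castRingHom (ZMod p) ((F2 ℤ).eval x) ≠ 0 := by
    rwa [← eval_map_apply, F2_map]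
  have hxZ : (F2 ℤ).eval x ≠ 0 := by
    intro h; rw [h] at hxp; simp at hxp
  have hxQ : evalRingHom (x : ℚ) ((F2 ℚ[X]).eval X) ≠ 0 := by
    rw [← eval_map_apply, F2_map]
    have : (F2 ℚ).eval (x : ℚ) = Int.castRingHom ℚ ((F2 ℤ).eval x) := by
      rw [← eval_map_apply, F2_map]; simp
    simpa [this] using hxZ
  have hxX : (F2 ℚ[X]).eval X ≠ 0 := by
    intro h; rw [h] at hxQ; simp at hxQ
  obtain ⟨g1, h1, d1⟩ := transport (K := RatFunc ℚ) (evalRingHom (x : ℚ)) (DD ℚ[X] X)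
    (by rw [(DD_deg _ hxX).2, map_neg]; exact neg_ne_zero.mpr hxQ) g
    (by rw [DD_map, RatFunc.algebraMap_X]; exact hg)
  obtain ⟨g2, h2, d2⟩ := transport (K := ℚ) (Int.castRingHom (ZMod p)) (DD ℤ x)
    (by rw [(DD_deg _ hxZ).2, map_neg]; exact neg_ne_zero.mpr hxp) g1
    (by rw [DD_map] at h1 ⊢; simpa using h1)
  refine ⟨g2, by simpa [DD_map] using h2, d2.trans d1⟩

lemma dvd_degree (p n : ℕ) [Fact p.Prime] (hn : n.Prime) (D : (ZMod p)[X]) (hD : D ≠ 0)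
    (hdiv : D ∣ X ^ p ^ n - X) (hroot : ∀ a, D.eval a ≠ 0) (g : (ZMod p)[X]) (hg : g ∣ D) :
    n ∣ g.natDegree := by
  have key : ∀ g : (ZMod p)[X], g ∣ D → n ∣ g.natDegree := by
    intro g
    induction g using WfDvdMonoid.induction_on_irreducible with
    | zero => intro _; simp
    | unit u hu => intro _; rw [natDegree_eq_zero_of_isUnit hu]; exact dvd_zero n
    | mul a i ha hi ih =>
      intro h
      rw [natDegree_mul hi.ne_zero ha]
      refine dvd_add ?_ (ih ((dvd_mul_left _ _).trans h))
      have hiD : i ∣ D := (dvd_mul_right _ _).trans h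
      have h1 : i.natDegree ∣ n := by
        apply hi.natDegree_dvd_of_dvd_X_pow_card_pow_sub_X
        simpa using hiD.trans hdiv
      rcases (Nat.dvd_prime hn).mp h1 with h2 | h2
      · exfalso
        obtain ⟨r, hr⟩ := exists_root_of_degree_eq_one
          ((degree_eq_iff_natDegree_eq_of_pos one_pos).mpr h2)
        exact hroot r (by
          obtain ⟨e, rfl⟩ := hiD
          rw [eval_mul, hr.eq_zero, zero_mul])
      · rw [h2]
  exact key g hg

lemma dvd_of_list (p n k : ℕ) [Fact p.Prime] (bs : List Bool) (hbs : bitsVal bs = p) (m : List ℤ)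
    (h : zeroL p (addL (frobIter p bs n m k) [0, -1]) = true) :
    evalL (monL (n + 1) m) (X : (ZMod p)[X]) ∣ X ^ p ^ k - X := by
  set M := evalL (monL (n + 1) m) (X : (ZMod p)[X]) with hM
  have hp : ((p : ℕ) : AdjoinRoot M) = 0 := by
    have : ((p : ℕ) : ZMod p) = 0 := by simp
    have h2 := congrArg (algebraMap (ZMod p) (AdjoinRoot M)) this
    rwa [map_natCast, map_zero] at h2
  have hm : (AdjoinRoot.mk M X) ^ (n + 1) = evalL m (AdjoinRoot.mk M X) := by
    have h0 : AdjoinRoot.mk M M = 0 := AdjoinRoot.mk_self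
    rw [show AdjoinRoot.mk M M = AdjoinRoot.mk M (evalL (monL (n + 1) m) (X : (ZMod p)[X])) from
      by rw [← hM], evalL_map, monL_evalL] at h0
    exact sub_eq_zero.mp h0
  have h1 := evalL_zeroL (AdjoinRoot.mk M X) (p := (p : ℤ)) (by exact_mod_cast hp) _ h
  rw [evalL_addL, evalL_frobIter _ hp bs hbs n m hm] at h1
  rw [← AdjoinRoot.mk_eq_zero, map_sub, map_pow]
  simp only [evalL] at h1
  push_cast at h1
  rw [← h1]; ring

instance : Fact (Nat.Prime 13) := ⟨by norm_num⟩
instance : Fact (Nat.Prime 11) := ⟨by norm_num⟩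

lemma natDegree_mod7 (g : (RatFunc ℚ)[X]) (hg : g ∣ DD (RatFunc ℚ) RatFunc.X) :
    7 ∣ g.natDegree := by
  have e2 : (F2 (ZMod 13)).eval ((1 : ℤ) : ZMod 13) = 3 := by
    simp [F2]; decide
  have e1 : (F1 (ZMod 13)).eval ((1 : ℤ) : ZMod 13) = 6 := by
    simp [F1]; decide
  obtain ⟨g', h, d⟩ := transport_DD 13 1 (by rw [e2]; decide) g hg
  rw [← d]
  have hDD : DD (ZMod 13) ((1 : ℤ) : ZMod 13) = C (-3) * evalL (monL 21 m13) X := by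
    have hf := evalL_zeroL (X : (ZMod 13)[X]) (p := 13)
      (by exact_mod_cast CharP.cast_eq_zero ((ZMod 13)[X]) 13) _ fac13
    apply mul_left_cancel₀ (X_sub_C_ne_zero ((1 : ℤ) : ZMod 13))
    rw [← PP_eq, PP, e1, e2, F1_evalL, F2_evalL]
    simp only [evalL_addL, evalL_smulL, evalL_mulL] at hf
    rw [evalL, evalL, evalL] at hf
    push_cast at hf
    simp only [map_neg, map_ofNat, Int.cast_one, map_one]
    linear_combination hf
  rw [hDD] at h
  refine dvd_degree 13 7 (by norm_num) (evalL (monL 21 m13) X) ?_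
    (dvd_of_list 13 20 7 _ (by rfl) m13 chk13) ?_ g' ?_
  · intro h0
    rw [h0, mul_zero] at hDD
    have := (DD_deg ((1 : ℤ) : ZMod 13) (by rw [e2]; decide)).1
    rw [hDD] at this
    simp at this
  · intro a
    have := evalL_map (evalRingHom a) (monL 21 m13) X
    simp only [coe_evalRingHom, eval_X] at this
    rw [this]
    exact noroot13 a
  · exact (IsUnit.dvd_mul_left (isUnit_C.mpr (Ne.isUnit (by decide)))).mp h

lemma natDegree_mod5 (g : (RatFunc ℚ)[X]) (hg : g ∣ DD (RatFunc ℚ) RatFunc.X) :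
    g.natDegree % 5 = 0 ∨ g.natDegree % 5 = 1 := by
  have e2 : (F2 (ZMod 11)).eval ((3 : ℤ) : ZMod 11) = 3 := by
    simp [F2]; decide
  have e1 : (F1 (ZMod 11)).eval ((3 : ℤ) : ZMod 11) = 3 := by
    simp [F1]; decide
  obtain ⟨g', h, d⟩ := transport_DD 11 3 (by rw [e2]; decide) g hg
  rw [← d]
  have hDD : DD (ZMod 11) ((3 : ℤ) : ZMod 11) =
      C (-3) * ((X - C 5) * evalL (monL 20 m11) X) := by
    have hf := evalL_zeroL (X : (ZMod 11)[X]) (p := 11)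
      (by exact_mod_cast CharP.cast_eq_zero ((ZMod 11)[X]) 11) _ fac11
    apply mul_left_cancel₀ (X_sub_C_ne_zero ((3 : ℤ) : ZMod 11))
    rw [← PP_eq, PP, e1, e2, F1_evalL, F2_evalL]
    simp only [evalL_addL, evalL_smulL, evalL_mulL] at hf
    rw [evalL, evalL, evalL, evalL, evalL, evalL] at hf
    push_cast at hf
    simp only [map_neg, map_ofNat, Int.cast_ofNat]
    linear_combination hf
  have h0 : DD (ZMod 11) ((3 : ℤ) : ZMod 11) ≠ 0 := by
    intro h0
    have := (DD_deg ((3 : ℤ) : ZMod 11) (by rw [e2]; decide)).1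
    rw [h0] at this
    simp at this
  rw [hDD] at h h0
  have hM := right_ne_zero_of_mul (right_ne_zero_of_mul h0)
  obtain ⟨a, b, ha, hb, rfl⟩ := exists_dvd_and_dvd_of_dvd_mul
    ((IsUnit.dvd_mul_left (isUnit_C.mpr (Ne.isUnit (by decide)))).mp h)
  have hb5 := dvd_degree 11 5 (by norm_num) (evalL (monL 20 m11) X) hM
    (dvd_of_list 11 19 5 _ (by rfl) m11 chk11) (by
      intro a
      have := evalL_map (evalRingHom a) (monL 20 m11) X
      simp only [coe_evalRingHom, eval_X] at this
      rw [this]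
      exact noroot11 a) b hb
  have ha1 := natDegree_le_of_dvd ha (X_sub_C_ne_zero _)
  rw [natDegree_X_sub_C] at ha1
  rw [natDegree_mul (ne_zero_of_dvd_ne_zero (X_sub_C_ne_zero _) ha)
    (ne_zero_of_dvd_ne_zero hM hb)]
  omega

lemma F2_X_ne : (F2 (RatFunc ℚ)).eval RatFunc.X ≠ 0 := by
  have h := RatFunc.algebraMap_ne_zero (K := ℚ) (x := X ^ 6 * (X - C 4) ^ 4)
    (mul_ne_zero (pow_ne_zero _ X_ne_zero) (pow_ne_zero _ (X_sub_C_ne_zero _)))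
  simpa [F2] using h

lemma DD_irr : Irreducible (DD (RatFunc ℚ) RatFunc.X) := by
  have hd := (DD_deg (RatFunc.X : RatFunc ℚ) F2_X_ne).1
  have h0 : DD (RatFunc ℚ) RatFunc.X ≠ 0 := by
    intro h; rw [h] at hd; simp at hd
  refine ⟨fun h => ?_, fun a b hab => ?_⟩
  · rw [natDegree_eq_zero_of_isUnit h] at hd; omega
  · have ha7 := natDegree_mod7 a (Dvd.intro _ hab.symm)
    have ha5 := natDegree_mod5 a (Dvd.intro _ hab.symm)
    have hb5 := natDegree_mod5 b (Dvd.intro_left _ hab.symm)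
    rw [hab] at h0 hd
    have ha0 := left_ne_zero_of_mul h0
    have hb0 := right_ne_zero_of_mul h0
    rw [natDegree_mul ha0 hb0] at hd
    have : a.natDegree = 0 ∨ b.natDegree = 0 := by omega
    rcases this with h | h
    · left
      exact isUnit_iff_degree_eq_zero.mpr (by rw [degree_eq_natDegree ha0, h]; rfl)
    · right
      exact isUnit_iff_degree_eq_zero.mpr (by rw [degree_eq_natDegree hb0, h]; rfl)


end DT

open DT in
lemma PXY_eq_PP : PXY = PP (RatFunc ℚ) RatFunc.X := by
  have e1 : f1Q = F1 ℚ := rfl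
  have e2 : f2Q = F2 ℚ := rfl
  have h1 : algebraMap ℚ[X] (RatFunc ℚ) (F1 ℚ) = (F1 (RatFunc ℚ)).eval RatFunc.X := by
    simp [F1, map_ofNat (algebraMap ℚ[X] (RatFunc ℚ))]
  have h2 : algebraMap ℚ[X] (RatFunc ℚ) (F2 ℚ) = (F2 (RatFunc ℚ)).eval RatFunc.X := by
    simp [F2, map_ofNat (algebraMap ℚ[X] (RatFunc ℚ))]
  rw [PXY, PP, e1, e2, F1_map, F2_map, h1, h2]

namespace DT

lemma fT_eq : fT = F1 (RatFunc ℚ) - C RatFunc.X * F2 (RatFunc ℚ) := by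
  have e1 : f1Q = F1 ℚ := rfl
  have e2 : f2Q = F2 ℚ := rfl
  rw [fT, e1, e2, F1_map, F2_map]

/-- `F₁, F₂` have no common roots in a field of characteristic zero. -/
lemma no_common {K : Type*} [Field K] [CharZero K] (a : K) (h2 : (F2 K).eval a = 0) :
    (F1 K).eval a ≠ 0 := by
  have : a = 0 ∨ a = 4 := by
    simp [F2] at h2
    rcases h2 with h | h
    · exact Or.inl h
    · exact Or.inr (sub_eq_zero.mp h)
  rcases this with rfl | rfl
  · simp [F1]
  · simp [F1]; norm_num

section
variable {K : Type*} [Field K] [Algebra (RatFunc ℚ) K]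

lemma root_iff (a : K) : aeval a fT = 0 ↔
    (F1 K).eval a = algebraMap (RatFunc ℚ) K RatFunc.X * (F2 K).eval a := by
  rw [fT_eq, aeval_def, eval₂_eq_eval_map, Polynomial.map_sub, Polynomial.map_mul, F1_map, F2_map,
    map_C, eval_sub, eval_mul, eval_C, sub_eq_zero]

lemma charZeroK : CharZero K := charZero_of_injective_algebraMap (algebraMap (RatFunc ℚ) K).injective

lemma root_F2_ne (a : K) (ha : aeval a fT = 0) : (F2 K).eval a ≠ 0 := by
  haveI : CharZero K := charZeroK
  intro h
  rw [root_iff, h, mul_zero] at ha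
  exact no_common a h ha

lemma root_t (a : K) (ha : aeval a fT = 0) :
    algebraMap (RatFunc ℚ) K RatFunc.X = (F1 K).eval a / (F2 K).eval a := by
  rw [eq_div_iff (root_F2_ne a ha), ← (root_iff a).mp ha]

/-- every root of `f` is transcendental over `ℚ` -/
lemma root_inj (a : K) (ha : aeval a fT = 0) (φ : ℚ[X] →+* K) (hφ : φ X = a) :
    Function.Injective φ := by
  haveI : CharZero K := charZeroK
  letI : Algebra ℚ K := DivisionRing.toRatAlgebra
  have hφ' : ∀ q : ℚ[X], φ q = aeval a q := by
    intro q
    have : φ = (aeval a : ℚ[X] →ₐ[ℚ] K).toRingHom := by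
      apply Polynomial.ringHom_ext
      · intro r
        have h1 : φ (C r) = (r : K) := map_ratCast (φ.comp C) r
        simp [h1]
      · simp [hφ]
    rw [this]; rfl
  have htr : Transcendental ℚ (algebraMap (RatFunc ℚ) K RatFunc.X) := by
    rw [transcendental_iff]
    intro q hq
    have : aeval (algebraMap (RatFunc ℚ) K RatFunc.X) q
        = algebraMap (RatFunc ℚ) K (algebraMap ℚ[X] (RatFunc ℚ) q) := by
      have e : (aeval (algebraMap (RatFunc ℚ) K RatFunc.X) : ℚ[X] →ₐ[ℚ] K).toRingHom
        = (algebraMap (RatFunc ℚ) K).comp (algebraMap ℚ[X] (RatFunc ℚ)) := by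
        apply Polynomial.ringHom_ext
        · intro r; simp
        · simp
      exact congrArg (fun ψ : ℚ[X] →+* K => ψ q) e
    rw [this, map_eq_zero] at hq
    by_contra h
    exact RatFunc.algebraMap_ne_zero h hq
  have htra : Transcendental ℚ a := by
    intro halg
    apply htr
    rw [root_t a ha]
    have hF : ∀ q : ℚ[X], IsAlgebraic ℚ ((q.map (algebraMap ℚ K)).eval a) := by
      intro q
      rw [eval_map_algebraMap]
      by_contra hc
      exact (transcendental_aeval_iff.mp hc).1 halg
    rw [← F1_map (algebraMap ℚ K), ← F2_map (algebraMap ℚ K), div_eq_mul_inv]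
    exact (hF _).mul (hF _).inv
  rw [injective_iff_map_eq_zero]
  intro q hq
  rw [hφ'] at hq
  exact (transcendental_iff.mp htra) q hq

end

section
variable {K : Type*} [Field K] [Algebra (RatFunc ℚ) K]

lemma root_PP (a b : K) (ha : aeval a fT = 0) :
    (PP K a).eval b = 0 ↔ aeval b fT = 0 := by
  have h := root_F2_ne a ha
  have h1 := (root_iff a).mp ha
  rw [root_iff, PP, h1]
  simp only [eval_sub, eval_mul, eval_C]
  constructor
  · intro h2
    have : (F2 K).eval a * (algebraMap (RatFunc ℚ) K RatFunc.X * (F2 K).eval b - (F1 K).eval b) = 0 := by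
      linear_combination h2
    rcases mul_eq_zero.mp this with h3 | h3
    · exact absurd h3 h
    · linear_combination -h3
  · intro h2
    rw [h2]; ring

lemma PP_fT (a : K) (ha : aeval a fT = 0) :
    PP K a = C (-(F2 K).eval a) * fT.map (algebraMap (RatFunc ℚ) K) := by
  have h1 := (root_iff a).mp ha
  rw [PP, h1, fT_eq, Polynomial.map_sub, Polynomial.map_mul, F1_map, F2_map, map_C]
  simp only [C_mul, C_neg]
  ring

open IntermediateField in
/-- If `E = ℚ(t)(a)`, then `E = ℚ(a)`, whence the irreducibility. -/
lemma DD_gen_irr (a : K) (ha : aeval a fT = 0) :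
    Irreducible (DD (RatFunc ℚ)⟮a⟯ (AdjoinSimple.gen (RatFunc ℚ) a)) := by
  set g := AdjoinSimple.gen (RatFunc ℚ) a with hgdef
  have hg : algebraMap (RatFunc ℚ)⟮a⟯ K g = a := AdjoinSimple.algebraMap_gen _ _
  have hgr : aeval g fT = 0 := by
    apply (algebraMap (RatFunc ℚ)⟮a⟯ K).injective
    rw [← aeval_algebraMap_apply, hg, ha, map_zero]
  let φ : ℚ[X] →+* (RatFunc ℚ)⟮a⟯ :=
    eval₂RingHom ((algebraMap (RatFunc ℚ) (RatFunc ℚ)⟮a⟯).comp (algebraMap ℚ (RatFunc ℚ))) g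
  have hφX : φ X = g := by simp [φ]
  have hφ : Function.Injective φ := root_inj g hgr φ hφX
  let ψ : RatFunc ℚ →+* (RatFunc ℚ)⟮a⟯ := IsFractionRing.lift hφ
  have hψ : ∀ q : ℚ[X], ψ (algebraMap ℚ[X] (RatFunc ℚ) q) = φ q :=
    fun q => IsFractionRing.lift_algebraMap hφ q
  have hψX : ψ RatFunc.X = g := by rw [← RatFunc.algebraMap_X, hψ, hφX]
  -- the range of `ψ` in `K`
  let R : Subfield K := ((algebraMap (RatFunc ℚ)⟮a⟯ K).comp ψ).fieldRange
  have haR : a ∈ R := ⟨RatFunc.X, by rw [RingHom.comp_apply, hψX, hg]⟩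
  have htR : algebraMap (RatFunc ℚ) K RatFunc.X ∈ R := by
    rw [root_t a ha]
    refine div_mem ⟨(F1 (RatFunc ℚ)).eval RatFunc.X, ?_⟩ ⟨(F2 (RatFunc ℚ)).eval RatFunc.X, ?_⟩
    · rw [← eval₂_at_apply, eval₂_eq_eval_map, F1_map, RingHom.comp_apply, hψX, hg]
    · rw [← eval₂_at_apply, eval₂_eq_eval_map, F2_map, RingHom.comp_apply, hψX, hg]
  have hpR : ∀ q : ℚ[X], algebraMap (RatFunc ℚ) K (algebraMap ℚ[X] (RatFunc ℚ) q) ∈ R := by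
    intro q
    induction q using Polynomial.induction_on' with
    | add p q hp hq => rw [map_add, map_add]; exact add_mem hp hq
    | monomial n r =>
      rw [← C_mul_X_pow_eq_monomial, map_mul, map_mul, map_pow, map_pow, RatFunc.algebraMap_X]
      refine mul_mem ?_ (pow_mem htR n)
      have : algebraMap (RatFunc ℚ) K (algebraMap ℚ[X] (RatFunc ℚ) (C r)) = (r : K) :=
        map_ratCast (((algebraMap (RatFunc ℚ) K).comp (algebraMap ℚ[X] (RatFunc ℚ))).comp C) r
      rw [this]
      exact SubfieldClass.ratCast_mem R r
  have hFR : ∀ z : RatFunc ℚ, algebraMap (RatFunc ℚ) K z ∈ R := by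
    intro z
    induction z using RatFunc.induction_on with
    | f p q hq => rw [map_div₀]; exact div_mem (hpR p) (hpR q)
  have hall : ∀ x ∈ (RatFunc ℚ)⟮a⟯, x ∈ R := by
    intro x hx
    induction hx using IntermediateField.adjoin_induction with
    | mem x hx => rw [Set.mem_singleton_iff.mp hx]; exact haR
    | algebraMap x => exact hFR x
    | add x y _ _ hx hy => exact add_mem hx hy
    | inv x _ hx => exact inv_mem hx
    | mul x y _ _ hx hy => exact mul_mem hx hy
  have hsurj : Function.Surjective ψ := by
    intro y
    obtain ⟨z, hz⟩ := hall y y.2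
    exact ⟨z, (algebraMap (RatFunc ℚ)⟮a⟯ K).injective hz⟩
  let e : RatFunc ℚ ≃+* (RatFunc ℚ)⟮a⟯ := RingEquiv.ofBijective ψ ⟨ψ.injective, hsurj⟩
  have h := (MulEquiv.irreducible_iff (Polynomial.mapEquiv e)).mpr DD_irr
  have h2 : Polynomial.mapEquiv e (DD (RatFunc ℚ) RatFunc.X) = DD (RatFunc ℚ)⟮a⟯ g := by
    rw [← hψX, ← DD_map ψ]; rfl
  rwa [h2] at h

lemma aeval_DD_iff (a b : K) (ha : aeval a fT = 0) (hab : b ≠ a) :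
    (DD K a).eval b = 0 ↔ aeval b fT = 0 := by
  rw [← root_PP a b ha, PP_eq, eval_mul, mul_eq_zero]
  simp [sub_eq_zero, hab]

open IntermediateField in
lemma aeval_DD_gen (a b : K) :
    aeval b (DD (RatFunc ℚ)⟮a⟯ (AdjoinSimple.gen (RatFunc ℚ) a)) = (DD K a).eval b := by
  rw [aeval_def, eval₂_eq_eval_map, DD_map, AdjoinSimple.algebraMap_gen]

open IntermediateField in
lemma stab_trans [Normal (RatFunc ℚ) K] (a b d : K) (ha : aeval a fT = 0) (hb : aeval b fT = 0)
    (hd : aeval d fT = 0) (hab : b ≠ a) (had : d ≠ a) :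
    ∃ σ : K ≃ₐ[RatFunc ℚ] K, σ a = a ∧ σ b = d := by
  have hirr := DD_gen_irr a ha
  have hb' := (aeval_DD_gen a b).trans ((aeval_DD_iff a b ha hab).mpr hb)
  have hd' := (aeval_DD_gen a d).trans ((aeval_DD_iff a d ha had).mpr hd)
  have e1 := minpoly.eq_of_irreducible hirr hb'
  have e2 := minpoly.eq_of_irreducible hirr hd'
  haveI : Normal (RatFunc ℚ)⟮a⟯ K := Normal.tower_top_of_normal (RatFunc ℚ) _ K
  have halg : IsAlgebraic (RatFunc ℚ)⟮a⟯ d := ⟨_, hirr.ne_zero, hd'⟩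
  obtain ⟨σ, hσ⟩ := minpoly.exists_algEquiv_of_root (x := b) halg (by
    rw [← e2, e1]; exact minpoly.aeval _ _)
  refine ⟨σ.restrictScalars (RatFunc ℚ), ?_, hσ⟩
  have := σ.commutes (AdjoinSimple.gen (RatFunc ℚ) a)
  rw [AdjoinSimple.algebraMap_gen] at this
  exact this

open IntermediateField in
lemma third_root (hs : (fT.map (algebraMap (RatFunc ℚ) K)).Splits) (a c : K)
    (ha : aeval a fT = 0) :
    ∃ e : K, aeval e fT = 0 ∧ e ≠ a ∧ e ≠ c := by
  classical
  have hF2 := root_F2_ne a ha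
  have hirr := DD_gen_irr a ha
  set D := DD (RatFunc ℚ)⟮a⟯ (AdjoinSimple.gen (RatFunc ℚ) a) with hD
  haveI : CharZero (RatFunc ℚ)⟮a⟯ := charZeroK
  have hmap : D.map (algebraMap (RatFunc ℚ)⟮a⟯ K) = DD K a := by
    rw [hD, DD_map, AdjoinSimple.algebraMap_gen]
  have hsep : D.Separable := hirr.separable
  have hPP0 : PP K a ≠ 0 := by
    intro h
    have := PP_eq a
    rw [h] at this
    rcases mul_eq_zero.mp this.symm with h1 | h1
    · exact X_sub_C_ne_zero a h1
    · have := (DD_deg a hF2).1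
      rw [h1] at this
      simp at this
  have hsp : (D.map (algebraMap (RatFunc ℚ)⟮a⟯ K)).Splits := by
    rw [hmap]
    have hPs : (PP K a).Splits := by
      rw [PP_fT a ha]
      exact (Splits.C _).mul hs
    exact hPs.of_dvd hPP0 ⟨X - C a, by rw [PP_eq, mul_comm]⟩
  have hcard := card_rootSet_eq_natDegree (K := K) hsep hsp
  have hdeg : D.natDegree = 21 := by
    rw [← natDegree_map (algebraMap (RatFunc ℚ)⟮a⟯ K), hmap]
    exact (DD_deg a hF2).1
  rw [hdeg] at hcard
  by_contra! hcon
  have hsub : (D.rootSet K).toFinset ⊆ ({a, c} : Finset K) := by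
    intro x hx
    rw [Set.mem_toFinset, mem_rootSet] at hx
    rw [Finset.mem_insert, Finset.mem_singleton]
    by_contra! hx2
    exact hx2.2 (hcon x ((aeval_DD_iff a x ha hx2.1).mp ((aeval_DD_gen a x).symm.trans hx.2)) hx2.1)
  have h3 := Finset.card_le_card hsub
  rw [Set.toFinset_card, hcard] at h3
  have h4 := Finset.card_le_two (a := a) (b := c)
  omega

lemma two_trans [Normal (RatFunc ℚ) K] (hs : (fT.map (algebraMap (RatFunc ℚ) K)).Splits)
    (a b c d : K) (ha : aeval a fT = 0) (hb : aeval b fT = 0) (hc : aeval c fT = 0)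
    (hd : aeval d fT = 0) (hab : a ≠ b) (hcd : c ≠ d) :
    ∃ σ : K ≃ₐ[RatFunc ℚ] K, σ a = c ∧ σ b = d := by
  obtain ⟨e, he, hea, hec⟩ := third_root hs a c ha
  obtain ⟨τ, -, hτ⟩ := stab_trans e a c he ha hc hea.symm hec.symm
  have hτb : aeval (τ b) fT = 0 := by
    have := aeval_algHom_apply τ.toAlgHom b fT
    rw [hb, map_zero] at this
    exact this
  have hne : τ b ≠ c := by
    rw [← hτ]; exact fun h => hab (τ.injective h).symm
  obtain ⟨ρ, h1, h2⟩ := stab_trans c (τ b) d hc hτb hd hne hcd.symm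
  exact ⟨τ.trans ρ, by simp [hτ, h1], by simp [h2]⟩

end

end DT

/-- `f₁(X)f₂(Y) − f₂(X)f₁(Y)` factors over `ℚ(X)` into irreducible factors of degrees `1`
and `21` in `Y`; consequently a point stabilizer of `G = Gal(f/ℚ(t))` on the 22 roots has
orbits of lengths `1` and `21`, i.e., `G` is doubly transitive on the roots of `f`. -/
theorem factorization_degrees_one_and_21_and_doubly_transitive :
    (∃ p q : (RatFunc ℚ)[X], PXY = p * q ∧ Irreducible p ∧ Irreducible q ∧
      p.natDegree = 1 ∧ q.natDegree = 21) ∧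
    (∀ a b c d : fT.rootSet fT.SplittingField, a ≠ b → c ≠ d →
      ∃ σ : fT.Gal, σ • a = c ∧ σ • b = d) := by
  refine ⟨⟨X - C RatFunc.X, DT.DD (RatFunc ℚ) RatFunc.X, ?_, irreducible_X_sub_C _, DT.DD_irr,
    natDegree_X_sub_C _, (DT.DD_deg _ DT.F2_X_ne).1⟩, ?_⟩
  · rw [PXY_eq_PP, DT.PP_eq]
  · rintro ⟨a, ha⟩ ⟨b, hb⟩ ⟨c, hc⟩ ⟨d, hd⟩ hab hcd
    have hab' : a ≠ b := fun h => hab (Subtype.ext h)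
    have hcd' : c ≠ d := fun h => hcd (Subtype.ext h)
    obtain ⟨σ, h1, h2⟩ := DT.two_trans (SplittingField.splits fT) a b c d
      (mem_rootSet.mp ha).2 (mem_rootSet.mp hb).2 (mem_rootSet.mp hc).2 (mem_rootSet.mp hd).2
      hab' hcd'
    exact ⟨σ, Subtype.ext h1, Subtype.ext h2⟩
end

section
/- The polynomial g̃(X) = X⁸ + 38X⁷ + 783X⁶ + (9795/2)X⁵ − (42189/2)X⁴ − (1312335/2)X³ + (74121075/16)X² − (23674275/2)X + 12301875 ∈ Q[X] is irreducible over Q and its Galois group over Q is isomorphic to AGL₃(2) = 2³.PSL₃(2), a group of order 1344, in its natural degree-8 permutation action. -/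
open Polynomial

/-- The degree-8 polynomial
`X⁸ + 38X⁷ + 783X⁶ + (9795/2)X⁵ − (42189/2)X⁴ − (1312335/2)X³ + (74121075/16)X² −
(23674275/2)X + 12301875` over `ℚ`. -/
noncomputable def gTilde : ℚ[X] :=
  X ^ 8 + C (38 : ℚ) * X ^ 7 + C (783 : ℚ) * X ^ 6 + C (9795 / 2 : ℚ) * X ^ 5
    - C (42189 / 2 : ℚ) * X ^ 4 - C (1312335 / 2 : ℚ) * X ^ 3
    + C (74121075 / 16 : ℚ) * X ^ 2 - C (23674275 / 2 : ℚ) * X + C (12301875 : ℚ)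

/-- The affine space `F₂³`. -/
abbrev V3 : Type := Fin 3 → ZMod 2

/-- The affine general linear group `AGL₃(2) = 2³.PSL₃(2)`, of order 1344, in its natural
degree-8 action on `F₂³`. -/
abbrev AGL32 : Type := V3 ≃ᵃ[ZMod 2] V3

open NumberField

set_option linter.unusedSimpArgs false

/-- Every elementary transvection of `F₂³` is a square. -/
theorem transvection_sq : ∀ i j : Fin 3, i ≠ j → ∀ c : ZMod 2,
    ∃ N : Matrix (Fin 3) (Fin 3) (ZMod 2), N * N = Matrix.transvection i j c := by
  intro i j hij c
  obtain ⟨k, hki, hkj⟩ : ∃ k : Fin 3, k ≠ i ∧ k ≠ j := by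
    revert i j; decide
  refine ⟨1 + Matrix.single i k c + Matrix.single k j 1, ?_⟩
  revert i j k c
  decide +kernel

/-- A subgroup of `GL₃(2)` whose order is divisible by 84 is everything. -/
theorem GL32_subgroup_eq_top (K : Subgroup (GL (Fin 3) (ZMod 2))) (h : 84 ∣ Nat.card K) :
    K = ⊤ := by
  have hc : Nat.card (GL (Fin 3) (ZMod 2)) = 168 := by
    rw [Matrix.card_GL_field]
    simp [Fin.prod_univ_three]
  have hidx : K.index ∣ 2 := by
    have h1 := K.card_mul_index
    rw [hc] at h1
    obtain ⟨m, hm⟩ := h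
    rw [hm] at h1
    exact ⟨m, by nlinarith⟩
  have hsq : ∀ g : GL (Fin 3) (ZMod 2), g * g ∈ K := by
    intro g
    rcases (Nat.dvd_prime Nat.prime_two).1 hidx with h1 | h2
    · rw [Subgroup.index_eq_one] at h1; simp [h1]
    · exact Subgroup.mul_self_mem_of_index_two h2 g
  have key : ∀ M : Matrix (Fin 3) (Fin 3) (ZMod 2), M.det ≠ 0 → ∃ g ∈ K, (g : Matrix _ _ _) = M := by
    intro M hM
    refine Matrix.diagonal_transvection_induction_of_det_ne_zero
      (fun M => ∃ g ∈ K, (g : Matrix _ _ _) = M) M hM ?_ ?_ ?_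
    · intro D hD
      refine ⟨1, K.one_mem, ?_⟩
      have : D = fun _ => 1 := by
        rw [Matrix.det_diagonal] at hD
        funext i
        have := Finset.prod_ne_zero_iff.1 hD i (Finset.mem_univ i)
        generalize D i = d at this
        revert d; decide
      rw [this]; simp
    · rintro ⟨i, j, hij, c⟩
      obtain ⟨N, hN⟩ := transvection_sq i j hij c
      have hdet : IsUnit N.det := by
        have := congrArg Matrix.det hN
        rw [Matrix.det_mul, Matrix.det_transvection_of_ne _ _ hij] at this
        exact IsUnit.of_mul_eq_one _ this
      refine ⟨_, hsq (Matrix.nonsingInvUnit N hdet), ?_⟩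
      exact hN
    · rintro A B _ _ ⟨g, hg, rfl⟩ ⟨g', hg', rfl⟩
      exact ⟨g * g', K.mul_mem hg hg', rfl⟩
  rw [eq_top_iff]
  intro g _
  obtain ⟨g', hg', h⟩ := key g (by
    have := (Matrix.isUnit_iff_isUnit_det _).1 g.isUnit
    exact this.ne_zero)
  rwa [← Units.ext h]

/-- Group theoretic criterion. -/
theorem group_criterion {G R : Type} [Group G] [Finite G] [MulAction G R] [FaithfulSMul G R]
    [MulAction.IsPretransitive G R]
    (e : R ≃ V3) (haff : ∀ g : G, ∃ A : AGL32, ∀ r, e (g • r) = A (e r))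
    (g7 g3 g4 : G) (h7 : orderOf g7 = 7) (h3 : orderOf g3 = 3) (h4 : orderOf g4 = 4)
    (f7 : ∃ r : R, g7 • r = r) (f3 : ∃ r : R, g3 • r = r) (f4 : ∃ r : R, g4 • r = r) :
    ∃ iso : G ≃* AGL32, ∀ (g : G) (r : R), e (g • r) = iso g (e r) := by
  choose A hA using haff
  have hA' : ∀ g x, A g x = e (g • e.symm x) := fun g x => by rw [hA]; simp
  let φ : G →* AGL32 :=
    { toFun := A
      map_one' := by ext1 x; rw [hA']; simp
      map_mul' := fun g h => by
        ext1 x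
        change A (g * h) x = A g (A h x)
        rw [hA', hA', hA', mul_smul]; simp }
  have hφ : ∀ g x, φ g x = e (g • e.symm x) := hA'
  have hφ2 : ∀ g r, e (g • r) = φ g (e r) := hA
  have hinj : Function.Injective φ := by
    intro g h hgh
    apply FaithfulSMul.eq_of_smul_eq_smul (α := R)
    intro r
    apply e.injective
    rw [hφ2, hφ2, hgh]
  set r0 : R := e.symm 0 with hr0
  let H := MulAction.stabilizer G r0
  have hH0 : ∀ h : H, φ h 0 = 0 := by
    intro h
    have : (h : G) • r0 = r0 := h.2
    rw [hφ, ← hr0, this, hr0]; simp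
  have hdvd : ∀ g : G, (∃ r : R, g • r = r) → orderOf g ∣ Nat.card H := by
    rintro g ⟨r, hr⟩
    obtain ⟨k, hk⟩ := MulAction.exists_smul_eq G r r0
    have hmem : k * g * k⁻¹ ∈ H := by
      rw [MulAction.mem_stabilizer_iff, ← hk]
      simp [mul_smul, hr]
    have : orderOf (k * g * k⁻¹) = orderOf g := by
      have := orderOf_injective (MulAut.conj k).toMonoidHom (MulAut.conj k).injective g
      simpa using this
    rw [← this]
    have h2 := orderOf_dvd_natCard (⟨_, hmem⟩ : H)
    rwa [← Subgroup.orderOf_coe] at h2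
  have h84 : 84 ∣ Nat.card H := by
    have a := hdvd _ f7
    have b := hdvd _ f3
    have c := hdvd _ f4
    rw [h7] at a; rw [h3] at b; rw [h4] at c
    omega
  let ψ : H →* GL (Fin 3) (ZMod 2) :=
    (Matrix.GeneralLinearGroup.toLin.symm.toMonoidHom).comp
      ((LinearMap.GeneralLinearGroup.generalLinearEquiv (ZMod 2) V3).symm.toMonoidHom.comp
      ((AffineEquiv.linearHom).comp (φ.comp H.subtype)))
  have hlin : ∀ h : H, ∀ x, φ h x = (φ h).linear x := by
    intro h x
    have := (φ (h : G)).map_vadd 0 x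
    rw [hH0 h] at this
    simpa using this
  have hψinj : Function.Injective ψ := by
    intro a b hab
    have hab' : (φ (a : G)).linear = (φ (b : G)).linear := by
      have := Matrix.GeneralLinearGroup.toLin.symm.injective hab
      exact (LinearMap.GeneralLinearGroup.generalLinearEquiv (ZMod 2) V3).symm.injective this
    apply Subtype.ext
    apply hinj
    ext1 x
    rw [hlin, hlin, hab']
  have htop : ψ.range = ⊤ := by
    apply GL32_subgroup_eq_top
    rwa [← Nat.card_congr (MonoidHom.ofInjective hψinj).toEquiv]
  have hsurjlin : ∀ l : V3 ≃ₗ[ZMod 2] V3, ∃ h : H, (φ (h : G)).linear = l := by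
    intro l
    have : Matrix.GeneralLinearGroup.toLin.symm
      ((LinearMap.GeneralLinearGroup.generalLinearEquiv (ZMod 2) V3).symm l) ∈ ψ.range := by
      rw [htop]; trivial
    obtain ⟨h, hh⟩ := this
    refine ⟨h, ?_⟩
    have := Matrix.GeneralLinearGroup.toLin.symm.injective hh
    exact (LinearMap.GeneralLinearGroup.generalLinearEquiv (ZMod 2) V3).symm.injective this
  have hsurj : Function.Surjective φ := by
    intro B
    obtain ⟨g, hg⟩ := MulAction.exists_smul_eq G r0 (e.symm (B 0))
    have hg0 : φ g 0 = B 0 := by rw [hφ, ← hr0, hg]; simp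
    obtain ⟨h, hh⟩ := hsurjlin ((φ g)⁻¹ * B).linear
    refine ⟨g * h, ?_⟩
    have h0 : ((φ g)⁻¹ * B) 0 = 0 := by
      change (φ g)⁻¹ (B 0) = 0
      rw [← hg0]
      change ((φ g)⁻¹ * φ g) 0 = 0
      simp
    have : φ (h : G) = (φ g)⁻¹ * B := by
      ext1 x
      rw [hlin, hh]
      have := ((φ g)⁻¹ * B).map_vadd 0 x
      rw [h0] at this
      simpa using this.symm
    rw [map_mul, this]; simp
  exact ⟨MulEquiv.ofBijective φ ⟨hinj, hsurj⟩, fun g r => hφ2 g r⟩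

theorem pretransitive_criterion {G R : Type} [Group G] [MulAction G R] [Fintype R]
    (hcard : Fintype.card R = 8) (g7 t : G) (h7 : ∀ r : R, g7 ^ 7 • r = r)
    (h7' : ∃ r : R, g7 • r ≠ r) (ht : ∀ r : R, t • r ≠ r) : MulAction.IsPretransitive G R := by
  classical
  obtain ⟨r, hr⟩ := h7'
  have hall : ∀ s : R, s ∈ MulAction.orbit G r := by
    by_contra! hs
    obtain ⟨s, hs⟩ := hs
    have hper : MulAction.period g7 r = 7 := by
      have hd : MulAction.period g7 r ∣ 7 := MulAction.pow_smul_eq_iff_period_dvd.1 (h7 r)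
      rcases (Nat.dvd_prime (by norm_num)).1 hd with h1 | h1
      · exact absurd (MulAction.period_eq_one_iff.1 h1) hr
      · exact h1
    have hinj : Function.Injective (fun i : Fin 7 => g7 ^ (i : ℕ) • r) := by
      intro i j hij
      have h2 := Function.iterate_injOn_Iio_minimalPeriod (f := (g7 • · : R → R)) (x := r)
      have h3 : Function.minimalPeriod (g7 • · : R → R) r = 7 := by
        rw [← hper]; rfl
      rw [h3] at h2
      apply Fin.ext
      apply h2 i.2 j.2
      simpa [smul_iterate] using hij
    let S : Finset R := Finset.univ.image (fun i : Fin 7 => g7 ^ (i : ℕ) • r)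
    have hS : S.card = 7 := by
      rw [Finset.card_image_of_injective _ hinj]; simp
    have hSo : ∀ x ∈ S, x ∈ MulAction.orbit G r := by
      intro x hx
      obtain ⟨i, -, rfl⟩ := Finset.mem_image.1 hx
      exact ⟨_, rfl⟩
    have hts : t • s ∉ MulAction.orbit G r := by
      intro h
      apply hs
      have := MulAction.mem_orbit_of_mem_orbit t⁻¹ h
      rwa [inv_smul_smul] at this
    have h9 : (insert (t • s) (insert s S)).card = 9 := by
      rw [Finset.card_insert_of_notMem, Finset.card_insert_of_notMem, hS]
      · exact fun h => hs (hSo _ h)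
      · intro h
        rcases Finset.mem_insert.1 h with h | h
        · exact ht s h
        · exact hts (hSo _ h)
    have := Finset.card_le_univ (insert (t • s) (insert s S))
    omega
  constructor
  intro x y
  obtain ⟨g, rfl⟩ := hall x
  obtain ⟨h, rfl⟩ := hall y
  exact ⟨h * g⁻¹, by simp [mul_smul]⟩
/-- Polynomials of degree at most 7 with natural number coefficients. -/
structure P8 where
  a0 : ℕ
  a1 : ℕ
  a2 : ℕ
  a3 : ℕ
  a4 : ℕ
  a5 : ℕ
  a6 : ℕ
  a7 : ℕ
  deriving DecidableEq

namespace P8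

def add (p : ℕ) (a b : P8) : P8 :=
  ⟨(a.a0 + b.a0) % p, (a.a1 + b.a1) % p, (a.a2 + b.a2) % p, (a.a3 + b.a3) % p,
   (a.a4 + b.a4) % p, (a.a5 + b.a5) % p, (a.a6 + b.a6) % p, (a.a7 + b.a7) % p⟩

def smul (p : ℕ) (s : ℕ) (b : P8) : P8 :=
  ⟨(s * b.a0) % p, (s * b.a1) % p, (s * b.a2) % p, (s * b.a3) % p,
   (s * b.a4) % p, (s * b.a5) % p, (s * b.a6) % p, (s * b.a7) % p⟩

/-- Multiplication by the variable, modulo `X^8 = c`. -/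
def mulX (p : ℕ) (c a : P8) : P8 :=
  ⟨(a.a7 * c.a0) % p, (a.a0 + a.a7 * c.a1) % p, (a.a1 + a.a7 * c.a2) % p,
   (a.a2 + a.a7 * c.a3) % p, (a.a3 + a.a7 * c.a4) % p, (a.a4 + a.a7 * c.a5) % p,
   (a.a5 + a.a7 * c.a6) % p, (a.a6 + a.a7 * c.a7) % p⟩

def mul (p : ℕ) (c a b : P8) : P8 :=
  add p (smul p a.a0 b) (mulX p c (add p (smul p a.a1 b) (mulX p c
    (add p (smul p a.a2 b) (mulX p c (add p (smul p a.a3 b) (mulX p c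
    (add p (smul p a.a4 b) (mulX p c (add p (smul p a.a5 b) (mulX p c
    (add p (smul p a.a6 b) (mulX p c (smul p a.a7 b))))))))))))))

/-- Powers by square and multiply; the bits are listed from the least significant one. -/
def powB (p : ℕ) (c a : P8) : List Bool → P8
  | [] => ⟨1, 0, 0, 0, 0, 0, 0, 0⟩
  | b :: l =>
    let r := powB p c a l
    if b then mul p c a (mul p c r r) else mul p c r r

def ev {A : Type*} [CommRing A] (a : P8) (x : A) : A :=
  a.a0 + a.a1 * x + a.a2 * x ^ 2 + a.a3 * x ^ 3 + a.a4 * x ^ 4 + a.a5 * x ^ 5 + a.a6 * x ^ 6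
    + a.a7 * x ^ 7

def bitsVal : List Bool → ℕ
  | [] => 0
  | b :: l => (if b then 1 else 0) + 2 * bitsVal l

section
variable {A : Type*} [CommRing A] {p : ℕ} [CharP A p] {c : P8} {x : A}

theorem cast_mod (n : ℕ) : ((n % p : ℕ) : A) = n := by
  rw [CharP.cast_eq_mod A p n]

theorem ev_add (a b : P8) : ev (add p a b) x = ev a x + ev b x := by
  simp only [ev, add, cast_mod]; push_cast; ring

theorem ev_smul (s : ℕ) (b : P8) : ev (smul p s b) x = s * ev b x := by
  simp only [ev, smul, cast_mod]; push_cast; ring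

theorem ev_mulX (hx : x ^ 8 = ev c x) (a : P8) : ev (mulX p c a) x = x * ev a x := by
  simp only [ev, mulX, cast_mod] at *; push_cast; linear_combination (-(a.a7 : A)) * hx

theorem ev_mul (hx : x ^ 8 = ev c x) (a b : P8) : ev (mul p c a b) x = ev a x * ev b x := by
  simp only [mul, ev_add, ev_mulX hx, ev_smul]
  simp only [ev]; ring

theorem ev_powB (hx : x ^ 8 = ev c x) (a : P8) (l : List Bool) :
    ev (powB p c a l) x = ev a x ^ bitsVal l := by
  induction l with
  | nil => simp [powB, ev, bitsVal]
  | cons b l ih =>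
    cases b
    · simp [powB, ev_mul hx, ih, bitsVal]; ring
    · simp [powB, ev_mul hx, ih, bitsVal]; ring
end

end P8

/-- Integral model of the polynomial: `fe (2x) = 2^8 gTilde(x)`. -/
def fe {R : Type*} [CommRing R] (y : R) : R :=
  1 * y^8 + 76 * y^7 + 3132 * y^6 + 39180 * y^5 - 337512 * y^4 - 20997360 * y^3 + 296484300 * y^2 - 1515153600 * y + 3149280000

/-- A septic resolvent. -/
def pe {R : Type*} [CommRing R] (t : R) : R :=
  1 * t^7 + 605 * t^6 + 411279 * t^5 + 255558655 * t^4 + 29556079520 * t^3 + 26864404523616 * t^2 + 298253490615520 * t - 32030827879469056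

/-- Numerator of the half sum of the two quartic factors over the septic field. -/
def ue {R : Type*} [CommRing R] (t y : R) : R :=
    (1925896509497283369558547200) * y^4 +
    (73184067360896768043224793600) * y^3 +
    (3851793018994566739117094400 * t + 1625456654015707163907413836800) * y^2 +
    (- 1397304245808768 * t^6 - 3742426356684025472 * t^5 - 2290883909140327881600 * t^4 - 1399382570482072595731840 * t^3 - 621796131902607654429521920 * t^2 - 17543949760483868700594029568 * t - 27784656771803590082907396142592) * y +
    (- 4933887788925568 * t^6 + 4411949346982434048 * t^5 + 3975782746419002597760 * t^4 + 4236624089455142520396800 * t^3 + 3025446756753870378172784640 * t^2 + 313788658128330145795831222272 * t + 113635156912835337139888001036288)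

/-- Numerator of the normalized half difference of the two quartic factors. -/
def ve {R : Type*} [CommRing R] (t y : R) : R :=
    (1925896509497283369558547200) * y^3 +
    (- 29234465577608 * t^6 - 18036177735905032 * t^5 - 12959128357464047000 * t^4 - 8043841679942380567640 * t^3 - 1213901831957002928321120 * t^2 - 940815542284240507124171008 * t + 23486764835526566742214613248) * y^2 +
    (890164838389501 * t^6 + 503690799109247849 * t^5 + 338406376266996463635 * t^4 + 212495407027449075190595 * t^3 + 17275278461314169249404000 * t^2 + 23838856933283477102421846816 * t + 470562207576284573074331190624) * y +
    (- 2531097194646056 * t^6 - 1669706949623718984 * t^5 - 1096638587338563771480 * t^4 - 660222911226122306763800 * t^3 - 70060310542779879086181120 * t^2 - 58338495645722844671562322176 * t - 4138941990729472915488190786304)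

/-- Cofactor in the certificate. -/
def qe {R : Type*} [CommRing R] (t y : R) : R :=
    (450420441703469834561186128745770648780800) * y^5 +
    (- 3418615910433388212284006656 * t^6 - 2149961511563283739636285760768 * t^5 - 1625308716818396396549855709554432 * t^4 - 1009921762271738233985439816481531648 * t^3 - 186359301647086092731721722467587745792 * t^2 - 130264311065989290828392068655986482827264 * t - 8269476309847006781629271243863983444940800) * y^4 +
    (208187946610358842595583148864 * t^6 + 120288712842840031171974422411072 * t^5 + 85710372115206263317553402376530368 * t^4 + 53496659387221774576968735302622898112 * t^3 + 6331778978665371317031507594100551276288 * t^2 + 6581092974347627227572773501028354415835136 * t - 130745549890040513510147984400301157351270400) * y^3 +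
    (- 3761535948503708132534821028388 * t^6 - 2064975476002433959516765353726740 * t^5 - 1377712521713383971351251908659367964 * t^4 - 860991864978402087819570975994055565276 * t^3 - 47240868999786044423007499492559893687424 * t^2 - 98369706573233002655413886239263103384747904 * t - 1302557325621476274289270397225057417920745344) * y^2 +
    (18024749801761806359926091664448 * t^6 + 11198452939158301732866395925133632 * t^5 + 7226291196176293916186144915142477760 * t^4 + 4338176819449435132097605411724639563200 * t^3 + 277202212568477154516340994736378702858240 * t^2 + 384406286813705217579251081657270549407643648 * t + 21691782178638429293816766228291685186411231232) * y +
    (- 25625812034980538775804465420544 * t^6 - 18281565078712014564733372879865088 * t^5 - 11801106911574338524766252637213816576 * t^4 - 6829602723996926886990534472247329617664 * t^3 - 639987007081311009578279528893720277753856 * t^2 - 445303225754735227534772155205571891127246848 * t - 38463748931756000760405392615522771992992538624)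

theorem ue_ve_cert {R : Type*} [CommRing R] (t y : R) :
    ue t y ^ 2 - 4 * t * ve t y ^ 2 = 1925896509497283369558547200 ^ 2 * fe y + qe t y * pe t := by
  simp only [ue, ve, qe, pe, fe]
  ring

def c7 : P8 := ⟨1, 2, 0, 6, 0, 6, 4, 1⟩
theorem s7_0 : P8.powB 7 c7 ⟨0, 1, 0, 0, 0, 0, 0, 0⟩ [true, true, true] = ⟨0, 0, 0, 0, 0, 0, 0, 1⟩ := by decide +kernel
theorem s7_1 : P8.powB 7 c7 ⟨0, 0, 0, 0, 0, 0, 0, 1⟩ [true, true, true] = ⟨1, 6, 2, 5, 1, 3, 2, 0⟩ := by decide +kernel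
theorem s7_2 : P8.powB 7 c7 ⟨1, 6, 2, 5, 1, 3, 2, 0⟩ [true, true, true] = ⟨5, 6, 2, 2, 1, 6, 1, 4⟩ := by decide +kernel
theorem s7_3 : P8.powB 7 c7 ⟨5, 6, 2, 2, 1, 6, 1, 4⟩ [true, true, true] = ⟨3, 0, 4, 4, 6, 0, 2, 5⟩ := by decide +kernel
theorem s7_4 : P8.powB 7 c7 ⟨3, 0, 4, 4, 6, 0, 2, 5⟩ [true, true, true] = ⟨5, 5, 2, 1, 2, 1, 4, 4⟩ := by decide +kernel
theorem s7_5 : P8.powB 7 c7 ⟨5, 5, 2, 1, 2, 1, 4, 4⟩ [true, true, true] = ⟨2, 5, 3, 0, 5, 1, 6, 2⟩ := by decide +kernel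
theorem s7_6 : P8.powB 7 c7 ⟨2, 5, 3, 0, 5, 1, 6, 2⟩ [true, true, true] = ⟨0, 1, 0, 0, 0, 0, 0, 0⟩ := by decide +kernel

theorem c7_spec {A : Type*} [CommRing A] [CharP A 7] {x : A} (hx : fe x = 0) :
    x ^ 8 = P8.ev c7 x := by
  have h0 : ((7 : ℕ) : A) = 0 := CharP.cast_eq_zero A 7
  simp only [fe, P8.ev, c7] at *
  push_cast at *
  linear_combination hx - ((449897143) * x ^ 0 + (-216450514) * x ^ 1 + (42354900) * x ^ 2 + (-2999622) * x ^ 3 + (-48216) * x ^ 4 + (5598) * x ^ 5 + (448) * x ^ 6 + (11) * x ^ 7) * h0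

theorem x_7_1 {A : Type*} [CommRing A] [CharP A 7] {x : A} (hx : fe x = 0) :
    x ^ 7 ^ 1 = P8.ev ⟨0, 0, 0, 0, 0, 0, 0, 1⟩ x := by
  have h := P8.ev_powB (p := 7) (c7_spec hx) ⟨0, 1, 0, 0, 0, 0, 0, 0⟩ [true, true, true]
  rw [s7_0, (by decide : P8.bitsVal [true, true, true] = 7)] at h
  rw [h]
  simp [P8.ev]

theorem x_7_2 {A : Type*} [CommRing A] [CharP A 7] {x : A} (hx : fe x = 0) :
    x ^ 7 ^ 2 = P8.ev ⟨1, 6, 2, 5, 1, 3, 2, 0⟩ x := by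
  have h := P8.ev_powB (p := 7) (c7_spec hx) ⟨0, 0, 0, 0, 0, 0, 0, 1⟩ [true, true, true]
  rw [s7_1, (by decide : P8.bitsVal [true, true, true] = 7), ← x_7_1 hx] at h
  rw [h, ← pow_mul, ← pow_succ]

theorem x_7_3 {A : Type*} [CommRing A] [CharP A 7] {x : A} (hx : fe x = 0) :
    x ^ 7 ^ 3 = P8.ev ⟨5, 6, 2, 2, 1, 6, 1, 4⟩ x := by
  have h := P8.ev_powB (p := 7) (c7_spec hx) ⟨1, 6, 2, 5, 1, 3, 2, 0⟩ [true, true, true]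
  rw [s7_2, (by decide : P8.bitsVal [true, true, true] = 7), ← x_7_2 hx] at h
  rw [h, ← pow_mul, ← pow_succ]

theorem x_7_4 {A : Type*} [CommRing A] [CharP A 7] {x : A} (hx : fe x = 0) :
    x ^ 7 ^ 4 = P8.ev ⟨3, 0, 4, 4, 6, 0, 2, 5⟩ x := by
  have h := P8.ev_powB (p := 7) (c7_spec hx) ⟨5, 6, 2, 2, 1, 6, 1, 4⟩ [true, true, true]
  rw [s7_3, (by decide : P8.bitsVal [true, true, true] = 7), ← x_7_3 hx] at h
  rw [h, ← pow_mul, ← pow_succ]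

theorem x_7_5 {A : Type*} [CommRing A] [CharP A 7] {x : A} (hx : fe x = 0) :
    x ^ 7 ^ 5 = P8.ev ⟨5, 5, 2, 1, 2, 1, 4, 4⟩ x := by
  have h := P8.ev_powB (p := 7) (c7_spec hx) ⟨3, 0, 4, 4, 6, 0, 2, 5⟩ [true, true, true]
  rw [s7_4, (by decide : P8.bitsVal [true, true, true] = 7), ← x_7_4 hx] at h
  rw [h, ← pow_mul, ← pow_succ]

theorem x_7_6 {A : Type*} [CommRing A] [CharP A 7] {x : A} (hx : fe x = 0) :
    x ^ 7 ^ 6 = P8.ev ⟨2, 5, 3, 0, 5, 1, 6, 2⟩ x := by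
  have h := P8.ev_powB (p := 7) (c7_spec hx) ⟨5, 5, 2, 1, 2, 1, 4, 4⟩ [true, true, true]
  rw [s7_5, (by decide : P8.bitsVal [true, true, true] = 7), ← x_7_5 hx] at h
  rw [h, ← pow_mul, ← pow_succ]

theorem x_7_7 {A : Type*} [CommRing A] [CharP A 7] {x : A} (hx : fe x = 0) :
    x ^ 7 ^ 7 = P8.ev ⟨0, 1, 0, 0, 0, 0, 0, 0⟩ x := by
  have h := P8.ev_powB (p := 7) (c7_spec hx) ⟨2, 5, 3, 0, 5, 1, 6, 2⟩ [true, true, true]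
  rw [s7_6, (by decide : P8.bitsVal [true, true, true] = 7), ← x_7_6 hx] at h
  rw [h, ← pow_mul, ← pow_succ]

def c13 : P8 := ⟨4, 12, 5, 7, 6, 2, 1, 2⟩
theorem s13_0 : P8.powB 13 c13 ⟨0, 1, 0, 0, 0, 0, 0, 0⟩ [true, false, true, true] = ⟨9, 4, 8, 6, 4, 4, 5, 1⟩ := by decide +kernel
theorem s13_1 : P8.powB 13 c13 ⟨9, 4, 8, 6, 4, 4, 5, 1⟩ [true, false, true, true] = ⟨6, 7, 5, 1, 9, 0, 12, 5⟩ := by decide +kernel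
theorem s13_2 : P8.powB 13 c13 ⟨6, 7, 5, 1, 9, 0, 12, 5⟩ [true, false, true, true] = ⟨9, 4, 3, 6, 3, 7, 4, 3⟩ := by decide +kernel
theorem s13_3 : P8.powB 13 c13 ⟨9, 4, 3, 6, 3, 7, 4, 3⟩ [true, false, true, true] = ⟨6, 8, 11, 4, 9, 12, 12, 9⟩ := by decide +kernel
theorem s13_4 : P8.powB 13 c13 ⟨6, 8, 11, 4, 9, 12, 12, 9⟩ [true, false, true, true] = ⟨8, 2, 2, 4, 7, 7, 6, 3⟩ := by decide +kernel
theorem s13_5 : P8.powB 13 c13 ⟨8, 2, 2, 4, 7, 7, 6, 3⟩ [true, false, true, true] = ⟨0, 1, 0, 0, 0, 0, 0, 0⟩ := by decide +kernel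

theorem c13_spec {A : Type*} [CommRing A] [CharP A 13] {x : A} (hx : fe x = 0) :
    x ^ 8 = P8.ev c13 x := by
  have h0 : ((13 : ℕ) : A) = 0 := CharP.cast_eq_zero A 13
  simp only [fe, P8.ev, c13] at *
  push_cast at *
  linear_combination hx - ((242252308) * x ^ 0 + (-116550276) * x ^ 1 + (22806485) * x ^ 2 + (-1615181) * x ^ 3 + (-25962) * x ^ 4 + (3014) * x ^ 5 + (241) * x ^ 6 + (6) * x ^ 7) * h0

theorem x_13_1 {A : Type*} [CommRing A] [CharP A 13] {x : A} (hx : fe x = 0) :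
    x ^ 13 ^ 1 = P8.ev ⟨9, 4, 8, 6, 4, 4, 5, 1⟩ x := by
  have h := P8.ev_powB (p := 13) (c13_spec hx) ⟨0, 1, 0, 0, 0, 0, 0, 0⟩ [true, false, true, true]
  rw [s13_0, (by decide : P8.bitsVal [true, false, true, true] = 13)] at h
  rw [h]
  simp [P8.ev]

theorem x_13_2 {A : Type*} [CommRing A] [CharP A 13] {x : A} (hx : fe x = 0) :
    x ^ 13 ^ 2 = P8.ev ⟨6, 7, 5, 1, 9, 0, 12, 5⟩ x := by
  have h := P8.ev_powB (p := 13) (c13_spec hx) ⟨9, 4, 8, 6, 4, 4, 5, 1⟩ [true, false, true, true]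
  rw [s13_1, (by decide : P8.bitsVal [true, false, true, true] = 13), ← x_13_1 hx] at h
  rw [h, ← pow_mul, ← pow_succ]

theorem x_13_3 {A : Type*} [CommRing A] [CharP A 13] {x : A} (hx : fe x = 0) :
    x ^ 13 ^ 3 = P8.ev ⟨9, 4, 3, 6, 3, 7, 4, 3⟩ x := by
  have h := P8.ev_powB (p := 13) (c13_spec hx) ⟨6, 7, 5, 1, 9, 0, 12, 5⟩ [true, false, true, true]
  rw [s13_2, (by decide : P8.bitsVal [true, false, true, true] = 13), ← x_13_2 hx] at h
  rw [h, ← pow_mul, ← pow_succ]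

theorem x_13_4 {A : Type*} [CommRing A] [CharP A 13] {x : A} (hx : fe x = 0) :
    x ^ 13 ^ 4 = P8.ev ⟨6, 8, 11, 4, 9, 12, 12, 9⟩ x := by
  have h := P8.ev_powB (p := 13) (c13_spec hx) ⟨9, 4, 3, 6, 3, 7, 4, 3⟩ [true, false, true, true]
  rw [s13_3, (by decide : P8.bitsVal [true, false, true, true] = 13), ← x_13_3 hx] at h
  rw [h, ← pow_mul, ← pow_succ]

theorem x_13_5 {A : Type*} [CommRing A] [CharP A 13] {x : A} (hx : fe x = 0) :
    x ^ 13 ^ 5 = P8.ev ⟨8, 2, 2, 4, 7, 7, 6, 3⟩ x := by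
  have h := P8.ev_powB (p := 13) (c13_spec hx) ⟨6, 8, 11, 4, 9, 12, 12, 9⟩ [true, false, true, true]
  rw [s13_4, (by decide : P8.bitsVal [true, false, true, true] = 13), ← x_13_4 hx] at h
  rw [h, ← pow_mul, ← pow_succ]

theorem x_13_6 {A : Type*} [CommRing A] [CharP A 13] {x : A} (hx : fe x = 0) :
    x ^ 13 ^ 6 = P8.ev ⟨0, 1, 0, 0, 0, 0, 0, 0⟩ x := by
  have h := P8.ev_powB (p := 13) (c13_spec hx) ⟨8, 2, 2, 4, 7, 7, 6, 3⟩ [true, false, true, true]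
  rw [s13_5, (by decide : P8.bitsVal [true, false, true, true] = 13), ← x_13_5 hx] at h
  rw [h, ← pow_mul, ← pow_succ]

def c41 : P8 := ⟨28, 35, 25, 30, 0, 16, 25, 6⟩
theorem s41_0 : P8.powB 41 c41 ⟨0, 1, 0, 0, 0, 0, 0, 0⟩ [true, false, false, true, false, true] = ⟨12, 5, 3, 21, 27, 30, 29, 38⟩ := by decide +kernel
theorem s41_1 : P8.powB 41 c41 ⟨12, 5, 3, 21, 27, 30, 29, 38⟩ [true, false, false, true, false, true] = ⟨19, 22, 29, 3, 24, 5, 25, 38⟩ := by decide +kernel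
theorem s41_2 : P8.powB 41 c41 ⟨19, 22, 29, 3, 24, 5, 25, 38⟩ [true, false, false, true, false, true] = ⟨5, 21, 29, 35, 16, 26, 9, 24⟩ := by decide +kernel
theorem s41_3 : P8.powB 41 c41 ⟨5, 21, 29, 35, 16, 26, 9, 24⟩ [true, false, false, true, false, true] = ⟨0, 1, 0, 0, 0, 0, 0, 0⟩ := by decide +kernel

theorem c41_spec {A : Type*} [CommRing A] [CharP A 41] {x : A} (hx : fe x = 0) :
    x ^ 8 = P8.ev c41 x := by
  have h0 : ((41 : ℕ) : A) = 0 := CharP.cast_eq_zero A 41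
  simp only [fe, P8.ev, c41] at *
  push_cast at *
  linear_combination hx - ((76811708) * x ^ 0 + (-36954965) * x ^ 1 + (7231325) * x ^ 2 + (-512130) * x ^ 3 + (-8232) * x ^ 4 + (956) * x ^ 5 + (77) * x ^ 6 + (2) * x ^ 7) * h0

theorem x_41_1 {A : Type*} [CommRing A] [CharP A 41] {x : A} (hx : fe x = 0) :
    x ^ 41 ^ 1 = P8.ev ⟨12, 5, 3, 21, 27, 30, 29, 38⟩ x := by
  have h := P8.ev_powB (p := 41) (c41_spec hx) ⟨0, 1, 0, 0, 0, 0, 0, 0⟩ [true, false, false, true, false, true]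
  rw [s41_0, (by decide : P8.bitsVal [true, false, false, true, false, true] = 41)] at h
  rw [h]
  simp [P8.ev]

theorem x_41_2 {A : Type*} [CommRing A] [CharP A 41] {x : A} (hx : fe x = 0) :
    x ^ 41 ^ 2 = P8.ev ⟨19, 22, 29, 3, 24, 5, 25, 38⟩ x := by
  have h := P8.ev_powB (p := 41) (c41_spec hx) ⟨12, 5, 3, 21, 27, 30, 29, 38⟩ [true, false, false, true, false, true]
  rw [s41_1, (by decide : P8.bitsVal [true, false, false, true, false, true] = 41), ← x_41_1 hx] at h
  rw [h, ← pow_mul, ← pow_succ]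

theorem x_41_3 {A : Type*} [CommRing A] [CharP A 41] {x : A} (hx : fe x = 0) :
    x ^ 41 ^ 3 = P8.ev ⟨5, 21, 29, 35, 16, 26, 9, 24⟩ x := by
  have h := P8.ev_powB (p := 41) (c41_spec hx) ⟨19, 22, 29, 3, 24, 5, 25, 38⟩ [true, false, false, true, false, true]
  rw [s41_2, (by decide : P8.bitsVal [true, false, false, true, false, true] = 41), ← x_41_2 hx] at h
  rw [h, ← pow_mul, ← pow_succ]

theorem x_41_4 {A : Type*} [CommRing A] [CharP A 41] {x : A} (hx : fe x = 0) :
    x ^ 41 ^ 4 = P8.ev ⟨0, 1, 0, 0, 0, 0, 0, 0⟩ x := by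
  have h := P8.ev_powB (p := 41) (c41_spec hx) ⟨5, 21, 29, 35, 16, 26, 9, 24⟩ [true, false, false, true, false, true]
  rw [s41_3, (by decide : P8.bitsVal [true, false, false, true, false, true] = 41), ← x_41_3 hx] at h
  rw [h, ← pow_mul, ← pow_succ]

def c53 : P8 := ⟨34, 41, 32, 32, 8, 40, 48, 30⟩
theorem s53_0 : P8.powB 53 c53 ⟨0, 1, 0, 0, 0, 0, 0, 0⟩ [true, false, true, false, true, true] = ⟨33, 11, 25, 11, 0, 2, 13, 25⟩ := by decide +kernel
theorem s53_1 : P8.powB 53 c53 ⟨33, 11, 25, 11, 0, 2, 13, 25⟩ [true, false, true, false, true, true] = ⟨28, 35, 14, 47, 48, 8, 36, 30⟩ := by decide +kernel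
theorem s53_2 : P8.powB 53 c53 ⟨28, 35, 14, 47, 48, 8, 36, 30⟩ [true, false, true, false, true, true] = ⟨0, 1, 0, 0, 0, 0, 0, 0⟩ := by decide +kernel

theorem c53_spec {A : Type*} [CommRing A] [CharP A 53] {x : A} (hx : fe x = 0) :
    x ^ 8 = P8.ev c53 x := by
  have h0 : ((53 : ℕ) : A) = 0 := CharP.cast_eq_zero A 53
  simp only [fe, P8.ev, c53] at *
  push_cast at *
  linear_combination hx - ((59420378) * x ^ 0 + (-28587803) * x ^ 1 + (5594044) * x ^ 2 + (-396176) * x ^ 3 + (-6368) * x ^ 4 + (740) * x ^ 5 + (60) * x ^ 6 + (2) * x ^ 7) * h0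

theorem x_53_1 {A : Type*} [CommRing A] [CharP A 53] {x : A} (hx : fe x = 0) :
    x ^ 53 ^ 1 = P8.ev ⟨33, 11, 25, 11, 0, 2, 13, 25⟩ x := by
  have h := P8.ev_powB (p := 53) (c53_spec hx) ⟨0, 1, 0, 0, 0, 0, 0, 0⟩ [true, false, true, false, true, true]
  rw [s53_0, (by decide : P8.bitsVal [true, false, true, false, true, true] = 53)] at h
  rw [h]
  simp [P8.ev]

theorem x_53_2 {A : Type*} [CommRing A] [CharP A 53] {x : A} (hx : fe x = 0) :
    x ^ 53 ^ 2 = P8.ev ⟨28, 35, 14, 47, 48, 8, 36, 30⟩ x := by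
  have h := P8.ev_powB (p := 53) (c53_spec hx) ⟨33, 11, 25, 11, 0, 2, 13, 25⟩ [true, false, true, false, true, true]
  rw [s53_1, (by decide : P8.bitsVal [true, false, true, false, true, true] = 53), ← x_53_1 hx] at h
  rw [h, ← pow_mul, ← pow_succ]

theorem x_53_3 {A : Type*} [CommRing A] [CharP A 53] {x : A} (hx : fe x = 0) :
    x ^ 53 ^ 3 = P8.ev ⟨0, 1, 0, 0, 0, 0, 0, 0⟩ x := by
  have h := P8.ev_powB (p := 53) (c53_spec hx) ⟨28, 35, 14, 47, 48, 8, 36, 30⟩ [true, false, true, false, true, true]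
  rw [s53_2, (by decide : P8.bitsVal [true, false, true, false, true, true] = 53), ← x_53_2 hx] at h
  rw [h, ← pow_mul, ← pow_succ]
/-- Residues modulo 4289 of the roots. -/
def aT : ℕ → ℤ
  | 0 => 226 | 1 => 2493 | 2 => 1474 | 3 => 3727 | 4 => 315 | 5 => 3462 | 6 => 1835 | _ => 3548

/-- Residues modulo 4289 of the roots of the septic resolvent. -/
def tT : ℕ → ℤ
  | 0 => 0 | 1 => 527 | 2 => 2257 | 3 => 2374 | 4 => 1742 | 5 => 2936 | 6 => 782 | _ => 1644

def par (n : ℕ) : Bool := (n % 2 + n / 2 % 2 + n / 4 % 2) % 2 == 0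

theorem table_check : ∀ w < 8, 0 < w → ∀ i < 8, ∀ j < 8,
    if par (w &&& i) = par (w &&& j) then
      (ue (tT w) (aT i) * ve (tT w) (aT j) + ue (tT w) (aT j) * ve (tT w) (aT i)) % 4289 ≠ 0
    else
      (ue (tT w) (aT i) * ve (tT w) (aT j) - ue (tT w) (aT j) * ve (tT w) (aT i)) % 4289 ≠ 0 := by
  decide +kernel

theorem fe_split {A : Type*} [CommRing A] [CharP A 4289] (x : A) :
    fe x = (x - 226) * (x - 2493) * (x - 1474) * (x - 3727) * (x - 315) * (x - 3462) * (x - 1835) * (x - 3548) := by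
  have h0 : ((4289 : ℕ) : A) = 0 := CharP.cast_eq_zero A 4289
  push_cast at h0
  simp only [fe]
  linear_combination ((-5123760776672057042400) * x ^ 0 + (51559901952812883000) * x ^ 1 + (-180490147552668576) * x ^ 2 + (279536630092490) * x ^ 3 + (-228330584999) * x ^ 4 + (105985970) * x ^ 5 + (-28136) * x ^ 6 + (4) * x ^ 7) * h0

theorem pe_split {A : Type*} [CommRing A] [CharP A 4289] (x : A) :
    pe x = (x - 527) * (x - 2257) * (x - 2374) * (x - 1742) * (x - 2936) * (x - 782) * (x - 1644) := by
  have h0 : ((4289 : ℕ) : A) = 0 := CharP.cast_eq_zero A 4289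
  push_cast at h0
  simp only [pe]
  linear_combination ((4328913039026848000) * x ^ 0 + (-24083993846282304) * x ^ 1 + (53095392106328) * x ^ 2 + (-60630321132) * x ^ 3 + (39275329) * x ^ 4 + (-14404) * x ^ 5 + (3) * x ^ 6) * h0

theorem map_fe {R S : Type*} [CommRing R] [CommRing S] (φ : R →+* S) (y : R) :
    φ (fe y) = fe (φ y) := by
  simp only [fe, map_add, map_sub, map_mul, map_pow, map_neg, map_ofNat, map_one]
theorem map_pe {R S : Type*} [CommRing R] [CommRing S] (φ : R →+* S) (y : R) :
    φ (pe y) = pe (φ y) := by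
  simp only [pe, map_add, map_sub, map_mul, map_pow, map_neg, map_ofNat, map_one]
theorem map_ue {R S : Type*} [CommRing R] [CommRing S] (φ : R →+* S) (t y : R) :
    φ (ue t y) = ue (φ t) (φ y) := by
  simp only [ue, map_add, map_sub, map_mul, map_pow, map_neg, map_ofNat, map_one]
theorem map_ve {R S : Type*} [CommRing R] [CommRing S] (φ : R →+* S) (t y : R) :
    φ (ve t y) = ve (φ t) (φ y) := by
  simp only [ve, map_add, map_sub, map_mul, map_pow, map_neg, map_ofNat, map_one]

theorem fe_gTilde {A : Type*} [Field A] [CharZero A] [Algebra ℚ A] (x : A) :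
    fe (2 * x) = 2 ^ 8 * aeval x gTilde := by
  simp only [fe, gTilde, map_add, map_sub, map_mul, map_pow, aeval_X, aeval_C, map_div₀, map_ofNat]
  field_simp
  ring

theorem gTilde_natDegree : gTilde.natDegree = 8 := by
  unfold gTilde; compute_degree!

theorem gTilde_monic : gTilde.Monic := by
  unfold gTilde; monicity!

theorem feX_monic : (fe (X : ℤ[X])).Monic := by
  have : fe (X : ℤ[X]) = X ^ 8 + 76 * X ^ 7 + 3132 * X ^ 6 + 39180 * X ^ 5 - 337512 * X ^ 4
      - 20997360 * X ^ 3 + 296484300 * X ^ 2 - 1515153600 * X + 3149280000 := by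
    simp only [fe]; ring
  rw [this]; monicity!

theorem peX_monic : (pe (X : ℤ[X])).Monic := by
  have : pe (X : ℤ[X]) = X ^ 7 + 605 * X ^ 6 + 411279 * X ^ 5 + 255558655 * X ^ 4
      + 29556079520 * X ^ 3 + 26864404523616 * X ^ 2 + 298253490615520 * X
      - 32030827879469056 := by
    simp only [pe]; ring
  rw [this]; monicity!

theorem gTilde_separable : gTilde.Separable := by
  have h16 : C 16 * gTilde = 16 * X ^ 8 + 608 * X ^ 7 + 12528 * X ^ 6 + 78360 * X ^ 5 - 337512 * X ^ 4
      - 10498680 * X ^ 3 + 74121075 * X ^ 2 - 189394200 * X + 196830000 := by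
    have h1 : (C (9795 / 2 : ℚ) : ℚ[X]) * 16 = 78360 := by
      rw [← map_ofNat C 16, ← map_mul, ← map_ofNat C]; norm_num
    have h2 : (C (42189 / 2 : ℚ) : ℚ[X]) * 16 = 337512 := by
      rw [← map_ofNat C 16, ← map_mul, ← map_ofNat C]; norm_num
    have h3 : (C (1312335 / 2 : ℚ) : ℚ[X]) * 16 = 10498680 := by
      rw [← map_ofNat C 16, ← map_mul, ← map_ofNat C]; norm_num
    have h4 : (C (74121075 / 16 : ℚ) : ℚ[X]) * 16 = 74121075 := by
      rw [← map_ofNat C 16, ← map_mul, ← map_ofNat C]; norm_num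
    have h5 : (C (23674275 / 2 : ℚ) : ℚ[X]) * 16 = 189394200 := by
      rw [← map_ofNat C 16, ← map_mul, ← map_ofNat C]; norm_num
    unfold gTilde
    simp only [map_ofNat]
    linear_combination X ^ 5 * h1 - X ^ 4 * h2 - X ^ 3 * h3 + X ^ 2 * h4 - X * h5
  have hb : ((859897119559024350) * X ^ 0 + (-245778980444411400) * X ^ 1 + (43173155431099200) * X ^ 2 + (12717389876011224) * X ^ 3 + (1437080391698592) * X ^ 4 + (70837869958432) * X ^ 5 + (1860400079488) * X ^ 6 : ℚ[X]) * (C 16 * gTilde)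
      + ((822702629868853500) * X ^ 0 + (-471381896064642975) * X ^ 1 + (121402048059300600) * X ^ 2 + (-6261504770348760) * X ^ 3 + (-2263791612494136) * X ^ 4 + (-230488331500848) * X ^ 5 + (-9959346292000) * X ^ 6 + (-232550009936) * X ^ 7) * derivative (C 16 * gTilde)
      = C (16 * 839902726305946828800000) := by
    rw [h16]
    simp only [derivative_add, derivative_sub, derivative_mul, derivative_X_pow,
      derivative_X, derivative_ofNat, map_mul, map_ofNat, map_natCast]
    push_cast
    ring
  have hs : (C 16 * gTilde).Separable := by
    refine ⟨C (16 * 839902726305946828800000)⁻¹ * ((859897119559024350) * X ^ 0 + (-245778980444411400) * X ^ 1 + (43173155431099200) * X ^ 2 + (12717389876011224) * X ^ 3 + (1437080391698592) * X ^ 4 + (70837869958432) * X ^ 5 + (1860400079488) * X ^ 6),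
      C (16 * 839902726305946828800000)⁻¹ * ((822702629868853500) * X ^ 0 + (-471381896064642975) * X ^ 1 + (121402048059300600) * X ^ 2 + (-6261504770348760) * X ^ 3 + (-2263791612494136) * X ^ 4 + (-230488331500848) * X ^ 5 + (-9959346292000) * X ^ 6 + (-232550009936) * X ^ 7), ?_⟩
    rw [mul_assoc, mul_assoc, ← mul_add, hb, ← map_mul, inv_mul_cancel₀ (by norm_num), map_one]
  exact hs.of_mul_right

theorem exists_M : ∃ (M : Type) (_ : Field M) (_ : NumberField M) (_ : IsGalois ℚ M),
    (gTilde.map (algebraMap ℚ M)).Splits ∧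
      ((pe (X : ℤ[X])).map (algebraMap ℤ M)).Splits := by
  let P : ℚ[X] := (pe (X : ℤ[X])).map (algebraMap ℤ ℚ)
  have hP : P ≠ 0 := (peX_monic.map _).ne_zero
  have hg : gTilde ≠ 0 := gTilde_monic.ne_zero
  have hs := SplittingField.splits (gTilde * P)
  have hne : (gTilde * P).map (algebraMap ℚ (gTilde * P).SplittingField) ≠ 0 :=
    map_ne_zero (mul_ne_zero hg hP)
  have : NumberField (gTilde * P).SplittingField :=
    { to_charZero := inferInstance, to_finiteDimensional := inferInstance }
  have : IsGalois ℚ (gTilde * P).SplittingField := by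
    have hn : Normal ℚ (gTilde * P).SplittingField := by
      have h := @Normal.of_isSplittingField ℚ _ (gTilde * P).SplittingField _ _ (gTilde * P)
        (IsSplittingField.splittingField (gTilde * P))
      convert h
    exact IsGalois.mk
  refine ⟨(gTilde * P).SplittingField, inferInstance, inferInstance, inferInstance, ?_, ?_⟩
  · refine Splits.of_dvd hs hne (Polynomial.map_dvd _ (dvd_mul_right _ _))
  · have := Splits.of_dvd hs hne (Polynomial.map_dvd _ (dvd_mul_left P gTilde))
    rw [Polynomial.map_map] at this
    have key : ∀ φ : ℤ →+* (gTilde * P).SplittingField, ((pe (X : ℤ[X])).map φ).Splits := by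
      intro φ
      rw [RingHom.ext_int φ _]
      exact this
    exact key _

/-- Reduction modulo a prime above `p`, together with a Frobenius element. -/
theorem exists_frob (M : Type) [Field M] [NumberField M] [IsGalois ℚ M] (p : ℕ) [Fact p.Prime] :
    ∃ (k : Type) (_ : Field k) (_ : CharP k p) (ρ : 𝓞 M →+* k) (σ : Gal(M/ℚ)),
      ∀ x y : 𝓞 M, (y : M) = σ (x : M) → ρ y = ρ x ^ p := by
  let P : Ideal ℤ := Ideal.span {(p : ℤ)}
  have hp : Prime (p : ℤ) := Nat.prime_iff_prime_int.1 Fact.out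
  have hP : P.IsPrime := (Ideal.span_singleton_prime hp.ne_zero).2 hp
  have hPm : P.IsMaximal := hP.isMaximal (by
    simp only [P, ne_eq, Ideal.span_singleton_eq_bot]; exact hp.ne_zero)
  obtain ⟨Q, hQm, hQ⟩ := Ideal.exists_maximal_ideal_liesOver_of_isIntegral (S := 𝓞 M) P
  have hQP : Q.under ℤ = P := hQ.over.symm
  have : Finite (𝓞 M ⧸ Q) := Ideal.finiteQuotientOfFreeOfNeBot Q (by
    rintro rfl
    have h2 : (p : ℤ) ∈ (⊥ : Ideal (𝓞 M)).under ℤ := by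
      rw [hQP]; exact Ideal.mem_span_singleton_self _
    rw [Ideal.mem_comap] at h2
    simp at h2
    exact (Fact.out : p.Prime).ne_zero h2)
  obtain ⟨σ, hσ⟩ := IsArithFrobAt.exists_of_isInvariant ℤ Gal(M/ℚ) Q
  have hcard : Nat.card (ℤ ⧸ Q.under ℤ) = p := by
    rw [hQP]
    simp [P, Int.card_ideal_quot]
  have hp0 : ((p : ℕ) : 𝓞 M ⧸ Q) = 0 := by
    have : (p : ℤ) ∈ Q.under ℤ := by rw [hQP]; exact Ideal.mem_span_singleton_self _
    rw [Ideal.mem_comap] at this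
    have := Ideal.Quotient.eq_zero_iff_mem.2 this
    simpa using this
  refine ⟨𝓞 M ⧸ Q, Ideal.Quotient.field Q, ?_, Ideal.Quotient.mk Q, σ, ?_⟩
  · exact (CharP.charP_iff_prime_eq_zero Fact.out).2 hp0
  · intro x y hxy
    have := hσ.mk_apply x
    rw [hcard] at this
    have h2 : y = (MulSemiringAction.toAlgHom ℤ (𝓞 M) σ) x := NumberField.RingOfIntegers.ext hxy
    rw [h2, this]

theorem exists_multiset {M : Type} [Field M] [NumberField M] (F : ℤ[X]) (hF : F.Monic)
    (hs : (F.map (algebraMap ℤ M)).Splits) :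
    ∃ S : Multiset (𝓞 M), F.map (algebraMap ℤ (𝓞 M)) = (S.map fun s => X - C s).prod := by
  have hIntegral : ∀ x ∈ (F.map (algebraMap ℤ M)).roots, ∃ y : 𝓞 M, algebraMap (𝓞 M) M y = x := by
    intro x hx
    have hi : IsIntegral ℤ x := ⟨F, hF, by
      have := isRoot_of_mem_roots hx
      rwa [IsRoot.def, eval_map] at this⟩
    exact ⟨⟨x, hi⟩, rfl⟩
  obtain ⟨S, hS⟩ : ∃ S : Multiset (𝓞 M), S.map (algebraMap (𝓞 M) M)
      = (F.map (algebraMap ℤ M)).roots := by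
    generalize (F.map (algebraMap ℤ M)).roots = T at hIntegral
    induction T using Multiset.induction with
    | empty => exact ⟨0, rfl⟩
    | cons a T ih =>
      obtain ⟨S, hS⟩ := ih fun x hx => hIntegral x (Multiset.mem_cons_of_mem hx)
      obtain ⟨y, hy⟩ := hIntegral a (Multiset.mem_cons_self a T)
      exact ⟨y ::ₘ S, by rw [Multiset.map_cons, hS, hy]⟩
  refine ⟨S, ?_⟩
  apply Polynomial.map_injective (algebraMap (𝓞 M) M) (RingOfIntegers.coe_injective)
  rw [Polynomial.map_map, ← IsScalarTower.algebraMap_eq,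
    hs.eq_prod_roots_of_monic (hF.map _), ← hS]
  simp [Polynomial.map_multiset_prod]


/-- The set of roots of `gTilde` in its splitting field. -/
abbrev RR : Type := gTilde.rootSet gTilde.SplittingField

theorem smul_coe (τ : gTilde.Gal) (r : RR) : ((τ • r : RR) : gTilde.SplittingField) = τ r := rfl

noncomputable instance : Fintype RR := Fintype.ofFinite _

theorem card_RR : Fintype.card RR = 8 := by
  have h := card_rootSet_eq_natDegree (K := gTilde.SplittingField) gTilde_separable
    (SplittingField.splits gTilde)
  rw [gTilde_natDegree] at h
  rw [← h]
  exact Fintype.card_congr (Equiv.refl _)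

instance : FaithfulSMul gTilde.Gal RR := by
  constructor
  intro a b h
  apply Gal.ext
  intro x hx
  have := congrArg Subtype.val (h ⟨x, hx⟩)
  exact this

theorem restr {L M : Type} [Field L] [Field M] [Algebra ℚ L] [Algebra ℚ M] [Normal ℚ L]
    [Normal ℚ M] (ι : L →+* M) :
    (∀ σ : M ≃ₐ[ℚ] M, ∃ τ : L ≃ₐ[ℚ] L, ∀ x, ι (τ x) = σ (ι x)) ∧
    (∀ τ : L ≃ₐ[ℚ] L, ∃ σ : M ≃ₐ[ℚ] M, ∀ x, ι (τ x) = σ (ι x)) := by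
  let a := ι.toAlgebra
  have : IsScalarTower ℚ L M := IsScalarTower.of_algebraMap_eq' (RingHom.ext_rat _ _)
  constructor
  · intro σ
    exact ⟨σ.restrictNormal L, fun x => σ.restrictNormal_commutes L x⟩
  · intro τ
    obtain ⟨σ, hσ⟩ := AlgEquiv.restrictNormalHom_surjective (F := ℚ) (K₁ := L) M τ
    refine ⟨σ, fun x => ?_⟩
    rw [← hσ]
    exact σ.restrictNormal_commutes L x

theorem exists_y (M : Type) [Field M] [NumberField M] [IsGalois ℚ M]
    (hs : (gTilde.map (algebraMap ℚ M)).Splits) :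
    ∃ y : RR → 𝓞 M, Function.Injective y ∧ (∀ r, fe (y r) = 0) ∧
      (∀ σ : Gal(M/ℚ), ∃ τ : gTilde.Gal, ∀ r, (y (τ • r) : M) = σ (y r)) ∧
      (∀ τ : gTilde.Gal, ∃ σ : Gal(M/ℚ), ∀ r, (y (τ • r) : M) = σ (y r)) := by
  let ι : gTilde.SplittingField →ₐ[ℚ] M := SplittingField.lift gTilde hs
  have hfe : ∀ r : RR, fe (2 * ι r) = 0 := by
    intro r
    rw [fe_gTilde, aeval_algHom_apply]
    have := aeval_eq_zero_of_mem_rootSet r.2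
    rw [this]; simp
  have hIntegral : ∀ r : RR, IsIntegral ℤ (2 * ι r) := by
    intro r
    refine ⟨fe X, feX_monic, ?_⟩
    rw [← coe_eval₂RingHom, map_fe, coe_eval₂RingHom, eval₂_X]
    exact hfe r
  have hr := @restr gTilde.SplittingField M _ _ _ _
    (@Normal.of_isSplittingField ℚ _ gTilde.SplittingField _ _ gTilde
      (IsSplittingField.splittingField gTilde)) _ ι.toRingHom
  refine ⟨fun r => ⟨2 * ι r, hIntegral r⟩, ?_, ?_, ?_, ?_⟩
  · intro r r' h
    have h2 : 2 * ι r = 2 * ι r' := congrArg Subtype.val h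
    have h3 := mul_left_cancel₀ (two_ne_zero) h2
    exact Subtype.ext (ι.injective h3)
  · intro r
    apply RingOfIntegers.coe_injective
    exact (map_fe (algebraMap (𝓞 M) M) _).trans ((hfe r).trans (map_zero _).symm)
  · intro σ
    obtain ⟨τ, hτ⟩ := hr.1 σ
    refine ⟨τ, fun r => ?_⟩
    change 2 * ι (τ r) = σ (2 * ι r)
    rw [map_mul, map_ofNat]
    exact congrArg (2 * ·) (hτ r)
  · intro τ
    obtain ⟨σ, hσ⟩ := hr.2 τ
    refine ⟨σ, fun r => ?_⟩
    change 2 * ι (τ r) = σ (2 * ι r)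
    rw [map_mul, map_ofNat]
    exact congrArg (2 * ·) (hσ r)

theorem fe_prod {M : Type} [Field M] [NumberField M] (y : RR → 𝓞 M) (hy : Function.Injective y)
    (hf : ∀ r, fe (y r) = 0) : fe (X : (𝓞 M)[X]) = ∏ r, (X - C (y r)) := by
  have hm : (fe (X : (𝓞 M)[X])).Monic := by
    have := feX_monic.map (algebraMap ℤ (𝓞 M))
    rwa [← coe_mapRingHom, map_fe, coe_mapRingHom, map_X] at this
  have hd : (fe (X : (𝓞 M)[X])).natDegree = 8 := by
    simp only [fe]; compute_degree!
  have hle : Finset.univ.val.map y ≤ (fe (X : (𝓞 M)[X])).roots := by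
    rw [Multiset.le_iff_subset (Multiset.Nodup.map hy Finset.univ.nodup)]
    intro a ha
    obtain ⟨r, -, rfl⟩ := Multiset.mem_map.1 ha
    rw [mem_roots hm.ne_zero, IsRoot.def, ← coe_evalRingHom, map_fe, coe_evalRingHom, eval_X]
    exact hf r
  have hc : (Finset.univ.val.map y).card = 8 := by
    rw [Multiset.card_map]; exact card_RR
  have heq := Multiset.eq_of_le_of_card_le hle (by rw [hc, ← hd]; exact card_roots' _)
  have := prod_multiset_X_sub_C_of_monic_of_roots_card_eq hm (by rw [← heq, hc, hd])
  rw [← this, ← heq, Multiset.map_map]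
  rfl

/-- Frobenius at a prime at which the reduction is separable. -/
theorem frob_data {M : Type} [Field M] [NumberField M] (y : RR → 𝓞 M) (hy : Function.Injective y)
    (hf : ∀ r, fe (y r) = 0) {k : Type} [Field k] (ρ : 𝓞 M →+* k)
    (hsep : (fe (X : k[X])).Separable) :
    Function.Injective (fun r => ρ (y r)) ∧ ∀ c : k, fe c = 0 → ∃ r, ρ (y r) = c := by
  have h := congrArg (mapRingHom ρ) (fe_prod y hy hf)
  rw [map_fe, map_prod] at h
  simp only [coe_mapRingHom, map_X, Polynomial.map_sub, map_C] at h
  constructor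
  · rw [h] at hsep
    exact separable_prod_X_sub_C_iff.1 hsep
  · intro c hc
    have h2 := congrArg (eval c) h
    rw [← coe_evalRingHom, map_fe, coe_evalRingHom, eval_X, hc, eval_prod] at h2
    obtain ⟨r, -, hr⟩ := Finset.prod_eq_zero_iff.1 h2.symm
    refine ⟨r, ?_⟩
    simp only [eval_sub, eval_X, eval_C] at hr
    exact (sub_eq_zero.1 hr).symm

theorem sep_of_pow {k : Type} [Field k] (p : ℕ) [Fact p.Prime] [CharP k p] (n : ℕ) (hn : n ≠ 0)
    (h : ∀ (A : Type) [CommRing A] [CharP A p] (x : A), fe x = 0 → x ^ p ^ n = x) :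
    (fe (X : k[X])).Separable := by
  have hd : (fe (X : k[X])).natDegree = 8 := by
    simp only [fe]; compute_degree!
  have hd0 : (fe (X : k[X])).degree ≠ 0 := by
    intro h0
    rw [natDegree_eq_of_degree_eq_some h0] at hd
    exact absurd hd (by decide)
  have : Nontrivial (AdjoinRoot (fe (X : k[X]))) := AdjoinRoot.nontrivial _ hd0
  have : CharP (AdjoinRoot (fe (X : k[X]))) p :=
    charP_of_injective_ringHom (AdjoinRoot.of (fe (X : k[X]))).injective p
  have h1 : fe (AdjoinRoot.root (fe (X : k[X]))) = 0 := by
    have := AdjoinRoot.mk_self (f := fe (X : k[X]))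
    rwa [map_fe, AdjoinRoot.mk_X] at this
  have h2 := h _ _ h1
  rw [← AdjoinRoot.mk_X, ← map_pow, ← sub_eq_zero, ← map_sub, AdjoinRoot.mk_eq_zero] at h2
  exact (galois_poly_separable p _ (dvd_pow_self p hn)).of_dvd h2

theorem frob_elt {M : Type} [Field M] [NumberField M] [IsGalois ℚ M] (y : RR → 𝓞 M)
    (hy : Function.Injective y) (hf : ∀ r, fe (y r) = 0)
    (hres : ∀ σ : Gal(M/ℚ), ∃ τ : gTilde.Gal, ∀ r, (y (τ • r) : M) = σ (y r))
    (p : ℕ) [Fact p.Prime]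
    (hsep : ∀ (k : Type) [Field k] [CharP k p], (fe (X : k[X])).Separable) :
    ∃ (k : Type) (_ : Field k) (_ : CharP k p) (z : RR → k) (τ : gTilde.Gal),
      Function.Injective z ∧ (∀ r, fe (z r) = 0) ∧ (∀ c, fe c = 0 → ∃ r, z r = c) ∧
      ∀ n r, z (τ ^ n • r) = z r ^ p ^ n := by
  obtain ⟨k, hk, hc, ρ, σ, hσ⟩ := exists_frob M p
  obtain ⟨τ, hτ⟩ := hres σ
  obtain ⟨h1, h2⟩ := frob_data y hy hf ρ (hsep k)
  refine ⟨k, hk, hc, fun r => ρ (y r), τ, h1, ?_, h2, ?_⟩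
  · intro r
    rw [← map_fe, hf, map_zero]
  · intro n
    induction n with
    | zero => intro r; simp
    | succ n ih =>
      intro r
      have := ih (τ • r)
      rw [pow_succ, mul_smul, this]
      change ρ (y (τ • r)) ^ p ^ n = _
      rw [hσ _ _ (hτ r), ← pow_mul, ← pow_succ']

theorem ev_X {A : Type*} [CommRing A] (x : A) : P8.ev ⟨0, 1, 0, 0, 0, 0, 0, 0⟩ x = x := by
  simp [P8.ev]

theorem ev_fix {k : Type} [Field k] (h : P8) (z : RR → k) (hz : Function.Injective z)
    (hfix : ∀ r, P8.ev h (z r) = z r) : (h.a7 : k) = 0 := by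
  let P : k[X] := P8.ev ⟨h.a0, 0, h.a2, h.a3, h.a4, h.a5, h.a6, h.a7⟩ X + ((h.a1 : k[X]) - 1) * X
  have hev : ∀ x : k, P.eval x = P8.ev h x - x := by
    intro x
    simp only [P, P8.ev]
    simp
    ring
  have hd : P.natDegree < Fintype.card RR := by
    rw [card_RR]
    simp only [P, P8.ev]
    refine lt_of_le_of_lt (b := 7) ?_ (by norm_num)
    compute_degree
  have h0 : P = 0 := by
    apply eq_zero_of_natDegree_lt_card_of_eval_eq_zero P hz _ hd
    intro r
    rw [hev, hfix, sub_self]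
  have h7 : P.coeff 7 = h.a7 := by
    simp only [P, P8.ev]
    compute_degree!
  rw [← h7, h0, coeff_zero]

theorem sep7 (k : Type) [Field k] [CharP k 7] : (fe (X : k[X])).Separable :=
  have : Fact (Nat.Prime 7) := ⟨by norm_num⟩
  sep_of_pow 7 7 (by norm_num) fun A _ _ x hx => (x_7_7 hx).trans (ev_X x)
theorem sep13 (k : Type) [Field k] [CharP k 13] : (fe (X : k[X])).Separable :=
  have : Fact (Nat.Prime 13) := ⟨by norm_num⟩
  sep_of_pow 13 6 (by norm_num) fun A _ _ x hx => (x_13_6 hx).trans (ev_X x)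
theorem sep41 (k : Type) [Field k] [CharP k 41] : (fe (X : k[X])).Separable :=
  have : Fact (Nat.Prime 41) := ⟨by norm_num⟩
  sep_of_pow 41 4 (by norm_num) fun A _ _ x hx => (x_41_4 hx).trans (ev_X x)
theorem sep53 (k : Type) [Field k] [CharP k 53] : (fe (X : k[X])).Separable :=
  have : Fact (Nat.Prime 53) := ⟨by norm_num⟩
  sep_of_pow 53 3 (by norm_num) fun A _ _ x hx => (x_53_3 hx).trans (ev_X x)

theorem cast_ne {k : Type} [Field k] (p : ℕ) [CharP k p] (n : ℕ) (h : ¬ p ∣ n) : (n : k) ≠ 0 := by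
  rw [Ne, CharP.cast_eq_zero_iff k p]; exact h

theorem pow_p {k : Type} [Field k] (p : ℕ) [Fact p.Prime] [CharP k p] (n : ℕ) :
    (n : k) ^ p = n := by
  have := ZMod.pow_card (n : ZMod p)
  have h := congrArg (ZMod.castHom (dvd_refl p) k) this
  rwa [map_pow, map_natCast] at h

theorem fe_nat {k : Type} [Field k] (p : ℕ) [CharP k p] (n : ℕ) (h : (p : ℤ) ∣ fe (n : ℤ)) :
    fe (n : k) = 0 := by
  have h2 : ((fe (n : ℤ) : ℤ) : k) = fe (n : k) := by
    have := map_fe (Int.castRingHom k) (n : ℤ)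
    simpa using this
  rw [← h2]
  exact (CharP.intCast_eq_zero_iff k p _).2 h

theorem inv13 : P8.mul 13 c13 ⟨8, 7, 4, 6, 11, 10, 2, 10⟩ ⟨9, 3, 8, 6, 4, 4, 5, 1⟩
    = ⟨1, 0, 0, 0, 0, 0, 0, 0⟩ := by decide +kernel

theorem gal_eq (a b : gTilde.Gal) (h : ∀ r : RR, a • r = b • r) : a = b :=
  FaithfulSMul.eq_of_smul_eq_smul h

theorem exists_g7 {M : Type} [Field M] [NumberField M] [IsGalois ℚ M] (y : RR → 𝓞 M)
    (hy : Function.Injective y) (hf : ∀ r, fe (y r) = 0)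
    (hres : ∀ σ : Gal(M/ℚ), ∃ τ : gTilde.Gal, ∀ r, (y (τ • r) : M) = σ (y r)) :
    ∃ g : gTilde.Gal, orderOf g = 7 ∧ (∃ r : RR, g • r = r) := by
  have : Fact (Nat.Prime 7) := ⟨by norm_num⟩
  obtain ⟨k, _, _, z, τ, hz, hzf, hs, hp⟩ := frob_elt y hy hf hres 7 sep7
  refine ⟨τ, orderOf_eq_prime ?_ ?_, ?_⟩
  · apply gal_eq
    intro r
    apply hz
    rw [hp, x_7_7 (hzf r), ev_X, one_smul]
  · rintro rfl
    refine cast_ne (k := k) 7 1 (by norm_num) (ev_fix ⟨0, 0, 0, 0, 0, 0, 0, 1⟩ z hz fun r => ?_)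
    rw [← x_7_1 (hzf r), ← hp, one_pow, one_smul]
  · obtain ⟨r, hr⟩ := hs (5 : ℕ) (fe_nat 7 5 (by decide +kernel))
    refine ⟨r, hz ?_⟩
    have := hp 1 r
    rwa [pow_one, pow_one, hr, pow_p, ← hr] at this

theorem exists_g3 {M : Type} [Field M] [NumberField M] [IsGalois ℚ M] (y : RR → 𝓞 M)
    (hy : Function.Injective y) (hf : ∀ r, fe (y r) = 0)
    (hres : ∀ σ : Gal(M/ℚ), ∃ τ : gTilde.Gal, ∀ r, (y (τ • r) : M) = σ (y r)) :
    ∃ g : gTilde.Gal, orderOf g = 3 ∧ (∃ r : RR, g • r = r) := by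
  have : Fact (Nat.Prime 53) := ⟨by norm_num⟩
  have : Fact (Nat.Prime 3) := ⟨by norm_num⟩
  obtain ⟨k, _, _, z, τ, hz, hzf, hs, hp⟩ := frob_elt y hy hf hres 53 sep53
  refine ⟨τ, orderOf_eq_prime ?_ ?_, ?_⟩
  · apply gal_eq
    intro r
    apply hz
    rw [hp, x_53_3 (hzf r), ev_X, one_smul]
  · rintro rfl
    refine cast_ne (k := k) 53 25 (by norm_num) (ev_fix ⟨33, 11, 25, 11, 0, 2, 13, 25⟩ z hz fun r => ?_)
    rw [← x_53_1 (hzf r), ← hp, one_pow, one_smul]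
  · obtain ⟨r, hr⟩ := hs (9 : ℕ) (fe_nat 53 9 (by decide +kernel))
    refine ⟨r, hz ?_⟩
    have := hp 1 r
    rwa [pow_one, pow_one, hr, pow_p, ← hr] at this

theorem exists_g4 {M : Type} [Field M] [NumberField M] [IsGalois ℚ M] (y : RR → 𝓞 M)
    (hy : Function.Injective y) (hf : ∀ r, fe (y r) = 0)
    (hres : ∀ σ : Gal(M/ℚ), ∃ τ : gTilde.Gal, ∀ r, (y (τ • r) : M) = σ (y r)) :
    ∃ g : gTilde.Gal, orderOf g = 4 ∧ (∃ r : RR, g • r = r) := by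
  have : Fact (Nat.Prime 41) := ⟨by norm_num⟩
  have : Fact (Nat.Prime 2) := ⟨by norm_num⟩
  obtain ⟨k, _, _, z, τ, hz, hzf, hs, hp⟩ := frob_elt y hy hf hres 41 sep41
  refine ⟨τ, orderOf_eq_prime_pow (p := 2) (n := 1) ?_ ?_, ?_⟩
  · intro h
    refine cast_ne (k := k) 41 38 (by norm_num) (ev_fix ⟨19, 22, 29, 3, 24, 5, 25, 38⟩ z hz fun r => ?_)
    rw [← x_41_2 (hzf r), ← hp]
    rw [pow_one] at h
    rw [h, one_smul]
  · apply gal_eq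
    intro r
    apply hz
    rw [hp, one_smul]
    exact (x_41_4 (hzf r)).trans (ev_X _)
  · obtain ⟨r, hr⟩ := hs (1 : ℕ) (fe_nat 41 1 (by decide +kernel))
    refine ⟨r, hz ?_⟩
    have := hp 1 r
    rwa [pow_one, pow_one, hr, pow_p, ← hr] at this

theorem exists_t {M : Type} [Field M] [NumberField M] [IsGalois ℚ M] (y : RR → 𝓞 M)
    (hy : Function.Injective y) (hf : ∀ r, fe (y r) = 0)
    (hres : ∀ σ : Gal(M/ℚ), ∃ τ : gTilde.Gal, ∀ r, (y (τ • r) : M) = σ (y r)) :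
    ∃ g : gTilde.Gal, ∀ r : RR, g • r ≠ r := by
  have : Fact (Nat.Prime 13) := ⟨by norm_num⟩
  obtain ⟨k, _, _, z, τ, hz, hzf, hs, hp⟩ := frob_elt y hy hf hres 13 sep13
  refine ⟨τ, fun r h => ?_⟩
  have h1 := hp 1 r
  rw [x_13_1 (hzf r), pow_one, h] at h1
  have h2 := P8.ev_mul (p := 13) (c13_spec (hzf r)) ⟨8, 7, 4, 6, 11, 10, 2, 10⟩ ⟨9, 3, 8, 6, 4, 4, 5, 1⟩
  have h3 : P8.ev ⟨9, 3, 8, 6, 4, 4, 5, 1⟩ (z r) = 0 := by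
    rw [← sub_eq_zero.2 h1.symm]
    simp only [P8.ev]
    push_cast
    ring
  rw [inv13, h3, mul_zero] at h2
  simp [P8.ev] at h2

theorem pretrans {M : Type} [Field M] [NumberField M] [IsGalois ℚ M] (y : RR → 𝓞 M)
    (hy : Function.Injective y) (hf : ∀ r, fe (y r) = 0)
    (hres : ∀ σ : Gal(M/ℚ), ∃ τ : gTilde.Gal, ∀ r, (y (τ • r) : M) = σ (y r)) :
    MulAction.IsPretransitive gTilde.Gal RR := by
  obtain ⟨g, hg, -⟩ := exists_g7 y hy hf hres
  obtain ⟨t, ht⟩ := exists_t y hy hf hres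
  refine pretransitive_criterion card_RR g t ?_ ?_ ht
  · intro r
    rw [← hg, pow_orderOf_eq_one, one_smul]
  · by_contra! h
    have : g = 1 := gal_eq _ _ fun r => by rw [h, one_smul]
    rw [this, orderOf_one] at hg
    exact absurd hg (by norm_num)

theorem gTilde_irreducible (h : MulAction.IsPretransitive gTilde.Gal RR) : Irreducible gTilde := by
  have hne : Nonempty RR := Fintype.card_pos_iff.1 (by rw [card_RR]; norm_num)
  obtain ⟨r⟩ := hne
  have hr : aeval (r : gTilde.SplittingField) gTilde = 0 := aeval_eq_zero_of_mem_rootSet r.2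
  have hi : IsIntegral ℚ (r : gTilde.SplittingField) := ⟨gTilde, gTilde_monic, hr⟩
  have hdvd : minpoly ℚ (r : gTilde.SplittingField) ∣ gTilde := minpoly.dvd ℚ _ hr
  have hdeg : gTilde.natDegree ≤ (minpoly ℚ (r : gTilde.SplittingField)).natDegree := by
    by_contra! hlt
    rw [gTilde_natDegree, ← card_RR] at hlt
    have h0 : (minpoly ℚ (r : gTilde.SplittingField)).map (algebraMap ℚ gTilde.SplittingField) = 0 := by
      refine eq_zero_of_natDegree_lt_card_of_eval_eq_zero _
        (f := fun s : RR => (s : gTilde.SplittingField)) Subtype.val_injective ?_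
        (lt_of_le_of_lt natDegree_map_le hlt)
      intro s
      obtain ⟨τ, rfl⟩ := h.exists_smul_eq r s
      rw [eval_map, ← aeval_def, smul_coe]
      have h2 := aeval_algHom_apply (τ : gTilde.SplittingField →+* gTilde.SplittingField).toRatAlgHom
        (r : gTilde.SplittingField) (minpoly ℚ (r : gTilde.SplittingField))
      rw [minpoly.aeval, map_zero] at h2
      exact h2
    exact ((minpoly.monic hi).map _).ne_zero h0
  rw [eq_of_monic_of_dvd_of_natDegree_le (minpoly.monic hi) gTilde_monic hdvd hdeg]
  exact minpoly.irreducible hi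

/-- Numbering of the points of the affine space. -/
def idx (v : V3) : ℕ := (v 0).val + 2 * (v 1).val + 4 * (v 2).val

theorem idx_lt : ∀ v : V3, idx v < 8 := by decide
theorem idx_pos : ∀ v : V3, v ≠ 0 → 0 < idx v := by decide

theorem par_bridge : ∀ w x y : V3,
    par (idx w &&& idx x) = par (idx w &&& idx y) ↔ w ⬝ᵥ x = w ⬝ᵥ y := by
  decide +kernel

theorem fe_root {k : Type} [Field k] [CharP k 4289] (z : k) (h : fe z = 0) :
    ∃ v : V3, z = (aT (idx v) : ℤ) := by
  rw [fe_split] at h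
  simp only [mul_eq_zero, sub_eq_zero] at h
  have e0 : aT (idx ![0, 0, 0]) = 226 := by decide
  have e1 : aT (idx ![1, 0, 0]) = 2493 := by decide
  have e2 : aT (idx ![0, 1, 0]) = 1474 := by decide
  have e3 : aT (idx ![1, 1, 0]) = 3727 := by decide
  have e4 : aT (idx ![0, 0, 1]) = 315 := by decide
  have e5 : aT (idx ![1, 0, 1]) = 3462 := by decide
  have e6 : aT (idx ![0, 1, 1]) = 1835 := by decide
  have e7 : aT (idx ![1, 1, 1]) = 3548 := by decide
  rcases h with ((((((h | h) | h) | h) | h) | h) | h) | h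
  · exact ⟨![0, 0, 0], by rw [e0, h]; norm_num⟩
  · exact ⟨![1, 0, 0], by rw [e1, h]; norm_num⟩
  · exact ⟨![0, 1, 0], by rw [e2, h]; norm_num⟩
  · exact ⟨![1, 1, 0], by rw [e3, h]; norm_num⟩
  · exact ⟨![0, 0, 1], by rw [e4, h]; norm_num⟩
  · exact ⟨![1, 0, 1], by rw [e5, h]; norm_num⟩
  · exact ⟨![0, 1, 1], by rw [e6, h]; norm_num⟩
  · exact ⟨![1, 1, 1], by rw [e7, h]; norm_num⟩

theorem pe_root {k : Type} [Field k] [CharP k 4289] (z : k) (h : pe z = 0) :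
    ∃ v : V3, v ≠ 0 ∧ z = (tT (idx v) : ℤ) := by
  rw [pe_split] at h
  simp only [mul_eq_zero, sub_eq_zero] at h
  have e1 : tT (idx ![1, 0, 0]) = 527 := by decide
  have e2 : tT (idx ![0, 1, 0]) = 2257 := by decide
  have e3 : tT (idx ![1, 1, 0]) = 2374 := by decide
  have e4 : tT (idx ![0, 0, 1]) = 1742 := by decide
  have e5 : tT (idx ![1, 0, 1]) = 2936 := by decide
  have e6 : tT (idx ![0, 1, 1]) = 782 := by decide
  have e7 : tT (idx ![1, 1, 1]) = 1644 := by decide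
  rcases h with (((((h | h) | h) | h) | h) | h) | h
  · exact ⟨![1, 0, 0], by decide, by rw [e1, h]; norm_num⟩
  · exact ⟨![0, 1, 0], by decide, by rw [e2, h]; norm_num⟩
  · exact ⟨![1, 1, 0], by decide, by rw [e3, h]; norm_num⟩
  · exact ⟨![0, 0, 1], by decide, by rw [e4, h]; norm_num⟩
  · exact ⟨![1, 0, 1], by decide, by rw [e5, h]; norm_num⟩
  · exact ⟨![0, 1, 1], by decide, by rw [e6, h]; norm_num⟩
  · exact ⟨![1, 1, 1], by decide, by rw [e7, h]; norm_num⟩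

theorem pe_tT : ∀ v : V3, v ≠ 0 → pe (tT (idx v)) % 4289 = 0 := by decide +kernel

theorem pe_tT_cast {k : Type} [Field k] [CharP k 4289] (v : V3) (hv : v ≠ 0) :
    pe ((tT (idx v) : ℤ) : k) = 0 := by
  have h := map_pe (Int.castRingHom k) (tT (idx v))
  rw [eq_intCast, eq_intCast] at h
  rw [← h, CharP.intCast_eq_zero_iff k 4289]
  exact Int.dvd_of_emod_eq_zero (pe_tT v hv)

theorem sep4289 (k : Type) [Field k] [CharP k 4289] : (fe (X : k[X])).Separable := by
  have h : fe (X : k[X]) = ∏ i : Fin 8, (X - C ((![226, 2493, 1474, 3727, 315, 3462, 1835, 3548] i : ℕ) : k)) := by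
    rw [fe_split]
    simp [Fin.prod_univ_succ]
    ring
  rw [h, separable_prod_X_sub_C_iff]
  intro i j hij
  have hij' := (CharP.natCast_eq_natCast k 4289).1 hij
  revert hij'
  clear hij h
  revert i j
  unfold Nat.ModEq
  decide +kernel

theorem exists_e {k : Type} [Field k] [CharP k 4289] (z : RR → k) (hz : Function.Injective z)
    (hf : ∀ r, fe (z r) = 0) : ∃ e : RR ≃ V3, ∀ r, z r = (aT (idx (e r)) : ℤ) := by
  choose e he using fun r => fe_root (z r) (hf r)
  have hinj : Function.Injective e := by
    intro r r' h
    apply hz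
    rw [he r, he r', h]
  have hb : Function.Bijective e := by
    rw [Fintype.bijective_iff_injective_and_card]
    exact ⟨hinj, by rw [card_RR]; rfl⟩
  exact ⟨Equiv.ofBijective e hb, he⟩

theorem table_k {k : Type} [Field k] [CharP k 4289] (w x y : V3) (hw : w ≠ 0) (t a b : k)
    (ht : t = (tT (idx w) : ℤ)) (ha : a = (aT (idx x) : ℤ)) (hb : b = (aT (idx y) : ℤ)) :
    (w ⬝ᵥ x = w ⬝ᵥ y → ue t a * ve t b + ue t b * ve t a ≠ 0) ∧
    (w ⬝ᵥ x ≠ w ⬝ᵥ y → ue t a * ve t b - ue t b * ve t a ≠ 0) := by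
  have h := table_check (idx w) (idx_lt w) (idx_pos w hw) (idx x) (idx_lt x) (idx y) (idx_lt y)
  have hu : ∀ s c : ℤ, ue (s : k) (c : k) = ((ue s c : ℤ) : k) := fun s c =>
    (map_ue (Int.castRingHom k) s c).symm
  have hv : ∀ s c : ℤ, ve (s : k) (c : k) = ((ve s c : ℤ) : k) := fun s c =>
    (map_ve (Int.castRingHom k) s c).symm
  subst ht ha hb
  rw [hu, hu, hv, hv]
  constructor
  · intro hd h0
    rw [if_pos ((par_bridge w x y).2 hd)] at h
    rw [← Int.cast_mul, ← Int.cast_mul, ← Int.cast_add, CharP.intCast_eq_zero_iff k 4289] at h0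
    exact h (Int.emod_eq_zero_of_dvd h0)
  · intro hd h0
    rw [if_neg (fun hh => hd ((par_bridge w x y).1 hh))] at h
    rw [← Int.cast_mul, ← Int.cast_mul, ← Int.cast_sub, CharP.intCast_eq_zero_iff k 4289] at h0
    exact h (Int.emod_eq_zero_of_dvd h0)

theorem rel_iff {A k : Type} [CommRing A] [IsDomain A] [Field k] [CharP k 4289] (ρ : A →+* k)
    (t a b : A) (ht : pe t = 0) (ha : fe a = 0) (hb : fe b = 0) (w x y : V3) (hw : w ≠ 0)
    (hwt : ρ t = (tT (idx w) : ℤ)) (hxa : ρ a = (aT (idx x) : ℤ)) (hyb : ρ b = (aT (idx y) : ℤ)) :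
    ue t a * ve t b = ue t b * ve t a ↔ w ⬝ᵥ x = w ⬝ᵥ y := by
  obtain ⟨h1, h2⟩ := table_k w x y hw (ρ t) (ρ a) (ρ b) hwt hxa hyb
  rw [← map_ue, ← map_ue, ← map_ve, ← map_ve, ← map_mul, ← map_mul] at h1 h2
  rw [← map_add] at h1
  rw [← map_sub] at h2
  constructor
  · intro h
    by_contra hne
    exact h2 hne (by rw [h, sub_self, map_zero])
  · intro h
    have h3 : (ue t a * ve t b - ue t b * ve t a) * (ue t a * ve t b + ue t b * ve t a) = 0 := by
      have ca := ue_ve_cert t a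
      have cb := ue_ve_cert t b
      rw [ha, ht] at ca
      rw [hb, ht] at cb
      linear_combination ve t b ^ 2 * ca - ve t a ^ 2 * cb
    rcases mul_eq_zero.1 h3 with h4 | h4
    · exact sub_eq_zero.1 h4
    · exact absurd (by rw [h4, map_zero]) (h1 h)

theorem zmod2_aux : ∀ a b c d : ZMod 2, (a = b ↔ c = d) → a - b = c - d := by decide

theorem aff (π : V3 → V3) (hπ : Function.Injective π) (w : Fin 3 → V3)
    (h : ∀ i x x', π x i = π x' i ↔ w i ⬝ᵥ x = w i ⬝ᵥ x') : ∃ A : AGL32, ∀ x, π x = A x := by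
  let f : V3 →ₗ[ZMod 2] V3 := (Matrix.of w).mulVecLin
  have hf : ∀ x, π x = f x + π 0 := by
    intro x
    funext i
    have := zmod2_aux _ _ _ _ (h i x 0)
    rw [dotProduct_zero, sub_zero] at this
    rw [Pi.add_apply, ← sub_eq_iff_eq_add, this]
    rfl
  have hinj : Function.Injective f := by
    intro x x' hx
    apply hπ
    rw [hf x, hf x', hx]
  let L : V3 ≃ₗ[ZMod 2] V3 := LinearEquiv.ofInjectiveEndo f hinj
  refine ⟨L.toAffineEquiv.trans (AffineEquiv.constVAdd (ZMod 2) V3 (π 0)), fun x => ?_⟩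
  rw [hf x, add_comm]
  rfl

theorem exists_t_lift {M : Type} [Field M] [NumberField M]
    (hs : ((pe (X : ℤ[X])).map (algebraMap ℤ M)).Splits) {k : Type} [Field k]
    (ρ : 𝓞 M →+* k) (c : k) (hc : pe c = 0) : ∃ t : 𝓞 M, pe t = 0 ∧ ρ t = c := by
  obtain ⟨S, hS⟩ := exists_multiset _ peX_monic hs
  rw [← coe_mapRingHom, map_pe, coe_mapRingHom, map_X] at hS
  have h1 := congrArg (fun P => eval c (Polynomial.map ρ P)) hS
  simp only [Polynomial.map_multiset_prod, eval_multiset_prod, Multiset.map_map] at h1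
  rw [← coe_mapRingHom, map_pe, coe_mapRingHom, map_X, ← coe_evalRingHom, map_pe,
    coe_evalRingHom, eval_X, hc] at h1
  obtain ⟨t, ht, ht0⟩ := Multiset.mem_map.1 (Multiset.prod_eq_zero_iff.1 h1.symm)
  refine ⟨t, ?_, ?_⟩
  · have h2 := congrArg (eval t) hS
    rw [← coe_evalRingHom, map_pe, coe_evalRingHom, eval_X, eval_multiset_prod] at h2
    rw [h2]
    apply Multiset.prod_eq_zero
    rw [Multiset.map_map]
    exact Multiset.mem_map.2 ⟨t, ht, by simp⟩
  · simp at ht0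
    exact (sub_eq_zero.1 ht0).symm

theorem haff {M : Type} [Field M] [NumberField M] [IsGalois ℚ M] (y : RR → 𝓞 M)
    (hf : ∀ r, fe (y r) = 0)
    (hs : ((pe (X : ℤ[X])).map (algebraMap ℤ M)).Splits)
    {k : Type} [Field k] [CharP k 4289] (ρ : 𝓞 M →+* k) (e : RR ≃ V3)
    (he : ∀ r, ρ (y r) = (aT (idx (e r)) : ℤ))
    (τ : gTilde.Gal) (σ : Gal(M/ℚ)) (hσ : ∀ r, (y (τ • r) : M) = σ (y r)) :
    ∃ A : AGL32, ∀ r, e (τ • r) = A (e r) := by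
  let s : 𝓞 M ≃+* 𝓞 M := RingOfIntegers.mapRingEquiv σ.toRingEquiv
  have hsy : ∀ r, s (y r) = y (τ • r) := fun r => RingOfIntegers.ext (hσ r).symm
  have key : ∀ i : Fin 3, ∃ w : V3, ∀ r r', e (τ • r) i = e (τ • r') i ↔ w ⬝ᵥ e r = w ⬝ᵥ e r' := by
    intro i
    have hne : (Pi.single i 1 : V3) ≠ 0 := by
      revert i; decide
    obtain ⟨t, ht, hρt⟩ := exists_t_lift hs ρ _ (pe_tT_cast (Pi.single i 1) hne)
    obtain ⟨t', rfl⟩ := s.surjective t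
    have ht' : pe t' = 0 := by
      apply s.injective
      rw [map_zero]
      exact (map_pe s.toRingHom t').trans ht
    obtain ⟨w, hw, hwt⟩ := pe_root (ρ t') (by rw [← map_pe, ht', map_zero])
    refine ⟨w, fun r r' => ?_⟩
    rw [← rel_iff ρ t' (y r) (y r') ht' (hf r) (hf r') w _ _ hw hwt (he r) (he r')]
    have h2 := rel_iff ρ (s t') (y (τ • r)) (y (τ • r')) ht (hf _) (hf _) (Pi.single i 1) _ _ hne hρt
      (he _) (he _)
    rw [single_one_dotProduct, single_one_dotProduct] at h2
    have hu : ∀ a, s (ue t' a) = ue (s t') (s a) := map_ue s.toRingHom t'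
    have hv : ∀ a, s (ve t' a) = ve (s t') (s a) := map_ve s.toRingHom t'
    rw [← h2, ← hsy, ← hsy, ← hu, ← hu, ← hv, ← hv, ← map_mul, ← map_mul, s.injective.eq_iff]
  choose w hw using key
  obtain ⟨A, hA⟩ := aff (fun v => e (τ • e.symm v))
    (e.injective.comp ((MulAction.injective τ).comp e.symm.injective)) w (by
      intro i x x'
      have := hw i (e.symm x) (e.symm x')
      rwa [e.apply_symm_apply, e.apply_symm_apply] at this)
  refine ⟨A, fun r => ?_⟩
  have := hA (e r)
  simpa using this


/-- The polynomial `g̃` is irreducible over `ℚ` and its Galois group over `ℚ` is isomorphic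
to `AGL₃(2)`, compatibly with its natural degree-8 permutation action: there is a bijection
between the 8 roots of `g̃` and the affine space `F₂³` carrying the Galois action to the
natural action of `AGL₃(2)`. -/
theorem gTilde_irreducible_and_galois_group_AGL32 :
    Irreducible gTilde ∧
    ∃ (iso : gTilde.Gal ≃* AGL32)
      (e : gTilde.rootSet gTilde.SplittingField ≃ V3),
      ∀ (σ : gTilde.Gal) (r : gTilde.rootSet gTilde.SplittingField),
        e (σ • r) = (iso σ) (e r) := by
  obtain ⟨M, _, _, _, hsg, hsp⟩ := exists_M
  obtain ⟨y, hy, hf, hres, hext⟩ := exists_y M hsg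
  have : Fact (Nat.Prime 4289) := ⟨by norm_num⟩
  have hpt : MulAction.IsPretransitive gTilde.Gal RR := pretrans y hy hf hres
  refine ⟨gTilde_irreducible hpt, ?_⟩
  obtain ⟨k, _, _, ρ, -, -⟩ := exists_frob M 4289
  obtain ⟨hinj, -⟩ := frob_data y hy hf ρ (sep4289 k)
  obtain ⟨e, he⟩ := exists_e (fun r => ρ (y r)) hinj fun r => by rw [← map_fe, hf, map_zero]
  obtain ⟨g7, h7, f7⟩ := exists_g7 y hy hf hres
  obtain ⟨g3, h3, f3⟩ := exists_g3 y hy hf hres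
  obtain ⟨g4, h4, f4⟩ := exists_g4 y hy hf hres
  obtain ⟨iso, hiso⟩ := group_criterion (G := gTilde.Gal) (R := RR) e (fun τ => by
    obtain ⟨σ, hσ⟩ := hext τ
    exact haff y hf hsp ρ e he τ σ hσ) g7 g3 g4 h7 h3 h4 f7 f3 f4
  exact ⟨iso, e, hiso⟩
end

section
/- Every subgroup of AGL₃(2), in its natural degree-8 permutation action on the affine space F₂³, that has at least one fixed point and at least one orbit of length 3 is isomorphic to one of the groups C₃, S₃, A₄, or S₄. -/
/-- Restriction of a permutation representation to an invariant subset. -/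
def restrictHom {G α : Type*} [Group G] (φ : G →* Equiv.Perm α) (p : α → Prop)
    (hp : ∀ g x, p (φ g x) ↔ p x) : G →* Equiv.Perm {x // p x} :=
  MonoidHom.mk' (fun g => (φ g).subtypePerm (hp g)) (by
    intro a b
    ext x
    simp only [map_mul]; rfl)

theorem restrictHom_injective {G α : Type*} [Group G] (φ : G →* Equiv.Perm α) (p : α → Prop)
    (hp : ∀ g x, p (φ g x) ↔ p x) (h : ∀ g, (∀ x, p x → φ g x = x) → g = 1) :
    Function.Injective (restrictHom φ p hp) := by
  rw [injective_iff_map_eq_one]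
  intro g hg
  apply h
  intro x hx
  have := congrArg (fun f => (f ⟨x, hx⟩ : {x // p x}).1) hg
  simpa [restrictHom] using this

theorem orbit_dvd {G α : Type*} [Group G] (φ : G →* Equiv.Perm α) (a : α) :
    Nat.card {w : α | ∃ g, φ g a = w} ∣ Nat.card G := by
  let _ := MulAction.compHom α φ
  have h1 := MulAction.index_stabilizer G a
  have h2 : MulAction.orbit G a = {w : α | ∃ g, φ g a = w} := rfl
  have h3 : Nat.card {w : α | ∃ g, φ g a = w} = (MulAction.stabilizer G a).index := by
    rw [h1, h2, Nat.card_coe_set_eq]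
  rw [h3]
  exact Subgroup.index_dvd_card _

theorem bij_of_card {G K : Type*} [Group G] [Group K] [Finite K] (f : G →* K)
    (h : Function.Injective f) (h' : Nat.card G = Nat.card K) : Nonempty (G ≃* K) :=
  ⟨MulEquiv.ofBijective f ((Nat.bijective_iff_injective_and_card f).2 ⟨h, h'⟩)⟩

theorem order_three_perm : ∀ σ : Equiv.Perm (Fin 4), σ ^ 3 = 1 → σ ≠ 1 →
    ∃ i, σ i = i ∧ ∀ j k, j ≠ i → k ≠ i → (k = j ∨ k = σ j ∨ k = σ (σ j)) := by
  decide +kernel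

theorem classify {G : Type*} [Group G] (φ : G →* Equiv.Perm (Fin 4))
    (hφ : Function.Injective φ) (h3 : 3 ∣ Nat.card G) :
    Nonempty (G ≃* Multiplicative (ZMod 3)) ∨
    Nonempty (G ≃* Equiv.Perm (Fin 3)) ∨
    Nonempty (G ≃* alternatingGroup (Fin 4)) ∨
    Nonempty (G ≃* Equiv.Perm (Fin 4)) := by
  have hfin : Finite G := Finite.of_injective φ hφ
  have c4 : Nat.card (Equiv.Perm (Fin 4)) = 24 := by
    rw [Nat.card_perm, Nat.card_fin]; rfl
  have c3 : Nat.card (Equiv.Perm (Fin 3)) = 6 := by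
    rw [Nat.card_perm, Nat.card_fin]; rfl
  have hd : Nat.card G ∣ 24 := c4 ▸ Subgroup.card_dvd_of_injective φ hφ
  have hcases : Nat.card G = 3 ∨ Nat.card G = 6 ∨ Nat.card G = 12 ∨ Nat.card G = 24 := by
    obtain ⟨m, hm⟩ := h3
    rw [hm] at hd ⊢
    have : m ∣ 8 := by
      obtain ⟨k, hk⟩ := hd
      exact ⟨k, by nlinarith⟩
    have h8 : m ≤ 8 := Nat.le_of_dvd (by norm_num) this
    interval_cases m <;> simp_all
  let e : G ≃* φ.range := MonoidHom.ofInjective hφ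
  rcases hcases with h | h | h | h
  · left
    have : Fact (Nat.Prime 3) := ⟨by norm_num⟩
    exact ⟨mulEquivOfPrimeCardEq (p := 3) h (by simp)⟩
  · right; left
    have : Fact (Nat.Prime 3) := ⟨by norm_num⟩
    obtain ⟨g, hg⟩ := exists_prime_orderOf_dvd_card' (G := G) 3 h3
    have hg3 : φ g ^ 3 = 1 := by rw [← map_pow, ← hg, pow_orderOf_eq_one, map_one]
    have hg1 : φ g ≠ 1 := by
      intro hh
      have : g = 1 := hφ (by rw [hh, map_one])
      rw [this, orderOf_one] at hg
      omega
    obtain ⟨i, hi, hi'⟩ := order_three_perm _ hg3 hg1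
    have hfix : ∀ x, φ x i = i := by
      by_contra hcon
      push Not at hcon
      obtain ⟨x, hx⟩ := hcon
      have huniv : {w | ∃ y, φ y i = w} = Set.univ := by
        rw [Set.eq_univ_iff_forall]
        intro k
        by_cases hk : k = i
        · exact ⟨1, by simp [hk]⟩
        · rcases hi' _ k hx hk with h | h | h
          · exact ⟨x, h.symm⟩
          · exact ⟨g * x, by simp [h]⟩
          · exact ⟨g * (g * x), by simp [h]⟩
      have := orbit_dvd φ i
      rw [huniv, h, Nat.card_univ, Nat.card_fin] at this
      omega
    have hp : ∀ g x, (φ g x ≠ i) ↔ x ≠ i := by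
      intro g x
      rw [not_iff_not]
      constructor
      · intro hh; exact (φ g).injective (hh.trans (hfix g).symm)
      · rintro rfl; exact hfix g
    have hinj := restrictHom_injective φ (fun x => x ≠ i) hp (by
      intro g hg
      apply hφ
      ext x
      rw [map_one, Equiv.Perm.one_apply]
      by_cases hx : x = i
      · rw [hx, hfix]
      · rw [hg x hx])
    have e3 : {x : Fin 4 // x ≠ i} ≃ Fin 3 :=
      Fintype.equivFinOfCardEq (by simp)
    have e' : Equiv.Perm {x : Fin 4 // x ≠ i} ≃* Equiv.Perm (Fin 3) := e3.permCongrHom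
    exact bij_of_card (e'.toMonoidHom.comp (restrictHom φ (fun x => x ≠ i) hp))
      (e'.injective.comp hinj) (by rw [h, c3])
  · right; right; left
    have hr : Nat.card φ.range = 12 := by rw [← Nat.card_congr e.toEquiv, h]
    have hidx : φ.range.index = 2 := by
      have := φ.range.index_mul_card
      rw [hr, c4] at this
      omega
    have := Equiv.Perm.eq_alternatingGroup_of_index_eq_two hidx
    exact ⟨e.trans (MulEquiv.subgroupCongr this)⟩
  · right; right; right
    exact bij_of_card φ hφ (by rw [h, c4])


set_option synthInstance.maxHeartbeats 400000 in
theorem span_four : ∀ a b c x : V3,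
    (a ≠ 0 ∧ b ≠ 0 ∧ c ≠ 0 ∧ a ≠ b ∧ a ≠ c ∧ b ≠ c) → c ≠ a + b →
    x ∈ [0, a, b, c, a + b, a + c, b + c, a + b + c] := by
  decide +kernel

set_option synthInstance.maxHeartbeats 400000 in
theorem span_compl : ∀ a b : V3, ∃ p : V3, p ∉ [0, a, b, a + b] ∧
    ∀ x ∈ [0, a, b, a + b], x + p ∉ [0, a, b, a + b] := by
  decide +kernel

theorem affine_three (h : AGL32) (p q r : V3) : h (p + q - r) = h p + h q - h r := by
  have h1 : h ((p -ᵥ r) +ᵥ q) = h.linear (p -ᵥ r) +ᵥ h q := h.map_vadd _ _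
  have h2 : h.linear (p -ᵥ r) = h p -ᵥ h r := h.toAffineMap.linearMap_vsub p r
  rw [h2] at h1
  simp only [vsub_eq_sub, vadd_eq_add] at h1
  have h3 : p + q - r = p - r + q := by abel
  rw [h3, h1]
  abel

/-- The permutation representation of a subgroup of the affine group. -/
def permRep (H : Subgroup AGL32) : H →* Equiv.Perm V3 :=
  MonoidHom.mk' (fun h => (h : AGL32).toEquiv) (fun _ _ => rfl)

theorem classify_set (H : Subgroup AGL32) (p : V3 → Prop)
    (hp : ∀ g : H, ∀ x, p ((g : AGL32) x) ↔ p x) (hc : Nat.card {x // p x} = 4)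
    (h : ∀ g : H, (∀ x, p x → (g : AGL32) x = x) → ∀ x, (g : AGL32) x = x)
    (h3 : 3 ∣ Nat.card H) :
    Nonempty (H ≃* Multiplicative (ZMod 3)) ∨
    Nonempty (H ≃* Equiv.Perm (Fin 3)) ∨
    Nonempty (H ≃* alternatingGroup (Fin 4)) ∨
    Nonempty (H ≃* Equiv.Perm (Fin 4)) := by
  have e4 : {x // p x} ≃ Fin 4 := Finite.equivFinOfCardEq hc
  have e' : Equiv.Perm {x // p x} ≃* Equiv.Perm (Fin 4) := e4.permCongrHom
  refine classify (e'.toMonoidHom.comp (restrictHom (permRep H) p hp))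
    (e'.injective.comp (restrictHom_injective _ p hp ?_)) h3
  intro g hg
  apply Subtype.ext
  apply AffineEquiv.ext
  exact h g hg

/-- Every subgroup of `AGL₃(2)` (in its natural degree-8 permutation action on `F₂³`) having
at least one fixed point and at least one orbit of length `3` is isomorphic to one of
`C₃`, `S₃`, `A₄`, `S₄`. -/
theorem subgroups_of_AGL32_with_fixed_point_and_orbit_of_length_three
    (H : Subgroup AGL32)
    (hfix : ∃ v : V3, ∀ h ∈ H, (h : AGL32) v = v)
    (horb : ∃ v : V3, Nat.card {w : V3 | ∃ h ∈ H, (h : AGL32) v = w} = 3) :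
    Nonempty (H ≃* Multiplicative (ZMod 3)) ∨
    Nonempty (H ≃* Equiv.Perm (Fin 3)) ∨
    Nonempty (H ≃* alternatingGroup (Fin 4)) ∨
    Nonempty (H ≃* Equiv.Perm (Fin 4)) := by
  obtain ⟨o, ho⟩ := hfix
  obtain ⟨v, hv⟩ := horb
  set O : Set V3 := {w : V3 | ∃ h ∈ H, (h : AGL32) v = w} with hO
  have h3 : 3 ∣ Nat.card H := by
    have h1 := orbit_dvd (permRep H) v
    have h2 : {w : V3 | ∃ g, permRep H g v = w} = O := by
      ext w
      exact ⟨fun ⟨g, hg⟩ => ⟨g.1, g.2, hg⟩, fun ⟨g, hg, hw⟩ => ⟨⟨g, hg⟩, hw⟩⟩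
    rwa [h2, hv] at h1
  have hinv1 : ∀ g ∈ H, ∀ x ∈ O, (g : AGL32) x ∈ O := by
    rintro g hg x ⟨k, hk, rfl⟩
    exact ⟨g * k, H.mul_mem hg hk, rfl⟩
  rw [Nat.card_coe_set_eq, Set.ncard_eq_three] at hv
  obtain ⟨a, b, c, hab, hac, hbc, habc⟩ := hv
  change O = {a, b, c} at habc
  have hoO : o ∉ O := by
    rintro ⟨g, hg, hgv⟩
    have hvo : v = o := g.injective (hgv.trans (ho g hg).symm)
    have hall : ∀ x ∈ O, x = o := by
      rintro x ⟨k, hk, rfl⟩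
      rw [hvo, ho k hk]
    exact hab ((hall a (by simp [habc])).trans (hall b (by simp [habc])).symm)
  have hao : a ≠ o := fun h => hoO (by simp [habc, ← h])
  have hbo : b ≠ o := fun h => hoO (by simp [habc, ← h])
  have hco : c ≠ o := fun h => hoO (by simp [habc, ← h])
  clear_value O
  -- the invariant four-element set
  have hT1 : ∀ g ∈ H, ∀ x ∈ insert o O, (g : AGL32) x ∈ insert o O := by
    rintro g hg x (rfl | hx)
    · left; exact ho g hg
    · right; exact hinv1 g hg x hx
  have hT : ∀ g : H, ∀ x, (g : AGL32) x ∈ insert o O ↔ x ∈ insert o O := by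
    intro g x
    refine ⟨fun hx => ?_, hT1 g.1 g.2 x⟩
    have h1 := hT1 (g⁻¹ : H).1 (g⁻¹ : H).2 _ hx
    have h2 : ((g⁻¹ : H).1 : AGL32) ((g : AGL32) x) = x := (g : AGL32).symm_apply_apply x
    rwa [h2] at h1
  have hcard : (insert o O).ncard = 4 := by
    rw [Set.ncard_insert_of_notMem hoO, Set.ncard_eq_three.2 ⟨a, b, c, hab, hac, hbc, habc⟩]
  have hmem : ∀ x, x ∈ insert o O ↔ x = o ∨ x = a ∨ x = b ∨ x = c := by
    intro x; simp [habc]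
  have hne : a - o ≠ 0 ∧ b - o ≠ 0 ∧ c - o ≠ 0 ∧ a - o ≠ b - o ∧ a - o ≠ c - o ∧
      b - o ≠ c - o := by
    simp only [ne_eq, sub_eq_zero, sub_left_inj]
    exact ⟨hao, hbo, hco, hab, hac, hbc⟩
  by_cases hpl : c - o = (a - o) + (b - o)
  · -- `{o, a, b, c}` is an affine plane: act on its complement
    refine classify_set H (fun x => x ∉ insert o O) (fun g x => not_congr (hT g x)) ?_ ?_ h3
    · have h1 := Set.ncard_add_ncard_compl (insert o O)
      have h2 : Nat.card V3 = 8 := by simp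
      rw [hcard, h2] at h1
      have h4 : Nat.card {x // x ∉ insert o O} = (insert o O)ᶜ.ncard :=
        Nat.card_coe_set_eq _
      omega
    · intro g hg x
      by_cases hx : x ∈ insert o O
      · obtain ⟨p, hp1, hp2⟩ := span_compl (a - o) (b - o)
        have hmem' : ∀ y, y - o ∈ [0, a - o, b - o, (a - o) + (b - o)] ↔ y ∈ insert o O := by
          intro y
          rw [hmem, ← hpl]
          simp [sub_eq_zero]
        have hq := hp2 (x - o) ((hmem' x).2 hx)
        have e1 : p = (p + o) - o := by abel
        have e2 : x - o + p = (x + p) - o := by abel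
        rw [e1, hmem'] at hp1
        rw [e2, hmem'] at hq
        have two : (2 : V3) = 0 := by decide
        have hx' : x = (p + o) + (x + p) - o := by linear_combination (-p) * two
        rw [hx', affine_three, hg _ hp1, hg _ hq, ho g.1 g.2]
      · exact hg x hx
  · refine classify_set H (fun x => x ∈ insert o O) hT ?_ ?_ h3
    · exact (Nat.card_coe_set_eq _).trans hcard
    · intro g hg x
      have go := hg o ((hmem o).2 (by simp))
      have ga := hg a ((hmem a).2 (by simp))
      have gb := hg b ((hmem b).2 (by simp))
      have gc := hg c ((hmem c).2 (by simp))
      have key : ∀ p q : V3, (g : AGL32) p = p → (g : AGL32) q = q →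
          (g : AGL32) (p + q - o) = p + q - o := by
        intro p q hp hq
        rw [affine_three, hp, hq, go]
      have hs := span_four (a - o) (b - o) (c - o) (x - o) hne hpl
      simp only [List.mem_cons, List.not_mem_nil, or_false] at hs
      rcases hs with h | h | h | h | h | h | h | h
      · rw [show x = o by linear_combination h, go]
      · rw [show x = a by linear_combination h, ga]
      · rw [show x = b by linear_combination h, gb]
      · rw [show x = c by linear_combination h, gc]
      · rw [show x = a + b - o by linear_combination h]; exact key _ _ ga gb
      · rw [show x = a + c - o by linear_combination h]; exact key _ _ ga gc
      · rw [show x = b + c - o by linear_combination h]; exact key _ _ gb gc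
      · rw [show x = (a + b - o) + c - o by linear_combination h]
        exact key _ _ (key _ _ ga gb) gc
end

section
/- Let φ: G_Q_p → G be a homomorphism from the absolute Galois group of Q_p whose image has inertia subgroup of odd order, and let ε: G̃ → G be a central extension with kernel of order 2 (restricted over the image of φ). Then the local embedding problem (φ, ε) is solvable: there exists a homomorphism ψ: G_Q_p → G̃ with ε ∘ ψ = φ. In particular, a central embedding problem over Q with kernel C₂ is locally solvable at every finite prime p whose inertia group in the given G-extension has odd order. -/
/-- The absolute Galois group of `ℚ_p`. -/
abbrev GQp (p : ℕ) [Fact p.Prime] : Type :=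
  AlgebraicClosure ℚ_[p] ≃ₐ[ℚ_[p]] AlgebraicClosure ℚ_[p]

/-- `y` lies in the maximal ideal of the valuation ring (the integral closure of `ℤ_p`)
of the algebraic closure of `ℚ_p`: either `y = 0` or `y⁻¹` is not integral over `ℤ_p`. -/
def InMaxIdeal (p : ℕ) [Fact p.Prime] (y : AlgebraicClosure ℚ_[p]) : Prop :=
  y = 0 ∨ ¬ IsIntegral ℤ_[p] y⁻¹

/-- The (absolute) inertia subgroup of `G_{ℚ_p}`: the elements acting trivially on the
residue field of the valuation ring of the algebraic closure of `ℚ_p`. -/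
def absInertia (p : ℕ) [Fact p.Prime] : Set (GQp p) :=
  {σ | ∀ x : AlgebraicClosure ℚ_[p], IsIntegral ℤ_[p] x → InMaxIdeal p (σ x - x)}


/-- a non-square in a commutative group is detected by a quadratic character -/
lemma exists_char_of_not_sq {D : Type*} [CommGroup D] (c : D) (hc : ∀ d : D, d ^ 2 ≠ c) :
    ∃ χ : D →* Multiplicative (ZMod 2), χ c ≠ 1 := by
  let S : AddSubgroup (Additive D) := (nsmulAddMonoidHom 2).range
  let : Module (ZMod 2) (Additive D ⧸ S) := AddCommGroup.zmodModule (by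
    intro x
    induction x using QuotientAddGroup.induction_on with
    | H z =>
      rw [← QuotientAddGroup.mk_nsmul, QuotientAddGroup.eq_zero_iff]
      exact ⟨z, rfl⟩)
  have hne : ((Additive.ofMul c : Additive D) : Additive D ⧸ S) ≠ 0 := by
    rw [Ne, QuotientAddGroup.eq_zero_iff]
    rintro ⟨z, hz⟩
    exact hc z.toMul hz
  have : ∃ f : Module.Dual (ZMod 2) (Additive D ⧸ S),
      f ((Additive.ofMul c : Additive D) : Additive D ⧸ S) ≠ 0 := by
    by_contra! h
    exact hne ((Module.forall_dual_apply_eq_zero_iff (ZMod 2) _).1 h)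
  obtain ⟨f, hf⟩ := this
  let g : Additive D →+ ZMod 2 := f.toAddMonoidHom.comp (QuotientAddGroup.mk' S)
  refine ⟨AddMonoidHom.toMultiplicativeRight g, ?_⟩
  intro h
  exact hf h

/-- odd power map is a homomorphism onto the central kernel over an odd-order subgroup -/
lemma exists_odd_pow {G Gt : Type*} [Group G] [Group Gt] (ε : Gt →* G)
    (hker : Nat.card ε.ker = 2) (hcentral : ε.ker ≤ Subgroup.center Gt)
    (J : Subgroup G) (hJ : Odd (Nat.card J)) :
    ∃ M : ℕ, Odd M ∧ (∀ u, ε u ∈ J → ε (u ^ M) = 1) ∧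
      ∀ u v, ε u ∈ J → ε v ∈ J → (u * v) ^ M = u ^ M * v ^ M := by
  let T : Subgroup Gt := J.comap ε
  have hkT : ε.ker ≤ T := fun x hx => by
    change ε x ∈ J; rw [MonoidHom.mem_ker.1 hx]; exact J.one_mem
  let ε' : T →* J := (ε.comp T.subtype).codRestrict J (fun x => x.2)
  have hkerle : ε'.ker ≤ Subgroup.center T := by
    intro x hx
    rw [Subgroup.mem_center_iff]
    intro y
    apply Subtype.ext
    have : (x : Gt) ∈ ε.ker := congrArg Subtype.val (MonoidHom.mem_ker.1 hx)
    exact Subgroup.mem_center_iff.1 (hcentral this) y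
  have hdiv : (Subgroup.center T).index ∣ Nat.card J := by
    refine (Subgroup.index_dvd_of_le hkerle).trans ?_
    rw [Subgroup.index_ker]
    exact Subgroup.card_subgroup_dvd_card _
  have hodd : Odd (Subgroup.center T).index := Odd.of_dvd_nat hJ hdiv
  have : (Subgroup.center T).FiniteIndex := ⟨hodd.pos.ne'⟩
  refine ⟨(Subgroup.center T).index * Nat.card J, hodd.mul hJ, ?_, ?_⟩
  · intro u hu
    rw [mul_comm, pow_mul, map_pow, map_pow]
    have : (⟨ε u, hu⟩ : J) ^ Nat.card J = 1 := pow_card_eq_one'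
    have := congrArg Subtype.val this
    simp only [Subgroup.coe_pow, Subgroup.coe_one] at this
    rw [this, one_pow]
  · intro u v hu hv
    have h := map_mul (MonoidHom.transferCenterPow T) ⟨u, hu⟩ ⟨v, hv⟩
    have h2 : (u * v) ^ (Subgroup.center T).index =
        u ^ (Subgroup.center T).index * v ^ (Subgroup.center T).index :=
      congrArg (fun z : Subgroup.center T => ((z : T) : Gt)) h
    have hz := Subgroup.mem_center_iff.1 ((MonoidHom.transferCenterPow T) ⟨v, hv⟩).2
      (((MonoidHom.transferCenterPow T) ⟨u, hu⟩ : Subgroup.center T) : T)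
    have hz' : Commute (u ^ (Subgroup.center T).index) (v ^ (Subgroup.center T).index) :=
      congrArg Subtype.val hz
    rw [pow_mul, pow_mul, pow_mul, h2, hz'.mul_pow]

lemma lift_of_surjective {Γ G Gt : Type*} [Group Γ] [Group G] [Group Gt]
    (φ : Γ →* G) (hφ : Function.Surjective φ)
    (ε : Gt →* G) (hsurj : Function.Surjective ε)
    (hker : Nat.card ε.ker = 2) (hcentral : ε.ker ≤ Subgroup.center Gt)
    (I : Subgroup Γ) [I.Normal] (hodd : Odd (Nat.card (I.map φ)))
    (hcomm : ∀ a b : Γ, a * b * a⁻¹ * b⁻¹ ∈ I)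
    (hsq : ∀ a : Γ, a ^ 2 ∈ I → a ∈ I)
    (F : Γ) (hF : ∀ a : Γ, ∃ n : ℤ, φ a * (φ F ^ n)⁻¹ ∈ I.map φ) :
    ∃ ψ : Γ →* Gt, ε.comp ψ = φ := by
  obtain ⟨M, hM, hM1, hM2⟩ := exists_odd_pow ε hker hcentral _ hodd
  have hIn : (I.map φ).Normal := Subgroup.Normal.map inferInstance φ hφ
  -- the generator of the kernel
  have hcsq : ∀ c ∈ ε.ker, c ^ 2 = 1 := by
    intro c hc
    have : (⟨c, hc⟩ : ε.ker) ^ Nat.card ε.ker = 1 := pow_card_eq_one'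
    rw [hker] at this
    exact congrArg Subtype.val this
  have hcM : ∀ c ∈ ε.ker, c ^ M = c := by
    intro c hc
    obtain ⟨m, rfl⟩ := hM
    rw [pow_succ, pow_mul, hcsq c hc, one_pow, one_mul]
  obtain ⟨c0, c1, hc01, hcuniv⟩ := Nat.card_eq_two_iff.1 hker
  have : ∃ c ∈ ε.ker, c ≠ 1 ∧ ∀ d ∈ ε.ker, d = 1 ∨ d = c := by
    have hall : ∀ d : ε.ker, d = c0 ∨ d = c1 := fun d => by
      have : d ∈ ({c0, c1} : Set ε.ker) := by rw [hcuniv]; trivial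
      simpa using this
    rcases hall 1 with h | h
    · refine ⟨c1, c1.2, fun h' => hc01 (h.symm.trans (Subtype.ext h'.symm)), fun d hd => ?_⟩
      rcases hall ⟨d, hd⟩ with h2 | h2
      · left; rw [← h] at h2; exact congrArg Subtype.val h2
      · right; exact congrArg Subtype.val h2
    · refine ⟨c0, c0.2, fun h' => hc01 ((Subtype.ext h' : c0 = 1).trans h), fun d hd => ?_⟩
      rcases hall ⟨d, hd⟩ with h2 | h2
      · right; exact congrArg Subtype.val h2
      · left; rw [← h] at h2; exact congrArg Subtype.val h2
  obtain ⟨c, hcker, hc1, hcall⟩ := this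
  -- the odd complement
  let J : Subgroup Gt :=
    { carrier := {g | ε g ∈ I.map φ ∧ g ^ M = 1}
      one_mem' := ⟨by rw [map_one]; exact one_mem _, one_pow _⟩
      mul_mem' := by
        rintro a b ⟨ha, ha'⟩ ⟨hb, hb'⟩
        refine ⟨by rw [map_mul]; exact mul_mem ha hb, ?_⟩
        rw [hM2 a b ha hb, ha', hb', one_mul]
      inv_mem' := by
        rintro a ⟨ha, ha'⟩
        exact ⟨by rw [map_inv]; exact inv_mem ha, by rw [inv_pow, ha', inv_one]⟩ }
  have hJn : J.Normal := ⟨by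
    rintro n ⟨hn, hn'⟩ g
    refine ⟨by simpa using hIn.conj_mem _ hn (ε g), ?_⟩
    rw [conj_pow, hn', mul_one, mul_inv_cancel]⟩
  have hdecomp : ∀ u, ε u ∈ I.map φ → ∃ d ∈ ε.ker, (u : Gt ⧸ J) = (d : Gt ⧸ J) := by
    intro u hu
    refine ⟨u ^ M, hM1 u hu, ?_⟩
    rw [QuotientGroup.eq]
    have hinv : ε u⁻¹ ∈ I.map φ := by rw [map_inv]; exact inv_mem hu
    have hk : ε (u ^ M) ∈ I.map φ := by rw [hM1 u hu]; exact one_mem _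
    refine ⟨by rw [map_mul]; exact mul_mem hinv hk, ?_⟩
    rw [hM2 _ _ hinv hk, hcM _ (hM1 u hu), inv_pow, inv_mul_cancel]
  -- `Gt / J` is commutative
  have hAcomm : ∀ a b : Gt ⧸ J, a * b = b * a := by
    let q : (Gt ⧸ J) →* (G ⧸ I.map φ) := QuotientGroup.map J (I.map φ) ε (fun g hg => hg.1)
    have : IsCyclic (G ⧸ I.map φ) := by
      refine ⟨((φ F : G) : G ⧸ I.map φ), fun x => ?_⟩
      induction x using QuotientGroup.induction_on with
      | H z =>
        obtain ⟨a, rfl⟩ := hφ z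
        obtain ⟨n, hn⟩ := hF a
        refine ⟨n, ?_⟩
        change ((φ F : G) : G ⧸ I.map φ) ^ n = _
        rw [← QuotientGroup.mk_zpow, QuotientGroup.eq]
        have := hIn.mem_comm hn
        exact this
    suffices h : q.ker ≤ Subgroup.center _ by
      have := MonoidHom.isMulCommutative_of_isCyclic_of_ker_le_center q h
      exact fun a b => this.is_comm.comm a b
    intro x hx
    induction x using QuotientGroup.induction_on with
    | H u =>
      have hu : ε u ∈ I.map φ := (QuotientGroup.eq_one_iff _).1 (MonoidHom.mem_ker.1 hx)
      obtain ⟨d, hd, he⟩ := hdecomp u hu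
      rw [he, Subgroup.mem_center_iff]
      intro y
      induction y using QuotientGroup.induction_on with
      | H y =>
        rw [← QuotientGroup.mk_mul, ← QuotientGroup.mk_mul, Subgroup.mem_center_iff.1 (hcentral hd) y]
  have hBcomm : ∀ a b : Γ ⧸ I, a * b = b * a := by
    intro a b
    induction a using QuotientGroup.induction_on with
    | H a =>
    induction b using QuotientGroup.induction_on with
    | H b =>
      rw [← QuotientGroup.mk_mul, ← QuotientGroup.mk_mul, QuotientGroup.eq]
      have := hcomm b⁻¹ a⁻¹
      simpa [mul_assoc] using this
  -- the fibre product
  let E : Subgroup (Γ × Gt) := (φ.comp (MonoidHom.fst Γ Gt)).eqLocus (ε.comp (MonoidHom.snd Γ Gt))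
  let π : Γ × Gt →* (Γ ⧸ I) × (Gt ⧸ J) := (QuotientGroup.mk' I).prodMap (QuotientGroup.mk' J)
  let D : Subgroup ((Γ ⧸ I) × (Gt ⧸ J)) := E.map π
  let : CommGroup D := { (inferInstance : Group D) with
    mul_comm := fun a b => Subtype.ext (Prod.ext (hBcomm _ _) (hAcomm _ _)) }
  have hcE : ((1, c) : Γ × Gt) ∈ E := by
    change φ 1 = ε c
    rw [map_one, MonoidHom.mem_ker.1 hcker]
  let cD : D := ⟨π (1, c), Subgroup.mem_map_of_mem π hcE⟩
  have hns : ∀ d : D, d ^ 2 ≠ cD := by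
    rintro ⟨_, ⟨⟨a, g⟩, hag, rfl⟩⟩ h
    have h' := congrArg Subtype.val h
    have hfst : ((a : Γ ⧸ I)) ^ 2 = 1 := congrArg Prod.fst h'
    have hsnd : ((g : Gt ⧸ J)) ^ 2 = (c : Gt ⧸ J) := congrArg Prod.snd h'
    have haI : a ∈ I := hsq a (by
      rw [← QuotientGroup.mk_pow] at hfst
      exact (QuotientGroup.eq_one_iff _).1 hfst)
    have hg : ε g ∈ I.map φ := by
      have : φ a = ε g := hag
      rw [← this]; exact Subgroup.mem_map_of_mem φ haI
    obtain ⟨d, hd, he⟩ := hdecomp g hg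
    rw [he, ← QuotientGroup.mk_pow, hcsq d hd, QuotientGroup.eq] at hsnd
    have := hsnd.2
    rw [inv_one, one_mul, hcM c hcker] at this
    exact hc1 this
  obtain ⟨χ, hχ⟩ := exists_char_of_not_sq cD hns
  let η : E →* Multiplicative (ZMod 2) := χ.comp (π.subgroupMap E)
  have hηc : η ⟨(1, c), hcE⟩ ≠ 1 := hχ
  have htwo : ∀ x y : Multiplicative (ZMod 2), x ≠ 1 → y ≠ 1 → x * y = 1 := by decide
  let S := η.ker
  let pr : S →* Γ := ((MonoidHom.fst Γ Gt).comp E.subtype).comp S.subtype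
  have hbij : Function.Bijective pr := by
    constructor
    · rw [injective_iff_map_eq_one]
      rintro ⟨⟨⟨a, g⟩, hag⟩, hS⟩ h
      have ha : a = 1 := h
      subst ha
      have hgk : g ∈ ε.ker := by
        have : φ 1 = ε g := hag
        rw [map_one] at this
        exact this.symm
      rcases hcall g hgk with rfl | rfl
      · rfl
      · exact absurd hS hηc
    · intro a
      obtain ⟨g, hg⟩ := hsurj (φ a)
      have hagE : ((a, g) : Γ × Gt) ∈ E := hg.symm
      by_cases h : η ⟨(a, g), hagE⟩ = 1
      · exact ⟨⟨⟨(a, g), hagE⟩, h⟩, rfl⟩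
      · refine ⟨⟨⟨(a, g), hagE⟩ * ⟨(1, c), hcE⟩, ?_⟩, ?_⟩
        · rw [MonoidHom.mem_ker, map_mul]
          exact htwo _ _ h hηc
        · change a * 1 = a
          rw [mul_one]
  let e : S ≃* Γ := MulEquiv.ofBijective pr hbij
  refine ⟨(((MonoidHom.snd Γ Gt).comp E.subtype).comp S.subtype).comp e.symm.toMonoidHom, ?_⟩
  ext a
  have h1 : pr (e.symm a) = a := e.apply_symm_apply a
  have h2 : φ (pr (e.symm a)) = ε (e.symm a).1.1.2 := (e.symm a).1.2
  rw [h1] at h2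
  exact h2.symm

lemma lift_general {Γ G Gt : Type*} [Group Γ] [Group G] [Group Gt]
    (φ : Γ →* G)
    (ε : Gt →* G) (hsurj : Function.Surjective ε)
    (hker : Nat.card ε.ker = 2) (hcentral : ε.ker ≤ Subgroup.center Gt)
    (I : Subgroup Γ) [I.Normal] (hodd : Odd (Nat.card (I.map φ)))
    (hcomm : ∀ a b : Γ, a * b * a⁻¹ * b⁻¹ ∈ I)
    (hsq : ∀ a : Γ, a ^ 2 ∈ I → a ∈ I)
    (F : Γ) (hF : ∀ a : Γ, ∃ n : ℤ, a * (F ^ n)⁻¹ ∈ I ⊔ φ.ker) :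
    ∃ ψ : Γ →* Gt, ε.comp ψ = φ := by
  let T : Subgroup Gt := φ.range.comap ε
  have hkT : ε.ker ≤ T := fun x hx => by
    change ε x ∈ φ.range; rw [MonoidHom.mem_ker.1 hx]; exact one_mem _
  let ε' : T →* φ.range := (ε.comp T.subtype).codRestrict φ.range (fun x => x.2)
  have hmem : ∀ x : T, x ∈ ε'.ker ↔ (x : Gt) ∈ ε.ker := fun x =>
    ⟨fun h => congrArg Subtype.val (MonoidHom.mem_ker.1 h), fun h => Subtype.ext h⟩
  have hcard : Nat.card ε'.ker = 2 := by
    rw [← hker]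
    refine Nat.card_congr ⟨fun x => ⟨x.1.1, (hmem _).1 x.2⟩,
      fun x => ⟨⟨x.1, hkT x.2⟩, (hmem _).2 x.2⟩, fun _ => rfl, fun _ => rfl⟩
  have hmap : (I.map φ.rangeRestrict).map φ.range.subtype = I.map φ := by
    rw [Subgroup.map_map]; rfl
  obtain ⟨ψ, hψ⟩ := lift_of_surjective φ.rangeRestrict φ.rangeRestrict_surjective ε'
    (by
      rintro ⟨_, a, rfl⟩
      obtain ⟨g, hg⟩ := hsurj (φ a)
      exact ⟨⟨g, ⟨a, hg.symm⟩⟩, Subtype.ext hg⟩) hcard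
    (fun x hx => by
      rw [Subgroup.mem_center_iff]
      intro y
      exact Subtype.ext (Subgroup.mem_center_iff.1 (hcentral ((hmem _).1 hx)) y))
    I
    (by
      rw [← hmap, Subgroup.card_map_of_injective (Subgroup.subtype_injective _)] at hodd
      exact hodd)
    hcomm hsq F
    (fun a => by
      obtain ⟨n, hn⟩ := hF a
      refine ⟨n, ?_⟩
      rw [← map_zpow, ← map_inv, ← map_mul]
      obtain ⟨y, hy, z, hz, hyz⟩ := Subgroup.mem_sup_of_normal_left.1 hn
      refine ⟨y, hy, ?_⟩
      rw [← hyz, map_mul]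
      have : φ.rangeRestrict z = 1 := Subtype.ext hz
      rw [this, mul_one])
  refine ⟨T.subtype.comp ψ, ?_⟩
  ext a
  exact congrArg Subtype.val (DFunLike.congr_fun hψ a)


lemma exists_frob_pow {p : ℕ} [Fact p.Prime] {k : Type*} [Field k] [Algebra (ZMod p) k]
    [Algebra.IsAlgebraic (ZMod p) k] (σ : k ≃ₐ[ZMod p] k) (x : k) :
    ∃ j : ℕ, σ x = x ^ (p ^ j) := by
  let L : IntermediateField (ZMod p) k := IntermediateField.adjoin (ZMod p) {x}
  have hfd : FiniteDimensional (ZMod p) L :=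
    IntermediateField.adjoin.finiteDimensional (Algebra.IsIntegral.isIntegral x)
  have : Finite L := Module.finite_of_finite (ZMod p)
  have hx : x ∈ L := IntermediateField.mem_adjoin_simple_self _ x
  obtain ⟨j, hj⟩ := (FiniteField.bijective_frobeniusAlgEquivOfAlgebraic_pow (ZMod p) L).2
    (σ.restrictNormal L)
  refine ⟨j, ?_⟩
  have h1 := AlgEquiv.restrictNormal_commutes σ L ⟨x, hx⟩
  change _ = σ x at h1
  rw [← h1, ← hj]
  simp only [AlgEquiv.coe_pow, FiniteField.coe_frobeniusAlgEquivOfAlgebraic_iterate, ZMod.card]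
  rfl

lemma exists_pow_fixed {p : ℕ} [Fact p.Prime] {k : Type*} [Field k] [Algebra (ZMod p) k]
    [Algebra.IsAlgebraic (ZMod p) k] (x : k) :
    ∃ m : ℕ, 0 < m ∧ x ^ (p ^ m) = x := by
  let L : IntermediateField (ZMod p) k := IntermediateField.adjoin (ZMod p) {x}
  have hfd : FiniteDimensional (ZMod p) L :=
    IntermediateField.adjoin.finiteDimensional (Algebra.IsIntegral.isIntegral x)
  have : Finite L := Module.finite_of_finite (ZMod p)
  have := Fintype.ofFinite L
  have hx : x ∈ L := IntermediateField.mem_adjoin_simple_self _ x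
  refine ⟨Module.finrank (ZMod p) L, Module.finrank_pos, ?_⟩
  have h := FiniteField.pow_card (⟨x, hx⟩ : L)
  rw [Module.card_eq_pow_finrank (K := ZMod p), ZMod.card] at h
  exact congrArg Subtype.val h

lemma pow_pow_mul {k : Type*} [Field k] {p m : ℕ} {x : k} (h : x ^ (p ^ m) = x) (i : ℕ) :
    x ^ (p ^ (m * i)) = x := by
  induction i with
  | zero => simp
  | succ n ih => rw [mul_add, pow_add, pow_mul, ih, mul_one, h]

lemma dvd_of_pow_sub_one_dvd {p a b : ℕ} (hp : 1 < p) (h : p ^ a - 1 ∣ p ^ b - 1) : a ∣ b := by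
  have h1 := Nat.pow_sub_one_gcd_pow_sub_one p a b
  rw [Nat.gcd_eq_left h] at h1
  have h2 : p ^ a = p ^ (a.gcd b) := by
    have := Nat.one_le_pow a p (by omega)
    have := Nat.one_le_pow (a.gcd b) p (by omega)
    omega
  have h3 := Nat.pow_right_injective hp h2
  exact Nat.gcd_eq_left_iff_dvd.1 h3.symm

lemma aut_eq_one_of_sq {p : ℕ} [hp : Fact p.Prime] {k : Type*} [Field k] [Algebra (ZMod p) k]
    [Algebra.IsAlgebraic (ZMod p) k] [IsAlgClosed k] (σ : k ≃ₐ[ZMod p] k) (h : σ ^ 2 = 1) :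
    σ = 1 := by
  ext x
  change σ x = x
  by_cases hx0 : x = 0
  · rw [hx0, map_zero]
  have : CharP k p := charP_of_injective_algebraMap (algebraMap (ZMod p) k).injective p
  obtain ⟨m, hm, hxm⟩ := exists_pow_fixed (p := p) x
  have hxm2 : x ^ (p ^ (m * 2)) = x := pow_pow_mul hxm 2
  have hpos : 1 < p ^ (m * 2) := Nat.one_lt_pow (by omega) hp.out.one_lt
  have hne : NeZero ((p ^ (m * 2) - 1 : ℕ) : k) := ⟨by
    rw [Nat.cast_sub hpos.le, Nat.cast_pow, CharP.cast_eq_zero, zero_pow (by omega)]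
    simp⟩
  have : NeZero (p ^ (m * 2) - 1) := ⟨by omega⟩
  obtain ⟨y, hy⟩ := HasEnoughRootsOfUnity.exists_primitiveRoot k (p ^ (m * 2) - 1)
  obtain ⟨j, hj⟩ := exists_frob_pow σ y
  have hy0 : y ≠ 0 := hy.ne_zero (by omega)
  have hyy : y ^ (p ^ (j * 2)) = y := by
    have h1 : σ (σ y) = y := DFunLike.congr_fun h y
    rw [hj, map_pow, hj, ← pow_mul, ← pow_add] at h1
    rw [mul_two]; exact h1
  have cancel : ∀ (z : k) (n : ℕ), z ≠ 0 → 0 < n → z ^ n = z → z ^ (n - 1) = 1 := by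
    intro z n hz hn hzn
    apply mul_right_cancel₀ hz
    rw [← pow_succ, Nat.sub_add_cancel hn, hzn, one_mul]
  have hd := (hy.pow_eq_one_iff_dvd _).1 (cancel y _ hy0 (Nat.pow_pos hp.out.pos) hyy)
  have hd2 : m * 2 ∣ j * 2 := dvd_of_pow_sub_one_dvd hp.out.one_lt hd
  obtain ⟨i, rfl⟩ := Nat.dvd_of_mul_dvd_mul_right (by norm_num) hd2
  obtain ⟨t, -, rfl⟩ := hy.eq_pow_of_pow_eq_one (cancel x _ hx0 (by omega) hxm2)
  rw [map_pow, hj, ← pow_mul, mul_comm, pow_mul, pow_pow_mul hxm]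

lemma aut_comm {p : ℕ} [hp : Fact p.Prime] {k : Type*} [Field k] [Algebra (ZMod p) k]
    [Algebra.IsAlgebraic (ZMod p) k] (σ τ : k ≃ₐ[ZMod p] k) : σ * τ = τ * σ := by
  ext x
  obtain ⟨i, hi⟩ := exists_frob_pow σ x
  obtain ⟨j, hj⟩ := exists_frob_pow τ x
  change σ (τ x) = τ (σ x)
  rw [hi, hj, map_pow, map_pow, hi, hj, ← pow_mul, ← pow_mul, mul_comm]

lemma exists_generator {p : ℕ} [hp : Fact p.Prime] {k : Type*} [Field k] [Algebra (ZMod p) k]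
    [Algebra.IsAlgebraic (ZMod p) k] {Γ : Type*} [Group Γ] (ρ : Γ →* (k ≃ₐ[ZMod p] k))
    (S : Finset k) :
    ∃ F : Γ, ∀ a : Γ, ∃ n : ℤ, ∀ x ∈ S, ρ (a * (F ^ n)⁻¹) x = x := by
  let L : IntermediateField (ZMod p) k := IntermediateField.adjoin (ZMod p) (S : Set k)
  have hfd : FiniteDimensional (ZMod p) L :=
    IntermediateField.finiteDimensional_adjoin (fun x _ => Algebra.IsIntegral.isIntegral x)
  have : Finite L := Module.finite_of_finite (ZMod p)
  let r : Γ →* (L ≃ₐ[ZMod p] L) := (AlgEquiv.restrictNormalHom L).comp ρ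
  obtain ⟨⟨_, F, rfl⟩, hg⟩ := IsCyclic.exists_generator (α := r.range)
  refine ⟨F, fun a => ?_⟩
  obtain ⟨n, hn⟩ := hg ⟨r a, a, rfl⟩
  refine ⟨n, fun x hx => ?_⟩
  have hn' : r F ^ n = r a := congrArg Subtype.val hn
  have h1 : r (a * (F ^ n)⁻¹) = 1 := by
    rw [map_mul, map_inv, map_zpow, hn', mul_inv_cancel]
  have hxL : x ∈ L := IntermediateField.subset_adjoin _ _ hx
  have h2 := AlgEquiv.restrictNormal_commutes (ρ (a * (F ^ n)⁻¹)) L ⟨x, hxL⟩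
  have h3 : (ρ (a * (F ^ n)⁻¹)).restrictNormal L = 1 := h1
  rw [h3] at h2
  exact h2.symm

open IsLocalRing

lemma integral_iff_norm (p : ℕ) [Fact p.Prime] (x : AlgebraicClosure ℚ_[p]) :
    IsIntegral ℤ_[p] x ↔ ‖x‖ ≤ 1 := by
  have halg : IsIntegral ℚ_[p] x := Algebra.IsIntegral.isIntegral x
  rw [← PadicAlgCl.spectralNorm_eq, spectralNorm, spectralValue_le_one_iff (minpoly.monic halg)]
  constructor
  · intro h n
    rw [minpoly.isIntegrallyClosed_eq_field_fractions' ℚ_[p] h, Polynomial.coeff_map]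
    exact PadicInt.norm_le_one _
  · intro h
    have hl : minpoly ℚ_[p] x ∈ Polynomial.lifts (algebraMap ℤ_[p] ℚ_[p]) := by
      rw [Polynomial.lifts_iff_coeff_lifts]
      intro n
      exact ⟨⟨_, h n⟩, rfl⟩
    obtain ⟨q, hq, -, hqm⟩ := Polynomial.lifts_and_degree_eq_and_monic hl (minpoly.monic halg)
    refine ⟨q, hqm, ?_⟩
    rw [IsScalarTower.algebraMap_eq ℤ_[p] ℚ_[p], ← Polynomial.eval₂_map, hq]
    exact minpoly.aeval _ _

/-- the ring of integers of the algebraic closure -/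
noncomputable abbrev OO (p : ℕ) [Fact p.Prime] : Subalgebra ℤ_[p] (AlgebraicClosure ℚ_[p]) :=
  integralClosure ℤ_[p] (AlgebraicClosure ℚ_[p])

lemma isUnit_OO_iff (p : ℕ) [Fact p.Prime] (x : OO p) : IsUnit x ↔ ‖(x : AlgebraicClosure ℚ_[p])‖ = 1 := by
  have hx := (integral_iff_norm p _).1 x.2
  constructor
  · rintro ⟨u, rfl⟩
    have h := (integral_iff_norm p _).1 (u⁻¹ : (OO p)ˣ).1.2
    have h1 : ((u : OO p) : AlgebraicClosure ℚ_[p]) * ((u⁻¹ : (OO p)ˣ) : OO p) = 1 :=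
      congrArg Subtype.val (Units.mul_inv u)
    have h2 := congrArg norm h1
    rw [norm_mul, norm_one] at h2
    nlinarith [norm_nonneg ((u : OO p) : AlgebraicClosure ℚ_[p]), norm_nonneg (((u⁻¹ : (OO p)ˣ) : OO p) : AlgebraicClosure ℚ_[p])]
  · intro h
    have h0 : (x : AlgebraicClosure ℚ_[p]) ≠ 0 := by
      rw [← norm_ne_zero_iff, h]; exact one_ne_zero
    have hi : IsIntegral ℤ_[p] (x : AlgebraicClosure ℚ_[p])⁻¹ := by
      rw [integral_iff_norm, norm_inv, h, inv_one]
    exact IsUnit.of_mul_eq_one (⟨_, hi⟩ : OO p) (Subtype.ext (mul_inv_cancel₀ h0))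

instance (p : ℕ) [Fact p.Prime] : IsLocalRing (OO p) := by
  refine IsLocalRing.of_nonunits_add ?_
  intro a b ha hb
  have lt : ∀ x : OO p, x ∈ nonunits (OO p) ↔ ‖(x : AlgebraicClosure ℚ_[p])‖ < 1 := fun x => by
    rw [mem_nonunits_iff, isUnit_OO_iff]
    have hx := (integral_iff_norm p _).1 x.2
    exact ⟨fun h => lt_of_le_of_ne hx h, fun h => h.ne⟩
  rw [lt] at *
  exact lt_of_le_of_lt (PadicAlgCl.isNonarchimedean p _ _) (max_lt ha hb)

lemma inMaxIdeal_iff (p : ℕ) [Fact p.Prime] (x : OO p) :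
    InMaxIdeal p x ↔ residue (OO p) x = 0 := by
  rw [residue_eq_zero_iff, mem_maximalIdeal, mem_nonunits_iff, isUnit_OO_iff, InMaxIdeal,
    integral_iff_norm, norm_inv]
  have hx := (integral_iff_norm p _).1 x.2
  constructor
  · rintro (h | h)
    · rw [h, norm_zero]; exact zero_ne_one
    · intro h1
      rw [h1, inv_one] at h
      exact h le_rfl
  · intro h
    by_cases h0 : (x : AlgebraicClosure ℚ_[p]) = 0
    · left; exact h0
    · right
      rw [not_le]
      exact (one_lt_inv₀ (norm_pos_iff.2 h0)).2 (lt_of_le_of_ne hx h)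

/-- the residue field -/
abbrev kk (p : ℕ) [Fact p.Prime] : Type := ResidueField (OO p)

instance (p : ℕ) [hp : Fact p.Prime] : CharP (kk p) p := by
  have h0 : (p : kk p) = 0 := by
    have h1 : residue (OO p) (p : OO p) = 0 := by
      rw [← inMaxIdeal_iff]
      right
      rw [integral_iff_norm, norm_inv, not_le]
      have h2 : ‖((p : OO p) : AlgebraicClosure ℚ_[p])‖ = (p : ℝ)⁻¹ := by
        have h3 : ((p : OO p) : AlgebraicClosure ℚ_[p]) =
            algebraMap ℚ_[p] (AlgebraicClosure ℚ_[p]) p := by simp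
        rw [h3, PadicAlgCl.norm_extends, Padic.norm_p]
      rw [h2, inv_inv]
      exact_mod_cast hp.out.one_lt
    rw [← h1, map_natCast]
  obtain ⟨q, hq⟩ := CharP.exists (kk p)
  have hd : q ∣ p := (CharP.cast_eq_zero_iff (kk p) q p).1 h0
  rcases (Nat.dvd_prime hp.out).1 hd with h | h
  · exact absurd h (CharP.char_ne_one (kk p) q)
  · exact h ▸ hq

noncomputable instance (p : ℕ) [Fact p.Prime] : Algebra (ZMod p) (kk p) := ZMod.algebra _ p

instance (p : ℕ) [hp : Fact p.Prime] : IsAlgClosed (kk p) := by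
  refine IsAlgClosed.of_exists_root _ fun f hf hirr => ?_
  have hl : f ∈ Polynomial.lifts (residue (OO p)) := by
    rw [Polynomial.lifts_iff_coeff_lifts]
    intro n
    exact residue_surjective _
  obtain ⟨q, hq, hdeg, hqm⟩ := Polynomial.lifts_and_degree_eq_and_monic hl hf
  have hd : (q.map (algebraMap (OO p) (AlgebraicClosure ℚ_[p]))).degree ≠ 0 := by
    rw [hqm.degree_map, hdeg]
    exact (Polynomial.degree_pos_of_irreducible hirr).ne'
  obtain ⟨x, hx⟩ := IsAlgClosed.exists_root _ hd
  have hxi : IsIntegral (OO p) x := ⟨q, hqm, by rwa [Polynomial.IsRoot, Polynomial.eval_map] at hx⟩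
  have hxi' : IsIntegral ℤ_[p] x := isIntegral_trans x hxi
  refine ⟨residue _ (⟨x, hxi'⟩ : OO p), ?_⟩
  rw [← hq, Polynomial.eval_map, Polynomial.eval₂_hom]
  have : q.eval (⟨x, hxi'⟩ : OO p) = 0 := by
    apply Subtype.ext
    rw [Polynomial.IsRoot, Polynomial.eval_map] at hx
    have := Polynomial.eval₂_hom (p := q) (algebraMap (OO p) (AlgebraicClosure ℚ_[p])) (⟨x, hxi'⟩ : OO p)
    exact this.symm.trans hx
  rw [this, map_zero]

instance (p : ℕ) [hp : Fact p.Prime] : Algebra.IsAlgebraic (ZMod p) (kk p) := by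
  refine ⟨fun z => ?_⟩
  obtain ⟨x, rfl⟩ := residue_surjective z
  let h : ℤ_[p] →+* kk p := (residue (OO p)).comp (algebraMap ℤ_[p] (OO p))
  have hh : h = (algebraMap (ZMod p) (kk p)).comp PadicInt.toZMod := by
    ext a
    obtain ⟨n, -, hn⟩ := PadicInt.exists_mem_range a
    have hn' := hn
    rw [PadicInt.maximalIdeal_eq_span_p, Ideal.mem_span_singleton] at hn
    obtain ⟨b, hb⟩ := hn
    have ha : a = n + p * b := by rw [← hb]; ring
    rw [ha]
    simp
  obtain ⟨f, hfm, hf⟩ := integralClosure.isIntegral x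
  refine IsIntegral.isAlgebraic ⟨f.map PadicInt.toZMod, hfm.map _, ?_⟩
  rw [Polynomial.eval₂_map, ← hh, ← Polynomial.hom_eval₂, hf, map_zero]

/-- action on the residue field -/
noncomputable def rhoRing (p : ℕ) [Fact p.Prime] : GQp p →* RingAut (kk p) :=
  ResidueField.mapAut.comp
    { toFun := fun σ => ((σ.restrictScalars ℤ_[p]).mapIntegralClosure : OO p ≃ₐ[ℤ_[p]] OO p).toRingEquiv
      map_one' := rfl
      map_mul' := fun _ _ => rfl }

noncomputable def rho (p : ℕ) [Fact p.Prime] : GQp p →* (kk p ≃ₐ[ZMod p] kk p) where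
  toFun σ := AlgEquiv.ofRingEquiv (f := rhoRing p σ) (fun a => by
    have : ((rhoRing p σ).toRingHom.comp (algebraMap (ZMod p) (kk p))) = algebraMap (ZMod p) (kk p) :=
      Subsingleton.elim _ _
    exact DFunLike.congr_fun this a)
  map_one' := by ext x; exact DFunLike.congr_fun (map_one (rhoRing p)) x
  map_mul' a b := by ext x; exact DFunLike.congr_fun (map_mul (rhoRing p) a b) x

lemma rho_residue (p : ℕ) [Fact p.Prime] (σ : GQp p) (x : AlgebraicClosure ℚ_[p])
    (hx : IsIntegral ℤ_[p] x) (hx' : IsIntegral ℤ_[p] (σ x)) :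
    rho p σ (residue (OO p) ⟨x, hx⟩) = residue (OO p) ⟨σ x, hx'⟩ := rfl

lemma isIntegral_gal (p : ℕ) [Fact p.Prime] (σ : GQp p) (x : AlgebraicClosure ℚ_[p])
    (hx : IsIntegral ℤ_[p] x) : IsIntegral ℤ_[p] (σ x) :=
  hx.map (σ.restrictScalars ℤ_[p])

lemma mem_absInertia_iff (p : ℕ) [Fact p.Prime] (σ : GQp p) : σ ∈ absInertia p ↔ rho p σ = 1 := by
  have key : ∀ (x : AlgebraicClosure ℚ_[p]) (hx : IsIntegral ℤ_[p] x), InMaxIdeal p (σ x - x) ↔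
      rho p σ (residue (OO p) ⟨x, hx⟩) = residue (OO p) ⟨x, hx⟩ := by
    intro x hx
    rw [rho_residue p σ x hx (isIntegral_gal p σ x hx), ← sub_eq_zero, ← map_sub]
    exact inMaxIdeal_iff p (⟨σ x, isIntegral_gal p σ x hx⟩ - ⟨x, hx⟩ : OO p)
  constructor
  · intro h
    ext z
    obtain ⟨⟨x, hx⟩, rfl⟩ := residue_surjective z
    exact (key x hx).1 (h x hx)
  · intro h x hx
    rw [key x hx, h]
    rfl

lemma isClosed_stab (p : ℕ) [Fact p.Prime] (z : kk p) : IsClosed {σ : GQp p | rho p σ z = z} := by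
  obtain ⟨⟨x, hx⟩, rfl⟩ := residue_surjective z
  let H : Subgroup (GQp p) := (MulAction.stabilizer (kk p ≃ₐ[ZMod p] kk p) (residue (OO p) ⟨x, hx⟩)).comap (rho p)
  have hle : MulAction.stabilizer (GQp p) x ≤ H := by
    intro σ hσ
    have h1 : σ x = x := hσ
    change rho p σ _ = _
    rw [rho_residue p σ x hx (isIntegral_gal p σ x hx)]
    congr 2
  have hopen : IsOpen (H : Set (GQp p)) :=
    Subgroup.isOpen_mono hle (stabilizer_isOpen_of_isIntegral x)
  exact OpenSubgroup.isClosed ⟨H, hopen⟩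

lemma exists_finset (p : ℕ) [Fact p.Prime] (N : Subgroup (GQp p)) (hN : IsOpen (N : Set (GQp p))) :
    ∃ S : Finset (kk p), ∀ σ : GQp p, (∀ x ∈ S, rho p σ x = x) → σ ∈ (rho p).ker ⊔ N := by
  have hopen : IsOpen (((rho p).ker ⊔ N : Subgroup (GQp p)) : Set (GQp p)) :=
    Subgroup.isOpen_mono le_sup_right hN
  have : CompactSpace (GQp p) := inferInstance
  obtain ⟨S, hS⟩ := hopen.isClosed_compl.isCompact.elim_finite_subfamily_closed
    (fun z : kk p => {σ : GQp p | rho p σ z = z}) (isClosed_stab p) (by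
      rw [Set.eq_empty_iff_forall_notMem]
      rintro σ ⟨h1, h2⟩
      apply h1
      apply (le_sup_left : (rho p).ker ≤ (rho p).ker ⊔ N)
      rw [MonoidHom.mem_ker]
      ext z
      exact Set.mem_iInter.1 h2 z)
  refine ⟨S, fun σ hσ => ?_⟩
  by_contra hc
  have : σ ∈ (((rho p).ker ⊔ N : Subgroup (GQp p)) : Set (GQp p))ᶜ ∩ ⋂ z ∈ S, {σ : GQp p | rho p σ z = z} :=
    ⟨hc, Set.mem_iInter₂.2 hσ⟩
  rw [hS] at this
  exact this

/-- Let `φ : G_{ℚ_p} → G` be a (continuous) homomorphism whose image has inertia subgroup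
of odd order, and let `ε : G̃ → G` be a central extension with kernel of order `2`. Then
the local embedding problem `(φ, ε)` is solvable: there is a homomorphism `ψ : G_{ℚ_p} → G̃`
with `ε ∘ ψ = φ`. -/
theorem local_embedding_problem_solvable_of_odd_inertia
    (p : ℕ) [Fact p.Prime] (G Gt : Type) [Group G] [Group Gt]
    (φ : GQp p →* G) (hφopen : IsOpen (φ.ker : Set (GQp p)))
    (ε : Gt →* G) (hsurj : Function.Surjective ε)
    (hker : Nat.card ε.ker = 2) (hcentral : ε.ker ≤ Subgroup.center Gt)
    (hodd : Odd (Nat.card (φ '' absInertia p : Set G))) :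
    ∃ ψ : GQp p →* Gt, ε.comp ψ = φ := by
  have hset : φ '' absInertia p = ((rho p).ker.map φ : Subgroup G) := by
    ext g
    constructor
    · rintro ⟨σ, hσ, rfl⟩
      exact ⟨σ, (mem_absInertia_iff p σ).1 hσ, rfl⟩
    · rintro ⟨σ, hσ, rfl⟩
      exact ⟨σ, (mem_absInertia_iff p σ).2 hσ, rfl⟩
  rw [hset] at hodd
  obtain ⟨S, hS⟩ := exists_finset p φ.ker hφopen
  obtain ⟨F, hF⟩ := exists_generator (rho p) S
  refine lift_general φ ε hsurj hker hcentral (rho p).ker hodd ?_ ?_ F ?_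
  · intro a b
    rw [MonoidHom.mem_ker, map_mul, map_mul, map_mul, map_inv, map_inv, aut_comm (rho p a)]
    group
  · intro a ha
    rw [MonoidHom.mem_ker, map_pow] at ha
    exact aut_eq_one_of_sq _ ha
  · intro a
    obtain ⟨n, hn⟩ := hF a
    exact ⟨n, hS _ hn⟩
end
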